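/- arXiv:2303.05997 — 2 statements merged into one kernel-verified Lean document; each statement's English description precedes it below -/
import Mathlib

section
/- Let q ≥ 2 be an integer and R a real number with 0 < R ≤ 1. Let L = a_0(z) + a_1(z)σ_q + ⋯ + a_m(z)σ_q^m be an M_q-operator of level R (so a_0, …, a_m ∈ ℚ̄[z] with a_0 nonzero and having no root in the punctured disk D*(0,R)). Then every formal power series f ∈ ℚ̄[[z]] satisfying a_0(z)f(z) + a_1(z)f(z^q) + ⋯ + a_m(z)f(z^{q^m}) = 0 defines an analytic function on the open disk D(0,R). -/
noncomputable section

/-- The derivative `d/dz` of a formal power series over `ℂ`. -/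
def psD (f : PowerSeries ℂ) : PowerSeries ℂ :=
  PowerSeries.mk fun n => ((n : ℂ) + 1) * PowerSeries.coeff (n + 1) f

/-- The Mahler operator `σ_q : f(z) ↦ f(z^q)` on formal power series over `ℂ`. -/
def psSigma (q : ℕ) (f : PowerSeries ℂ) : PowerSeries ℂ :=
  PowerSeries.mk fun n => if q ∣ n then PowerSeries.coeff (n / q) f else 0

/-- The canonical embedding of polynomials into power series. -/
def polyPS : Polynomial ℂ →+* PowerSeries ℂ := Polynomial.coeToPowerSeries.ringHom

/-- The power series `∑ (a n / n!) zⁿ` attached to a sequence `a` of coefficients. -/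
def ePS (a : ℕ → ℂ) : PowerSeries ℂ := PowerSeries.mk fun n => a n / (n.factorial : ℂ)

/-- `IsE a` : the power series `∑ (a n / n!) zⁿ` is an E-function: its coefficients are
algebraic, it satisfies a nonzero linear differential equation over `ℚ̄[z]`, and the size of
the conjugates of the `a n` as well as their common denominators grow at most geometrically. -/
def IsE (a : ℕ → ℂ) : Prop :=
  (∀ n, IsAlgebraic ℚ (a n)) ∧
  (∃ (m : ℕ) (p : ℕ → Polynomial ℂ),
      (∀ i k, IsAlgebraic ℚ ((p i).coeff k)) ∧ (∃ i, i ≤ m ∧ p i ≠ 0) ∧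
      ∑ i ∈ Finset.range (m + 1), polyPS (p i) * psD^[i] (ePS a) = 0) ∧
  (∃ C : ℝ, 0 < C ∧ ∃ d : ℕ → ℕ, ∀ n : ℕ, 1 ≤ n →
      1 ≤ d n ∧ (d n : ℝ) ≤ C ^ n ∧
      (∀ σ : (integralClosure ℚ ℂ) →+* ℂ, ∀ h : a n ∈ integralClosure ℚ ℂ,
        ‖σ ⟨a n, h⟩‖ ≤ C ^ n) ∧
      (∀ i, 1 ≤ i → i ≤ n → IsIntegral ℤ ((d n : ℂ) * a i)))

/-- The value at `α` of the E-function with coefficient sequence `a`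
(E-functions are entire, so this series converges for all `α`). -/
def evalE (a : ℕ → ℂ) (α : ℂ) : ℂ := ∑' n : ℕ, a n / (n.factorial : ℂ) * α ^ n

/-- `IsM q f` : the formal power series `f` is an M_q-function, i.e. it has algebraic
coefficients and satisfies a linear `σ_q`-difference equation over `ℚ̄[z]` with
not-all-zero polynomial coefficients. -/
def IsM (q : ℕ) (f : PowerSeries ℂ) : Prop :=
  (∀ n, IsAlgebraic ℚ (PowerSeries.coeff n f)) ∧
  ∃ (m : ℕ) (p : ℕ → Polynomial ℂ),
    (∀ i k, IsAlgebraic ℚ ((p i).coeff k)) ∧ (∃ i, i ≤ m ∧ p i ≠ 0) ∧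
    ∑ i ∈ Finset.range (m + 1), polyPS (p i) * (psSigma q)^[i] f = 0

/-- `MahlerValue f α v` : the meromorphic extension of (the sum of) the power series `f`
to the open unit disk has no pole at `α` and takes the value `v` there. -/
def MahlerValue (f : PowerSeries ℂ) (α v : ℂ) : Prop :=
  ∃ F : ℂ → ℂ, MeromorphicOn F (Metric.ball (0 : ℂ) 1) ∧
    (∀ᶠ z in nhds (0 : ℂ), HasSum (fun n => PowerSeries.coeff n f * z ^ n) (F z)) ∧
    AnalyticAt ℂ F α ∧ F α = v

/-- The power series `f` converges (hence defines an analytic function) on the open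
disk `D(0,R)`. -/
def AnOnBall (f : PowerSeries ℂ) (R : ℝ) : Prop :=
  ∀ z : ℂ, ‖z‖ < R → Summable fun n => PowerSeries.coeff n f * z ^ n

/-- The value at `z` of (the sum of) the power series `f`. -/
def psEval (f : PowerSeries ℂ) (z : ℂ) : ℂ := ∑' n : ℕ, PowerSeries.coeff n f * z ^ n

/-- `Banal fv α P` : the homogeneous algebraic relation `P` among the values at `α` of the
power series `fv 1, …, fv r` is banal: it is the specialization at `z = α` of some
`Q ∈ ℚ̄[z, X₁, …, X_r]`, homogeneous in `X₁, …, X_r`, with `Q(z, fv 1, …, fv r) = 0`. -/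
def Banal {r : ℕ} (fv : Fin r → PowerSeries ℂ) (α : ℂ) (P : MvPolynomial (Fin r) ℂ) : Prop :=
  ∃ Q : MvPolynomial (Fin r) (Polynomial ℂ),
    (∀ v k, IsAlgebraic ℚ ((MvPolynomial.coeff v Q).coeff k)) ∧
    (∃ e, Q.IsHomogeneous e) ∧
    MvPolynomial.eval₂ polyPS fv Q = 0 ∧
    MvPolynomial.map (Polynomial.evalRingHom α) Q = P

/-- `Eset S` : the set of values at `z = 1` of all E-functions with coefficients in `S`. -/
def Eset (S : Set ℂ) : Set ℂ :=
  {x | ∃ a : ℕ → ℂ, IsE a ∧ (∀ n, a n ∈ S) ∧ x = evalE a 1}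

/-- `Mset q α S` : the set of values at `α` of all M_q-functions with coefficients in `S`
having no pole at `α`. -/
def Mset (q : ℕ) (α : ℂ) (S : Set ℂ) : Set ℂ :=
  {x | ∃ f : PowerSeries ℂ, IsM q f ∧ (∀ n, PowerSeries.coeff n f ∈ S) ∧ MahlerValue f α x}

/-- Absolute convergence of a power series on the closed disk of radius `s`. -/
def AbsSummableAt (s : ℝ) (g : PowerSeries ℂ) : Prop :=
  Summable fun n => ‖PowerSeries.coeff n g‖ * s ^ n

lemma AbsSummableAt.mul {s : ℝ} (hs : 0 ≤ s) {g h : PowerSeries ℂ}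
    (hg : AbsSummableAt s g) (hh : AbsSummableAt s h) : AbsSummableAt s (g * h) := by
  have hprod := Summable.mul_of_nonneg hg hh (fun n => by positivity) (fun n => by positivity)
  have key := summable_sum_mul_antidiagonal_of_summable_mul
    (f := fun n => ‖PowerSeries.coeff n g‖ * s ^ n)
    (g := fun n => ‖PowerSeries.coeff n h‖ * s ^ n) hprod
  refine Summable.of_nonneg_of_le (fun n => by positivity) (fun n => ?_) key
  rw [PowerSeries.coeff_mul]
  refine (mul_le_mul_of_nonneg_right (norm_sum_le _ _) (by positivity)).trans_eq ?_
  rw [Finset.sum_mul]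
  refine Finset.sum_congr rfl fun p hp => ?_
  rw [← Finset.HasAntidiagonal.mem_antidiagonal.mp hp, pow_add, norm_mul]
  ring

lemma absSummableAt_polyPS (s : ℝ) (p : Polynomial ℂ) : AbsSummableAt s (polyPS p) := by
  refine summable_of_ne_finset_zero (s := p.support) fun n hn => ?_
  have : PowerSeries.coeff n (polyPS p) = p.coeff n := Polynomial.coeff_coe p n
  simp [this, Polynomial.notMem_support_iff.mp hn]

lemma exists_mul_X_sub_C_eq_X_pow {s : ℝ} (hs : 0 ≤ s) {ρ : ℂ} (hρ : ρ ≠ 0 → s < ‖ρ‖) :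
    ∃ (g : PowerSeries ℂ) (v : ℕ), AbsSummableAt s g ∧
      g * polyPS (Polynomial.X - Polynomial.C ρ) = PowerSeries.X ^ v := by
  have hpoly : polyPS (Polynomial.X - Polynomial.C ρ) = PowerSeries.X - PowerSeries.C ρ := by
    rw [map_sub]
    exact congrArg₂ _ Polynomial.coe_X (Polynomial.coe_C ρ)
  by_cases h0 : ρ = 0
  · refine ⟨1, 1, ?_, by rw [hpoly, h0, map_zero, sub_zero, one_mul, pow_one]⟩
    simpa using absSummableAt_polyPS s 1
  · refine ⟨PowerSeries.mk fun n => -(ρ⁻¹) ^ (n + 1), 0, ?_, ?_⟩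
    · have hpos : 0 < ‖ρ‖ := norm_pos_iff.mpr h0
      have hgeo := (summable_geometric_of_lt_one (r := s / ‖ρ‖) (by positivity)
        ((div_lt_one hpos).mpr (hρ h0))).mul_left ‖ρ‖⁻¹
      refine hgeo.congr fun n => ?_
      simp only [PowerSeries.coeff_mk, norm_neg, norm_pow, norm_inv, div_pow, inv_pow]
      field_simp
      ring
    · rw [hpoly, mul_sub]
      ext n
      cases n with
      | zero => simp [h0]
      | succ n =>
        simp [PowerSeries.coeff_succ_mul_X, PowerSeries.coeff_one, pow_succ, h0]
        ring

lemma exists_mul_multiset_prod_eq_X_pow {s : ℝ} (hs : 0 ≤ s) (t : Multiset ℂ)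
    (ht : ∀ ρ ∈ t, ρ ≠ 0 → s < ‖ρ‖) :
    ∃ (g : PowerSeries ℂ) (v : ℕ), AbsSummableAt s g ∧
      g * polyPS (t.map fun ρ => Polynomial.X - Polynomial.C ρ).prod = PowerSeries.X ^ v := by
  induction t using Multiset.induction with
  | empty => exact ⟨1, 0, by simpa using absSummableAt_polyPS s 1, by simp⟩
  | cons ρ t ih =>
    obtain ⟨g, v, hg, hgv⟩ := ih fun x hx => ht x (Multiset.mem_cons_of_mem hx)
    obtain ⟨h, w, hh, hhw⟩ := exists_mul_X_sub_C_eq_X_pow hs (ht ρ (Multiset.mem_cons_self ρ t))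
    refine ⟨h * g, w + v, hh.mul hs hg, ?_⟩
    rw [Multiset.map_cons, Multiset.prod_cons, map_mul, pow_add, ← hgv, ← hhw]
    ring

/-- Up to a power of `X`, a nonzero polynomial without roots in `0 < |z| ≤ s` has an inverse
converging absolutely on the closed disk of radius `s`. -/
lemma exists_mul_polyPS_eq_X_pow {s : ℝ} (hs : 0 ≤ s) {p : Polynomial ℂ} (hp : p ≠ 0)
    (hroot : ∀ z : ℂ, z ≠ 0 → ‖z‖ ≤ s → Polynomial.eval z p ≠ 0) :
    ∃ (g : PowerSeries ℂ) (v : ℕ), AbsSummableAt s g ∧ g * polyPS p = PowerSeries.X ^ v := by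
  obtain ⟨g, v, hg, hgv⟩ := exists_mul_multiset_prod_eq_X_pow hs p.roots fun ρ hρ h0 => by
    by_contra! hle
    exact hroot ρ h0 hle (Polynomial.isRoot_of_mem_roots hρ)
  have hlead : p.leadingCoeff ≠ 0 := Polynomial.leadingCoeff_ne_zero.mpr hp
  refine ⟨g * polyPS (Polynomial.C p.leadingCoeff⁻¹), v,
    hg.mul hs (absSummableAt_polyPS s _), ?_⟩
  have hsplit := (IsAlgClosed.splits p).eq_prod_roots
  rw [← hgv, mul_assoc, ← map_mul]
  congr 2
  nth_rw 2 [hsplit]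
  rw [← mul_assoc, ← Polynomial.C_mul, inv_mul_cancel₀ hlead, Polynomial.C_1, one_mul]

lemma coeff_iterate_psSigma {q : ℕ} (hq : 0 < q) (f : PowerSeries ℂ) (i l : ℕ) :
    PowerSeries.coeff l ((psSigma q)^[i] f) = 0 ∨
      ∃ j, q ^ i * j = l ∧ PowerSeries.coeff l ((psSigma q)^[i] f) = PowerSeries.coeff j f := by
  induction i generalizing l with
  | zero => exact Or.inr ⟨l, by simp⟩
  | succ i ih =>
    rw [Function.iterate_succ_apply', psSigma, PowerSeries.coeff_mk]
    split_ifs with h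
    · obtain ⟨k, rfl⟩ := h
      rw [Nat.mul_div_cancel_left k hq]
      refine (ih k).imp id ?_
      rintro ⟨j, rfl, hj⟩
      exact ⟨j, by ring, hj⟩
    · exact Or.inl rfl

/-- Dividing a Mahler equation by its constant coefficient. -/
lemma exists_X_pow_mul_eq_sum {q m : ℕ} {s : ℝ} (hs : 0 ≤ s) {a : ℕ → Polynomial ℂ}
    (ha0 : a 0 ≠ 0) (hroot : ∀ z : ℂ, z ≠ 0 → ‖z‖ ≤ s → Polynomial.eval z (a 0) ≠ 0)
    {f : PowerSeries ℂ}
    (heq : ∑ i ∈ Finset.range (m + 1), polyPS (a i) * (psSigma q)^[i] f = 0) :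
    ∃ (v : ℕ) (h : ℕ → PowerSeries ℂ), (∀ i, AbsSummableAt s (h i)) ∧
      PowerSeries.X ^ v * f = -∑ i ∈ Finset.range m, h i * (psSigma q)^[i + 1] f := by
  obtain ⟨g, v, hg, hgv⟩ := exists_mul_polyPS_eq_X_pow hs ha0 hroot
  refine ⟨v, fun i => g * polyPS (a (i + 1)), fun i => hg.mul hs (absSummableAt_polyPS s _), ?_⟩
  rw [Finset.sum_range_succ'] at heq
  simp only [mul_assoc, ← Finset.mul_sum]
  rw [← hgv, eq_neg_iff_add_eq_zero, mul_assoc, ← mul_add, add_comm]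
  simpa using congrArg (g * ·) heq

lemma norm_coeff_mul_le {s B : ℝ} (hs : 0 ≤ s) {h u : PowerSeries ℂ}
    (hh : AbsSummableAt s h) (N : ℕ) (hB : 0 ≤ B)
    (hu : ∀ l ≤ N, ‖PowerSeries.coeff l u‖ * s ^ l ≤ B) :
    ‖PowerSeries.coeff N (h * u)‖ * s ^ N ≤ (∑' k, ‖PowerSeries.coeff k h‖ * s ^ k) * B := by
  rw [PowerSeries.coeff_mul]
  calc ‖∑ p ∈ Finset.HasAntidiagonal.antidiagonal N, PowerSeries.coeff p.1 h * PowerSeries.coeff p.2 u‖ * s ^ N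
      ≤ (∑ p ∈ Finset.HasAntidiagonal.antidiagonal N,
          ‖PowerSeries.coeff p.1 h‖ * ‖PowerSeries.coeff p.2 u‖) * s ^ N := by
        gcongr
        exact norm_sum_le_of_le _ fun p _ => norm_mul_le _ _
    _ = ∑ p ∈ Finset.HasAntidiagonal.antidiagonal N,
          (‖PowerSeries.coeff p.1 h‖ * s ^ p.1) * (‖PowerSeries.coeff p.2 u‖ * s ^ p.2) := by
        rw [Finset.sum_mul]
        refine Finset.sum_congr rfl fun p hp => ?_
        rw [← Finset.HasAntidiagonal.mem_antidiagonal.mp hp, pow_add]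
        ring
    _ ≤ ∑ p ∈ Finset.HasAntidiagonal.antidiagonal N, (‖PowerSeries.coeff p.1 h‖ * s ^ p.1) * B := by
        refine Finset.sum_le_sum fun p hp => ?_
        gcongr
        exact hu _ (Finset.HasAntidiagonal.mem_antidiagonal.mp hp ▸ Nat.le_add_left _ _)
    _ = (∑ k ∈ Finset.range (N + 1), ‖PowerSeries.coeff k h‖ * s ^ k) * B := by
        rw [← Finset.sum_mul, Finset.Nat.sum_antidiagonal_eq_sum_range_succ_mk]
    _ ≤ _ := by
        gcongr
        exact hh.sum_le_tsum _ fun k _ => by positivity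

/-- The equation bounds each coefficient by those of at most about half its index, so the terms
`‖fₙ‖ sⁿ` grow subexponentially. -/
lemma exists_norm_coeff_mul_pow_le {q m v : ℕ} (hq : 2 ≤ q) {s : ℝ} (hs : 0 < s) (hs1 : s ≤ 1)
    {f : PowerSeries ℂ} {h : ℕ → PowerSeries ℂ} (hh : ∀ i, AbsSummableAt s (h i))
    (heq : PowerSeries.X ^ v * f = -∑ i ∈ Finset.range m, h i * (psSigma q)^[i + 1] f)
    {e : ℝ} (he : 1 < e) :
    ∃ K : ℝ, ∀ n, ‖PowerSeries.coeff n f‖ * s ^ n ≤ K * (e ^ 2) ^ n := by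
  set D : ℝ := ∑ i ∈ Finset.range m, ∑' k, ‖PowerSeries.coeff k (h i)‖ * s ^ k with hD
  obtain ⟨N, hN⟩ := pow_unbounded_of_one_lt (D * e ^ v / s ^ v) he
  set K : ℝ := ∑ n ∈ Finset.range (max N (v + 1)), ‖PowerSeries.coeff n f‖ * s ^ n with hK
  have hK0 : 0 ≤ K := Finset.sum_nonneg fun n _ => by positivity
  refine ⟨K, fun n => ?_⟩
  induction n using Nat.strong_induction_on with
  | _ n ih =>
  rcases lt_or_ge n (max N (v + 1)) with hn | hn
  · calc ‖PowerSeries.coeff n f‖ * s ^ n ≤ K :=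
          Finset.single_le_sum (f := fun n => ‖PowerSeries.coeff n f‖ * s ^ n)
            (fun k _ => by positivity) (Finset.mem_range.mpr hn)
      _ ≤ K * (e ^ 2) ^ n :=
          le_mul_of_one_le_right hK0 (one_le_pow₀ (one_le_pow₀ he.le))
  · have hnN : N ≤ n := (le_max_left _ _).trans hn
    have hnv : v + 1 ≤ n := (le_max_right _ _).trans hn
    have hsigma : ∀ i, ∀ l ≤ n + v,
        ‖PowerSeries.coeff l ((psSigma q)^[i + 1] f)‖ * s ^ l ≤ K * e ^ (n + v) := by
      intro i l hl
      rcases coeff_iterate_psSigma (zero_lt_two.trans_le hq) f (i + 1) l with h0 | ⟨j, hj, hcoeff⟩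
      · rw [h0, norm_zero, zero_mul]
        positivity
      · have h2j : 2 * j ≤ l := by
          rw [← hj]
          exact Nat.mul_le_mul_right j (hq.trans (Nat.le_self_pow (by omega) q))
        calc ‖PowerSeries.coeff l ((psSigma q)^[i + 1] f)‖ * s ^ l
            ≤ ‖PowerSeries.coeff j f‖ * s ^ j := by
              rw [hcoeff]
              gcongr ?_ * ?_
              exact pow_le_pow_of_le_one hs.le hs1 (by omega)
          _ ≤ K * (e ^ 2) ^ j := ih j (by omega)
          _ ≤ K * e ^ (n + v) := by
              rw [← pow_mul]
              gcongr
              · exact he.le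
              · omega
    have hcoeff : ‖PowerSeries.coeff n f‖ * s ^ (n + v) ≤ D * (K * e ^ (n + v)) := by
      have hX : PowerSeries.coeff n f = PowerSeries.coeff (n + v) (PowerSeries.X ^ v * f) := by
        rw [PowerSeries.coeff_X_pow_mul]
      rw [hX, heq, map_neg, norm_neg, map_sum]
      calc _ ≤ (∑ i ∈ Finset.range m,
              ‖PowerSeries.coeff (n + v) (h i * (psSigma q)^[i + 1] f)‖) * s ^ (n + v) := by
            gcongr
            exact norm_sum_le _ _
        _ ≤ D * (K * e ^ (n + v)) := by
            rw [hD, Finset.sum_mul, Finset.sum_mul]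
            exact Finset.sum_le_sum fun i _ =>
              norm_coeff_mul_le hs.le (hh i) _ (by positivity) (hsigma i)
    have hDn : D * e ^ v ≤ e ^ n * s ^ v := by
      rw [← div_le_iff₀ (by positivity)]
      exact hN.le.trans (pow_le_pow_right₀ he.le hnN)
    refine le_of_mul_le_mul_right ?_ (pow_pos hs v)
    calc ‖PowerSeries.coeff n f‖ * s ^ n * s ^ v = ‖PowerSeries.coeff n f‖ * s ^ (n + v) := by ring
      _ ≤ D * (K * e ^ (n + v)) := hcoeff
      _ = D * e ^ v * (K * e ^ n) := by ring
      _ ≤ e ^ n * s ^ v * (K * e ^ n) := by gcongr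
      _ = K * (e ^ 2) ^ n * s ^ v := by ring

/-- Every formal power series `f ∈ ℚ̄[[z]]` annihilated by an
M_q-operator of level `R` (i.e. whose constant coefficient `a 0` is nonzero and has no root
in the punctured disk `D*(0,R)`) defines an analytic function on the open disk `D(0,R)`. -/
theorem solution_of_level_R_operator_is_analytic
    (q : ℕ) (hq : 2 ≤ q) (R : ℝ) (hR0 : 0 < R) (hR1 : R ≤ 1)
    (m : ℕ) (a : ℕ → Polynomial ℂ)
    (haalg : ∀ i k, IsAlgebraic ℚ ((a i).coeff k))
    (ha0 : a 0 ≠ 0)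
    (hroot : ∀ z : ℂ, z ≠ 0 → ‖z‖ < R → Polynomial.eval z (a 0) ≠ 0)
    (f : PowerSeries ℂ) (hfalg : ∀ n, IsAlgebraic ℚ (PowerSeries.coeff n f))
    (heq : ∑ i ∈ Finset.range (m + 1), polyPS (a i) * (psSigma q)^[i] f = 0) :
    AnOnBall f R := by
  intro z hz
  obtain ⟨s, hzs, hsR⟩ := exists_between hz
  obtain ⟨w, hzw, hws⟩ := exists_between hzs
  have hw : 0 < w := (norm_nonneg z).trans_lt hzw
  have hs : 0 < s := hw.trans hws
  obtain ⟨v, h, hh, hdiv⟩ := exists_X_pow_mul_eq_sum hs.le ha0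
    (fun z hz0 hzle => hroot z hz0 (hzle.trans_lt hsR)) heq
  have he : 1 < √(s / w) := by
    rw [Real.lt_sqrt zero_le_one, one_pow]
    exact (one_lt_div hw).mpr hws
  obtain ⟨K, hK⟩ :=
    exists_norm_coeff_mul_pow_le hq hs (hsR.le.trans hR1) hh hdiv he
  rw [Real.sq_sqrt (by positivity)] at hK
  refine Summable.of_norm_bounded ((summable_geometric_of_lt_one (r := ‖z‖ / w) (by positivity)
    ((div_lt_one hw).mpr hzw)).mul_left K) fun n => ?_
  have hcoeff : ‖PowerSeries.coeff n f‖ ≤ K / w ^ n := by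
    refine le_of_mul_le_mul_right ((hK n).trans_eq ?_) (pow_pos hs n)
    rw [div_pow]
    ring
  calc ‖PowerSeries.coeff n f * z ^ n‖ = ‖PowerSeries.coeff n f‖ * ‖z‖ ^ n := by
        rw [norm_mul, norm_pow]
    _ ≤ K / w ^ n * ‖z‖ ^ n := by gcongr
    _ = K * (‖z‖ / w) ^ n := by rw [div_pow]; ring
end
end

section
/- Let q ≥ 2 be an integer and R a real number with 0 < R ≤ 1. Every M_q-function that is analytic on the open disk D(0,R) is annihilated by an M_q-operator of level R; that is, there exist polynomials a_0, …, a_m ∈ ℚ̄[z], with a_0 nonzero and having no root in the punctured disk D*(0,R), such that a_0(z)f(z) + a_1(z)f(z^q) + ⋯ + a_m(z)f(z^{q^m}) = 0. -/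
noncomputable section

section MahlerRelations

open Polynomial
open scoped RatFunc

theorem natDegree_minpoly_eq_of_closed {k M Ω : Type*} [Field k] [Field M] [Field Ω]
    [Algebra k M] [Algebra M Ω] [Algebra k Ω] [IsScalarTower k M Ω]
    (hcl : ∀ x : M, IsIntegral k x → x ∈ (algebraMap k M).range)
    {θ : Ω} (hθ : IsIntegral k θ) :
    (minpoly k θ).natDegree ≤ (minpoly M θ).natDegree := by
  have hdvd := minpoly.dvd_map_of_isScalarTower k M θ
  have hInt : ∀ i, IsIntegral k ((minpoly M θ).coeff i) := fun i =>
    isIntegral_coeff_of_dvd _ _ (minpoly.monic hθ) (minpoly.monic hθ.tower_top) hdvd i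
  obtain ⟨ν, hν⟩ : minpoly M θ ∈ Polynomial.lifts (algebraMap k M) := by
    rw [Polynomial.lifts_iff_coeff_lifts]
    intro n
    exact hcl _ (hInt n)
  have hν' : ν.map (algebraMap k M) = minpoly M θ := hν
  have h0 : aeval θ ν = 0 := by
    rw [← Polynomial.aeval_map_algebraMap M θ ν, hν', minpoly.aeval]
  have hne : ν ≠ 0 := by
    rintro rfl
    rw [Polynomial.map_zero] at hν'
    exact minpoly.ne_zero hθ.tower_top hν'.symm
  calc _ ≤ ν.natDegree := natDegree_le_natDegree (minpoly.degree_le_of_ne_zero k θ hne h0)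
    _ = _ := by rw [← hν', Polynomial.natDegree_map]


/-- Over a base field that is algebraically closed in `M`, elements of `M` that are linearly
independent over the base stay so over any algebraic extension of the base. -/
theorem eq_zero_of_sum_mul_eq_zero_of_isIntegral {k M Ω ι : Type*} [Field k] [Field M] [Field Ω]
    [CharZero k] [Algebra k M] [Algebra M Ω] [Algebra k Ω] [IsScalarTower k M Ω] [Fintype ι]
    (hcl : ∀ x : M, IsIntegral k x → x ∈ (algebraMap k M).range)
    {y : ι → M} (hy : LinearIndependent k y) {ξ : ι → Ω} (hξ : ∀ i, IsIntegral k (ξ i))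
    (h : ∑ i, algebraMap M Ω (y i) * ξ i = 0) : ξ = 0 := by
  have : FiniteDimensional k (IntermediateField.adjoin k (Set.range ξ)) :=
    IntermediateField.finiteDimensional_adjoin (by rintro _ ⟨i, rfl⟩; exact hξ i)
  obtain ⟨θ, hθ⟩ := Field.exists_primitive_element k (IntermediateField.adjoin k (Set.range ξ))
  have hθint : IsIntegral k (θ : Ω) := (Algebra.IsIntegral.isIntegral θ).map
    (IntermediateField.val _)
  have hex : ∀ i, ∃ c : k[X], aeval (θ : Ω) c = ξ i ∧ c.degree < (minpoly k (θ : Ω)).degree := by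
    intro i
    have hmem : (⟨ξ i, IntermediateField.subset_adjoin _ _ ⟨i, rfl⟩⟩ :
        IntermediateField.adjoin k (Set.range ξ)) ∈ IntermediateField.adjoin k {θ} := by
      rw [hθ]; trivial
    rw [← IntermediateField.mem_toSubalgebra,
      IntermediateField.adjoin_simple_toSubalgebra_of_isAlgebraic
        (Algebra.IsAlgebraic.isAlgebraic θ), Algebra.adjoin_singleton_eq_range_aeval] at hmem
    obtain ⟨c, hc⟩ := hmem
    have hc' : aeval (θ : Ω) c = ξ i := by
      have := congrArg (IntermediateField.val _) hc
      simpa [← Polynomial.aeval_algHom_apply] using this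
    refine ⟨c %ₘ minpoly k (θ : Ω), ?_, degree_modByMonic_lt _ (minpoly.monic hθint)⟩
    rw [Polynomial.aeval_modByMonic_eq_self_of_root (minpoly.aeval _ _), hc']
  choose c hc hdeg using hex
  set P : M[X] := ∑ i, C (y i) * (c i).map (algebraMap k M) with hP
  have hP0 : aeval (θ : Ω) P = 0 := by
    rw [hP, map_sum, ← h]
    refine Finset.sum_congr rfl fun i _ => ?_
    rw [map_mul, aeval_C, aeval_map_algebraMap, hc]
  have hPdeg : P.degree < (minpoly M (θ : Ω)).degree := by
    have h1 := natDegree_minpoly_eq_of_closed (M := M) hcl hθint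
    rw [degree_eq_natDegree (minpoly.ne_zero hθint.tower_top)]
    refine lt_of_lt_of_le ?_ (Nat.cast_le.2 h1)
    rw [hP, ← degree_eq_natDegree (minpoly.ne_zero hθint)]
    refine (Polynomial.degree_sum_le _ _).trans_lt ?_
    rw [Finset.sup_lt_iff (bot_lt_iff_ne_bot.2 fun hb =>
      minpoly.ne_zero hθint (degree_eq_bot.1 hb))]
    intro i _
    refine lt_of_le_of_lt ?_ (hdeg i)
    rw [C_mul']
    exact (degree_smul_le _ _).trans degree_map_le
  have hPz : P = 0 := by
    by_contra hne
    exact absurd (minpoly.degree_le_of_ne_zero M _ hne hP0) (not_le.2 hPdeg)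
  have hcz : ∀ i, c i = 0 := by
    intro i
    ext n
    have h2 : ∑ i, (c i).coeff n • y i = 0 := by
      have := congrArg (fun p => p.coeff n) hPz
      simpa [hP, finsetSum_coeff, Algebra.smul_def, mul_comm] using this
    simpa using Fintype.linearIndependent_iff.1 hy _ h2 i
  ext i
  rw [← hc, hcz]; simp

section
attribute [local instance] MvPolynomial.algebraMvPolynomial

/-- If `k` is algebraically closed in `M` then `k(t)` is algebraically closed in `M(t)`. -/
theorem exists_mul_eq_of_isAlgebraic_mvPolynomial {k M M₁ τ : Type*} [Field k] [Field M]
    [Algebra k M] [Field M₁] [Algebra (MvPolynomial τ M) M₁] [IsFractionRing (MvPolynomial τ M) M₁]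
    [Algebra (MvPolynomial τ k) M₁] [IsScalarTower (MvPolynomial τ k) (MvPolynomial τ M) M₁]
    (hcl : ∀ x : M, IsIntegral k x → x ∈ (algebraMap k M).range)
    (x : M₁) (hx : IsAlgebraic (MvPolynomial τ k) x) :
    ∃ a b : MvPolynomial τ k, b ≠ 0 ∧
      algebraMap _ M₁ b * x = algebraMap _ M₁ a := by
  obtain ⟨b, hb, hbx⟩ := hx.exists_integral_multiple
  have h1 : IsIntegral (MvPolynomial τ M) (b • x) := hbx.tower_top
  obtain ⟨r, hr⟩ := IsIntegrallyClosed.isIntegral_iff.1 h1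
  have h2 : IsIntegral (MvPolynomial τ k) r := by
    rw [← hr] at hbx
    exact (isIntegral_algebraMap_iff (IsFractionRing.injective _ _)).1 hbx
  rw [MvPolynomial.isIntegral_iff_isIntegral_coeff] at h2
  have h3 : r ∈ Set.range (MvPolynomial.map (algebraMap k M) (σ := τ)) := by
    rw [MvPolynomial.mem_range_map_iff_coeffs_subset]
    intro c hc
    obtain ⟨n, -, rfl⟩ := MvPolynomial.mem_coeffs_iff.1 hc
    exact hcl _ (h2 n)
  obtain ⟨a, ha⟩ := h3
  refine ⟨a, b, hb, ?_⟩
  rw [← Algebra.smul_def, ← hr, ← ha,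
    IsScalarTower.algebraMap_apply (MvPolynomial τ k) (MvPolynomial τ M) M₁ a]
  rfl

theorem eq_zero_of_sum_mul_eq_zero_of_algebraicIndependent {k M Ω ι : Type*} [Field k] [Field M]
    [Field Ω] [CharZero k] [Algebra k M] [Algebra M Ω] [Algebra k Ω] [IsScalarTower k M Ω]
    [Fintype ι] (hcl : ∀ x : M, IsIntegral k x → x ∈ (algebraMap k M).range)
    {y : ι → M} (hy : LinearIndependent k y) {ξ : ι → Ω}
    (hind : ∀ s : Set ι, AlgebraicIndepOn k ξ s → AlgebraicIndepOn M ξ s)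
    (h : ∑ i, algebraMap M Ω (y i) * ξ i = 0) : ξ = 0 := by
  obtain ⟨s, hs, hsmax⟩ : ∃ s : Set ι, AlgebraicIndepOn k ξ s ∧
      ∀ i, IsAlgebraic (Algebra.adjoin k (ξ '' s)) (ξ i) := by
    obtain ⟨s, hs⟩ := (Set.toFinite {s : Set ι | AlgebraicIndepOn k ξ s}).exists_maximal
      ⟨∅, by
        have := (algebraicIndependent_empty_type_iff (ι := (∅ : Set ι)) (R := k)
          (x := fun i => ξ i)).2 (algebraMap k Ω).injective
        exact this⟩
    refine ⟨s, hs.1, fun i => ?_⟩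
    by_contra hi
    have h1 := AlgebraicIndepOn.insert hs.1 hi
    have h2 : i ∈ s := hs.2 h1 (Set.subset_insert i s) (Set.mem_insert i s)
    exact hi (isAlgebraic_algebraMap (⟨ξ i, Algebra.subset_adjoin ⟨i, h2, rfl⟩⟩ :
      Algebra.adjoin k (ξ '' s)))
  have hM := hind s hs
  let R₀ := MvPolynomial s k
  let R₁ := MvPolynomial s M
  let e₁ : R₁ →+* Ω := (MvPolynomial.aeval (R := M) (fun i : s => ξ i)).toRingHom
  have he₁ : Function.Injective e₁ := hM
  have he₀ : Function.Injective (algebraMap R₀ R₁) :=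
    MvPolynomial.map_injective _ (algebraMap k M).injective
  let g : FractionRing R₁ →+* Ω := IsFractionRing.lift he₁
  have he₀' : Function.Injective ((algebraMap R₁ (FractionRing R₁)).comp (algebraMap R₀ R₁)) :=
    (IsFractionRing.injective R₁ (FractionRing R₁)).comp he₀
  let j : FractionRing R₀ →+* FractionRing R₁ := IsFractionRing.lift he₀'
  let : Algebra (FractionRing R₁) Ω := g.toAlgebra
  let : Algebra (FractionRing R₀) (FractionRing R₁) := j.toAlgebra
  let : Algebra (FractionRing R₀) Ω := (g.comp j).toAlgebra
  let : Algebra R₀ Ω := (e₁.comp (algebraMap R₀ R₁)).toAlgebra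
  have : IsScalarTower (FractionRing R₀) (FractionRing R₁) Ω := .of_algebraMap_eq fun _ => rfl
  have : IsScalarTower R₀ (FractionRing R₀) (FractionRing R₁) := .of_algebraMap_eq fun x =>
    (IsFractionRing.lift_algebraMap he₀' x).symm
  have : IsScalarTower R₀ (FractionRing R₀) Ω := .of_algebraMap_eq fun x => by
    change _ = g (j _)
    rw [IsFractionRing.lift_algebraMap he₀']
    exact (IsFractionRing.lift_algebraMap he₁ _).symm
  have hcast : ∀ m : M, g (algebraMap R₁ _ (MvPolynomial.C m)) = algebraMap M Ω m := fun m => by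
    rw [IsFractionRing.lift_algebraMap he₁]
    exact MvPolynomial.aeval_C _ _
  refine eq_zero_of_sum_mul_eq_zero_of_isIntegral (k := FractionRing R₀) (M := FractionRing R₁)
    (y := fun i => algebraMap R₁ _ (MvPolynomial.C (y i))) ?_ ?_ ?_ ?_
  · intro x hx
    obtain ⟨a, b, hb, hab⟩ := exists_mul_eq_of_isAlgebraic_mvPolynomial hcl x
      ((IsFractionRing.isAlgebraic_iff R₀ (FractionRing R₀) (FractionRing R₁)).2 hx.isAlgebraic)
    have hb' : algebraMap R₀ (FractionRing R₁) b ≠ 0 := fun h0 =>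
      hb (he₀' (by rw [map_zero]; exact h0))
    refine ⟨algebraMap R₀ _ a / algebraMap R₀ _ b, ?_⟩
    rw [map_div₀, ← IsScalarTower.algebraMap_apply, ← IsScalarTower.algebraMap_apply, ← hab,
      mul_div_cancel_left₀ _ hb']
  · rw [← LinearIndependent.iff_fractionRing R₀ (FractionRing R₀), Fintype.linearIndependent_iff]
    intro r hr i
    have h1 : ∑ i, algebraMap R₀ R₁ (r i) * MvPolynomial.C (y i) = 0 := by
      apply IsFractionRing.injective R₁ (FractionRing R₁)
      rw [map_sum, map_zero, ← hr]
      refine Finset.sum_congr rfl fun i _ => ?_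
      rw [map_mul, Algebra.smul_def]
      rfl
    ext n
    have h2 : ∑ i, (r i).coeff n • y i = 0 := by
      have h3 : MvPolynomial.coeff n
          (∑ i, MvPolynomial.map (algebraMap k M) (r i) * MvPolynomial.C (y i)) = 0 := by
        erw [h1]
        rfl
      rw [MvPolynomial.coeff_sum] at h3
      rw [← h3]
      refine Finset.sum_congr rfl fun i _ => ?_
      rw [mul_comm, MvPolynomial.coeff_C_mul, MvPolynomial.coeff_map, Algebra.smul_def, mul_comm]
    simpa using Fintype.linearIndependent_iff.1 hy _ h2 i
  · intro i
    rw [← isAlgebraic_iff_isIntegral, ← IsFractionRing.isAlgebraic_iff R₀]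
    have himg : ξ '' s = Set.range fun i : s => ξ i := Set.image_eq_range _ _
    have halg : ∀ p : R₀, algebraMap R₀ Ω p = MvPolynomial.aeval (fun i : s => ξ i) p :=
      fun p => MvPolynomial.aeval_map_algebraMap M _ p
    have hmem : ∀ p : R₀, algebraMap R₀ Ω p ∈ Algebra.adjoin k (ξ '' s) := fun p => by
      rw [halg, himg, Algebra.adjoin_range_eq_range_aeval]
      exact ⟨p, rfl⟩
    refine (hsmax i).of_ringHom_of_comp_eq
      ((algebraMap R₀ Ω).codRestrict (Algebra.adjoin k (ξ '' s)) hmem) (RingHom.id Ω) ?_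
      Function.injective_id rfl
    rintro ⟨x, hx⟩
    have hx' := hx
    rw [himg, Algebra.adjoin_range_eq_range_aeval] at hx'
    obtain ⟨p, rfl⟩ := hx'
    exact ⟨p, Subtype.ext (halg p)⟩
  · rw [← h]
    refine Finset.sum_congr rfl fun i _ => ?_
    rw [← hcast]
    rfl

end

theorem mem_range_of_isIntegral_of_mem_adjoin {k M τ : Type*} [Field k] [Field M]
    [Algebra k M] {t : τ → M} (ht : AlgebraicIndependent k t) {x : M} (hx : IsIntegral k x)
    (hxt : x ∈ IntermediateField.adjoin k (Set.range t)) : x ∈ (algebraMap k M).range := by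
  obtain ⟨r, s, hrs⟩ := (IntermediateField.mem_adjoin_range_iff k t x).1 hxt
  by_cases hs : s = 0
  · rw [hs, map_zero, div_zero] at hrs
    exact ⟨0, by rw [map_zero, hrs]⟩
  have hs' : MvPolynomial.aeval t s ≠ 0 := fun h => hs (ht (h.trans (map_zero _).symm))
  have hx' : x ∈ integralClosure k M := hx
  have hcl := ht.integralClosure
  set x₁ : integralClosure k M := ⟨x, hx'⟩
  have h1 : MvPolynomial.C x₁ * MvPolynomial.map (algebraMap k (integralClosure k M)) s =
      MvPolynomial.map (algebraMap k (integralClosure k M)) r := by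
    apply hcl
    rw [map_mul, MvPolynomial.aeval_map_algebraMap, MvPolynomial.aeval_map_algebraMap,
      MvPolynomial.aeval_C]
    change x * _ = _
    rw [hrs, div_mul_cancel₀ _ hs']
  obtain ⟨n, hn⟩ := MvPolynomial.ne_zero_iff.1 hs
  have h2 := congrArg (fun p => ((MvPolynomial.coeff n p : integralClosure k M) : M)) h1
  simp only [MvPolynomial.coeff_C_mul, MvPolynomial.coeff_map] at h2
  have h3 : x * algebraMap k M (s.coeff n) = algebraMap k M (r.coeff n) := h2
  refine ⟨r.coeff n / s.coeff n, ?_⟩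
  rw [map_div₀, ← h3, mul_div_cancel_right₀]
  simpa using hn

/-- In a finitely generated field extension, the degrees of the algebraic elements are bounded. -/
theorem exists_natDegree_minpoly_le {k M : Type*} [Field k] [Field M] [Algebra k M]
    [Algebra.EssFiniteType k M] :
    ∃ d : ℕ, ∀ g : M, IsIntegral k g → (minpoly k g).natDegree ≤ d := by
  obtain ⟨s, hs⟩ := exists_isTranscendenceBasis k M
  set E := IntermediateField.adjoin k (Set.range ((↑) : s → M)) with hE
  have : Algebra.IsAlgebraic E M := hs.isAlgebraic_field
  have : Algebra.EssFiniteType E M := Algebra.EssFiniteType.of_comp k E M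
  have : Module.Finite E M := Algebra.finite_of_essFiniteType_of_isAlgebraic
  refine ⟨Module.finrank E M, fun g hg => ?_⟩
  refine (natDegree_minpoly_eq_of_closed (M := E) ?_ hg).trans (minpoly.natDegree_le g)
  intro x hx
  obtain ⟨c, hc⟩ := mem_range_of_isIntegral_of_mem_adjoin hs.1 (hx.map E.val) x.2
  exact ⟨c, Subtype.ext hc⟩

theorem exists_natDegree_minpoly_le_of_mem_adjoin (k : Type*) {L : Type*} [Field k] [Field L]
    [Algebra k L] {S : Set L} (hS : S.Finite) :
    ∃ d, ∀ g ∈ IntermediateField.adjoin k S, (minpoly k g).natDegree ≤ d := by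
  have hEss : Algebra.EssFiniteType k (IntermediateField.adjoin k S) := by
    rw [IntermediateField.essFiniteType_iff]
    exact IntermediateField.fg_adjoin_of_finite hS
  obtain ⟨d, hd⟩ := exists_natDegree_minpoly_le (k := k) (M := IntermediateField.adjoin k S)
  refine ⟨d, fun g hg => ?_⟩
  by_cases hgi : IsIntegral k g
  · have := hd ⟨g, hg⟩ ((isIntegral_algebraMap_iff (FaithfulSMul.algebraMap_injective _ L)).1 hgi)
    rwa [← minpoly.algebraMap_eq (FaithfulSMul.algebraMap_injective _ L)] at this
  · rw [minpoly.eq_zero hgi]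
    simp

/-- The field of formal Laurent series, as fraction field of the ring of power series. -/
abbrev LS (k : Type*) [Field k] := FractionRing (PowerSeries k)

theorem algebraMap_polynomial_powerSeries {k : Type*} [Field k] (p : k[X]) :
    algebraMap k[X] (PowerSeries k) p = (p : PowerSeries k) := by
  rw [PowerSeries.algebraMap_apply']
  simp

instance faithfulSMul_polynomial_LS {k : Type*} [Field k] : FaithfulSMul k[X] (LS k) := by
  rw [faithfulSMul_iff_algebraMap_injective, IsScalarTower.algebraMap_eq k[X] (PowerSeries k),
    RingHom.coe_comp]
  refine (IsFractionRing.injective (PowerSeries k) (LS k)).comp fun a b h => ?_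
  rw [algebraMap_polynomial_powerSeries, algebraMap_polynomial_powerSeries] at h
  exact Polynomial.coe_injective k h

/-- The variable `z` as an element of the field of Laurent series. -/
abbrev zLS (k : Type*) [Field k] : LS k :=
  algebraMap (PowerSeries k) (LS k) PowerSeries.X

/-- The ring homomorphism `k[X] → k((z))` sending `X` to `z⁻¹`. -/
def polyInv (k : Type*) [Field k] : k[X] →+* LS k :=
  (aeval (zLS k)⁻¹).toRingHom

theorem algebraMap_polynomial_X (k : Type*) [Field k] :
    algebraMap k[X] (LS k) X = zLS k := by
  rw [IsScalarTower.algebraMap_apply k[X] (PowerSeries k), algebraMap_polynomial_powerSeries,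
    Polynomial.coe_X]

theorem algebraMap_ratFunc_X (k : Type*) [Field k] :
    algebraMap (RatFunc k) (LS k) RatFunc.X = zLS k := by
  rw [← RatFunc.algebraMap_X, ← IsScalarTower.algebraMap_apply, algebraMap_polynomial_X]

open Classical in
theorem inftyValuation_aeval_inv_le {k : Type*} [Field k] (p : k[X]) :
    RatFunc.inftyValuation k (aeval (RatFunc.X : RatFunc k)⁻¹ p) ≤ 1 := by
  have hC : ∀ a : k, RatFunc.inftyValuation k (algebraMap k (RatFunc k) a) ≤ 1 := by
    intro a
    by_cases ha : a = 0
    · simp [ha]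
    · exact (RatFunc.inftyValuation.C k ha).le
  have hX : RatFunc.inftyValuation k (RatFunc.X : RatFunc k)⁻¹ ≤ 1 := by
    rw [← one_div, RatFunc.inftyValuation.X_inv]
    exact WithZero.exp_le_exp.2 (by norm_num)
  induction p using Polynomial.induction_on' with
  | add p q hp hq =>
    rw [map_add]
    exact (Valuation.map_add _ _ _).trans (max_le hp hq)
  | monomial n a =>
    rw [aeval_monomial, map_mul, map_pow]
    exact mul_le_one' (hC a) (pow_le_one' hX n)

open Classical in
theorem natDegree_coeff_zero_minpoly_le {k : Type*} [Field k] (w : LS k) (N : ℕ)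
    (h0 : IsIntegral k[X] w) (hinf : (polyInv k).IsIntegralElem ((zLS k)⁻¹ ^ N * w)) :
    ((minpoly k[X] w).coeff 0).natDegree ≤ N * (minpoly (RatFunc k) w).natDegree := by
  have hP : minpoly (RatFunc k) w = (minpoly k[X] w).map (algebraMap k[X] (RatFunc k)) :=
    minpoly.isIntegrallyClosed_eq_field_fractions' _ h0
  by_cases hc0 : (minpoly k[X] w).coeff 0 = 0
  · simp [hc0]
  let O := (RatFunc.inftyValuation k).integer
  let toO : k[X] →+* O := (aeval (RatFunc.X : RatFunc k)⁻¹).toRingHom.codRestrict O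
    inftyValuation_aeval_inv_le
  have hcomp : (algebraMap (RatFunc k) (LS k)).comp
      ((algebraMap O (RatFunc k)).comp toO) = polyInv k := RingHom.ext fun p => by
    change algebraMap (RatFunc k) (LS k) (aeval (RatFunc.X : RatFunc k)⁻¹ p) = _
    rw [← aeval_algebraMap_apply, map_inv₀, algebraMap_ratFunc_X]
    rfl
  obtain ⟨p, hpm, hp⟩ := hinf
  obtain ⟨s, hs⟩ : ∃ s : RatFunc k, s = RatFunc.X⁻¹ ^ N := ⟨_, rfl⟩
  have hsu : s ≠ 0 := hs ▸ pow_ne_zero _ (inv_ne_zero RatFunc.X_ne_zero)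
  have hsw : (zLS k)⁻¹ ^ N * w = algebraMap (RatFunc k) _ s * w := by
    rw [hs, map_pow, map_inv₀, algebraMap_ratFunc_X]
  have hroot : aeval (algebraMap (RatFunc k) (LS k) s * w)
      ((p.map toO).map (algebraMap O (RatFunc k))) = 0 := by
    rw [← hsw, Polynomial.map_map, aeval_def, eval₂_map, hcomp, hp]
  have hdvd : (minpoly (RatFunc k) w).scaleRoots s ∣
      (p.map toO).map (algebraMap O (RatFunc k)) := by
    have h1 : minpoly (RatFunc k) w ∣
        ((p.map toO).map (algebraMap O (RatFunc k))).scaleRoots s⁻¹ := by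
      apply minpoly.dvd
      have := scaleRoots_aeval_eq_zero (r := s⁻¹) hroot
      rwa [map_inv₀, inv_mul_cancel_left₀ ((_root_.map_ne_zero _).2 hsu)] at this
    have := scaleRoots_dvd _ _ (r := s) h1
    rwa [← scaleRoots_mul, inv_mul_cancel₀ hsu, scaleRoots_one] at this
  have hPm : (minpoly (RatFunc k) w).Monic := by rw [hP]; exact (minpoly.monic h0).map _
  have hInt := isIntegral_coeff_of_dvd (p.map toO) ((minpoly (RatFunc k) w).scaleRoots s)
    (hpm.map _) ((monic_scaleRoots_iff s).2 hPm) hdvd 0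
  have hv := (Valuation.integer.integers (RatFunc.inftyValuation k)).mem_of_integral hInt
  rw [coeff_scaleRoots, hP, coeff_map, Nat.sub_zero, Valuation.mem_integer_iff, map_mul,
    RatFunc.inftyValuation_apply, RatFunc.inftyValuation.polynomial k hc0, hs, ← pow_mul,
    ← zpow_natCast, inv_zpow', RatFunc.inftyValuation.X_zpow, ← WithZero.exp_add,
    ← WithZero.exp_zero, WithZero.exp_le_exp, ← hP] at hv
  have h5 : (((minpoly k[X] w).coeff 0).natDegree : ℤ) ≤
      N * (minpoly (RatFunc k) w).natDegree := by push_cast at hv; linarith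
  exact_mod_cast h5

theorem eq_zero_of_X_pow_dvd_of_isIntegral {k : Type*} [Field k] (W : PowerSeries k) (N d n : ℕ)
    (h0 : IsIntegral k[X] (algebraMap _ (LS k) W))
    (hinf : (polyInv k).IsIntegralElem ((zLS k)⁻¹ ^ N * algebraMap _ (LS k) W))
    (hd : (minpoly (RatFunc k) (algebraMap _ (LS k) W)).natDegree ≤ d)
    (hn : PowerSeries.X ^ n ∣ W) (hNd : N * d < n) : W = 0 := by
  have hdeg := (natDegree_coeff_zero_minpoly_le _ N h0 hinf).trans (Nat.mul_le_mul_left N hd)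
  have hinj : Function.Injective (algebraMap (PowerSeries k) (LS k)) :=
    IsFractionRing.injective _ _
  have hann := minpoly.aeval k[X] (algebraMap _ (LS k) W)
  have hzero := minpoly.coeff_zero_eq_zero (A := RatFunc k) (h0.tower_top)
  rw [minpoly.isIntegrallyClosed_eq_field_fractions' (RatFunc k) h0, coeff_map,
    FaithfulSMul.algebraMap_eq_zero_iff] at hzero
  generalize minpoly k[X] (algebraMap _ (LS k) W) = P at *
  have hWc : W ∣ algebraMap k[X] (PowerSeries k) (P.coeff 0) := by
    have h1 : aeval W P = 0 := by
      apply hinj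
      rw [map_zero, ← aeval_algebraMap_apply, hann]
    rw [← Polynomial.divX_mul_X_add P, map_add, map_mul, aeval_X, aeval_C,
      add_eq_zero_iff_neg_eq] at h1
    rw [← h1]
    exact (Dvd.intro_left _ rfl).neg_right
  have hc0 : P.coeff 0 = 0 := by
    ext i
    rw [coeff_zero]
    rcases lt_or_ge i n with hi | hi
    · have := PowerSeries.X_pow_dvd_iff.1 (hn.trans hWc) i hi
      rwa [algebraMap_polynomial_powerSeries, Polynomial.coeff_coe] at this
    · exact coeff_eq_zero_of_natDegree_lt (by omega)
  exact hinj ((hzero.1 hc0).trans (map_zero _).symm)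

/-- The `n`-th section operator `∑ aᵢ zⁱ ↦ ∑ a_{Qj+n} zʲ`. -/
def psSection {k : Type*} [Semiring k] (Q n : ℕ) (h : PowerSeries k) : PowerSeries k :=
  PowerSeries.mk fun j => PowerSeries.coeff (Q * j + n) h

theorem coeff_sum_X_pow_mul_expand {k : Type*} [CommRing k] {Q : ℕ} (hQ : Q ≠ 0)
    (w : ℕ → PowerSeries k) (j : ℕ) {r : ℕ} (hr : r < Q) :
    PowerSeries.coeff (Q * j + r)
      (∑ n ∈ Finset.range Q, PowerSeries.X ^ n * PowerSeries.expand Q hQ (w n)) =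
      PowerSeries.coeff j (w r) := by
  rw [map_sum, Finset.sum_eq_single r]
  · rw [PowerSeries.coeff_X_pow_mul', if_pos (by omega), Nat.add_sub_cancel,
      PowerSeries.coeff_expand_mul]
  · intro n hn hnr
    rw [PowerSeries.coeff_X_pow_mul']
    split_ifs with hle
    · refine PowerSeries.coeff_expand_of_not_dvd _ _ _ fun hd => hnr ?_
      have h1 := (Nat.modEq_iff_dvd' hle).2 hd
      have h2 : n % Q = r % Q := h1.trans (by simp [Nat.ModEq])
      rwa [Nat.mod_eq_of_lt hr, Nat.mod_eq_of_lt (Finset.mem_range.1 hn)] at h2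
    · rfl
  · intro h
    exact absurd (Finset.mem_range.2 hr) h

theorem sum_X_pow_mul_expand_psSection {k : Type*} [CommRing k] {Q : ℕ} (hQ : Q ≠ 0)
    (h : PowerSeries k) :
    ∑ n ∈ Finset.range Q, PowerSeries.X ^ n * PowerSeries.expand Q hQ (psSection Q n h) = h := by
  ext i
  rw [← Nat.div_add_mod i Q, coeff_sum_X_pow_mul_expand hQ _ _ (Nat.mod_lt _ (by omega)),
    psSection, PowerSeries.coeff_mk]

theorem eq_zero_of_sum_X_pow_mul_expand {k : Type*} [CommRing k] {Q : ℕ} (hQ : Q ≠ 0)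
    {w : ℕ → PowerSeries k}
    (h : ∑ n ∈ Finset.range Q, PowerSeries.X ^ n * PowerSeries.expand Q hQ (w n) = 0)
    {r : ℕ} (hr : r < Q) : w r = 0 := by
  ext j
  rw [← coeff_sum_X_pow_mul_expand hQ w j hr, h, map_zero, map_zero]

theorem expand_powerSeries_injective {k : Type*} [CommRing k] {Q : ℕ} (hQ : Q ≠ 0) :
    Function.Injective (PowerSeries.expand (R := k) Q hQ) := by
  intro a b h
  ext j
  rw [← PowerSeries.coeff_expand_mul Q hQ a, h, PowerSeries.coeff_expand_mul]

theorem RingHom.IsIntegralElem.map_of_comp {A S : Type*} [CommRing A] [CommRing S]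
    {φ : A →+* S} {τ : S →+* S} {e : A →+* A} (h : τ.comp φ = φ.comp e) {x : S}
    (hx : φ.IsIntegralElem x) : φ.IsIntegralElem (τ x) := by
  have := hx.map τ
  rw [h] at this
  exact this.of_comp

theorem RingHom.IsIntegral.isIntegralElem_comp {A B S : Type*} [CommRing A] [CommRing B]
    [CommRing S] {e : A →+* B} (he : e.IsIntegral) {φ : B →+* S} {x : S}
    (hx : φ.IsIntegralElem x) : (φ.comp e).IsIntegralElem x := by
  algebraize [e, φ, φ.comp e]
  have : Algebra.IsIntegral A B := ⟨he⟩
  exact isIntegral_trans (A := B) x hx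

theorem RingHom.IsIntegralElem.of_map_of_comp {A S : Type*} [CommRing A] [CommRing S]
    {φ : A →+* S} {τ : S →+* S} (hτ : Function.Injective τ) {e : A →+* A} (he : e.IsIntegral)
    (h : τ.comp φ = φ.comp e) {x : S} (hx : φ.IsIntegralElem (τ x)) : φ.IsIntegralElem x := by
  refine RingHom.IsIntegralElem.of_map (g := τ) hτ ?_
  rw [h]
  exact he.isIntegralElem_comp hx

theorem isIntegral_expand (k : Type*) [CommRing k] {Q : ℕ} (hQ : Q ≠ 0) :
    (expand k Q : k[X] →+* k[X]).IsIntegral := by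
  intro p
  induction p using Polynomial.induction_on' with
  | add p q hp hq => exact RingHom.IsIntegralElem.add _ hp hq
  | monomial n a =>
    have hX : (expand k Q : k[X] →+* k[X]).IsIntegralElem X :=
      ⟨X ^ Q - C X, monic_X_pow_sub_C _ hQ, by simp⟩
    have ha : (expand k Q : k[X] →+* k[X]).IsIntegralElem (C a) := by
      have := RingHom.isIntegralElem_map (expand k Q : k[X] →+* k[X]) (x := C a)
      simpa using this
    rw [← C_mul_X_pow_eq_monomial]
    refine RingHom.IsIntegralElem.mul _ ha ?_
    induction n with
    | zero => simpa using RingHom.isIntegralElem_one _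
    | succ n ih => rw [pow_succ]; exact RingHom.IsIntegralElem.mul _ ih hX

/-- The extension of an injective endomorphism of `k⟦z⟧` to its fraction field. -/
def lsMap {k : Type*} [Field k] {j : PowerSeries k →+* PowerSeries k}
    (hj : Function.Injective j) : LS k →+* LS k :=
  IsFractionRing.map hj

theorem lsMap_algebraMap {k : Type*} [Field k] {j : PowerSeries k →+* PowerSeries k}
    (hj : Function.Injective j) (x : PowerSeries k) :
    lsMap hj (algebraMap _ _ x) = algebraMap _ (LS k) (j x) := by
  simp [lsMap, IsFractionRing.map, IsLocalization.map_eq]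

theorem algebraMap_C_LS {k : Type*} [Field k] (c : k) :
    algebraMap (PowerSeries k) (LS k) (PowerSeries.C c) = algebraMap k (LS k) c := by
  rw [IsScalarTower.algebraMap_apply k (PowerSeries k), PowerSeries.algebraMap_eq]

theorem algebraMap_C_polynomial_LS {k : Type*} [Field k] (c : k) :
    algebraMap k[X] (LS k) (C c) = algebraMap k (LS k) c := by
  rw [IsScalarTower.algebraMap_apply k k[X] (LS k), Polynomial.algebraMap_eq]

theorem polyInv_C {k : Type*} [Field k] (c : k) : polyInv k (C c) = algebraMap k (LS k) c := by
  simp [polyInv]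

theorem polyInv_X (k : Type*) [Field k] : polyInv k X = (zLS k)⁻¹ := by
  simp [polyInv]

/-- The substitution `z ↦ z^Q` on Laurent series. -/
def lsExpand (k : Type*) [Field k] {Q : ℕ} (hQ : Q ≠ 0) : LS k →+* LS k :=
  lsMap (j := (PowerSeries.expand (R := k) Q hQ).toRingHom) (expand_powerSeries_injective hQ)

theorem lsExpand_algebraMap {k : Type*} [Field k] {Q : ℕ} (hQ : Q ≠ 0) (x : PowerSeries k) :
    lsExpand k hQ (algebraMap _ _ x) = algebraMap _ (LS k) (PowerSeries.expand Q hQ x) :=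
  lsMap_algebraMap _ _

theorem lsExpand_algebraMap_base {k : Type*} [Field k] {Q : ℕ} (hQ : Q ≠ 0) (c : k) :
    lsExpand k hQ (algebraMap k _ c) = algebraMap k (LS k) c := by
  rw [← algebraMap_C_LS, lsExpand_algebraMap, PowerSeries.expand_C]

theorem lsExpand_zLS {k : Type*} [Field k] {Q : ℕ} (hQ : Q ≠ 0) :
    lsExpand k hQ (zLS k) = zLS k ^ Q := by
  rw [lsExpand_algebraMap, PowerSeries.expand_X, map_pow]

theorem lsExpand_comp_algebraMap {k : Type*} [Field k] {Q : ℕ} (hQ : Q ≠ 0) :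
    (lsExpand k hQ).comp (algebraMap k[X] (LS k)) =
      (algebraMap k[X] (LS k)).comp (expand k Q : k[X] →+* k[X]) := by
  refine Polynomial.ringHom_ext (fun a => ?_) ?_
  · simp [algebraMap_C_polynomial_LS, lsExpand_algebraMap_base]
  · simp only [RingHom.comp_apply, RingHom.coe_coe, expand_X, map_pow,
      algebraMap_polynomial_X, lsExpand_zLS]

theorem lsExpand_comp_polyInv {k : Type*} [Field k] {Q : ℕ} (hQ : Q ≠ 0) :
    (lsExpand k hQ).comp (polyInv k) =
      (polyInv k).comp (expand k Q : k[X] →+* k[X]) := by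
  refine Polynomial.ringHom_ext (fun a => ?_) ?_
  · simp [polyInv_C, lsExpand_algebraMap_base]
  · simp only [RingHom.comp_apply, RingHom.coe_coe, expand_X, map_pow,
      polyInv_X, map_inv₀, lsExpand_zLS, inv_pow]

/-- The substitution `z ↦ cz` on Laurent series. -/
def lsRescale {k : Type*} [Field k] {c : k} (hc : c ≠ 0) : LS k →+* LS k :=
  lsMap (PowerSeries.rescale_injective hc)

theorem lsRescale_algebraMap {k : Type*} [Field k] {c : k} (hc : c ≠ 0) (x : PowerSeries k) :
    lsRescale hc (algebraMap _ _ x) = algebraMap _ (LS k) (PowerSeries.rescale c x) :=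
  lsMap_algebraMap _ _

theorem lsRescale_algebraMap_base {k : Type*} [Field k] {c : k} (hc : c ≠ 0) (a : k) :
    lsRescale hc (algebraMap k _ a) = algebraMap k (LS k) a := by
  rw [← algebraMap_C_LS, lsRescale_algebraMap]
  congr 1
  ext n
  rw [PowerSeries.coeff_rescale, PowerSeries.coeff_C]
  split_ifs with h <;> simp [h]

theorem lsRescale_zLS {k : Type*} [Field k] {c : k} (hc : c ≠ 0) :
    lsRescale hc (zLS k) = algebraMap k _ c * zLS k := by
  rw [lsRescale_algebraMap, PowerSeries.rescale_X, map_mul, algebraMap_C_LS]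

theorem lsRescale_comp_algebraMap {k : Type*} [Field k] {c : k} (hc : c ≠ 0) :
    (lsRescale hc).comp (algebraMap k[X] (LS k)) =
      (algebraMap k[X] (LS k)).comp (compRingHom (C c * X)) := by
  refine Polynomial.ringHom_ext (fun a => ?_) ?_
  · simp [algebraMap_C_polynomial_LS, lsRescale_algebraMap_base]
  · simp [algebraMap_C_polynomial_LS, lsRescale_zLS, algebraMap_polynomial_X]

theorem lsRescale_comp_polyInv {k : Type*} [Field k] {c : k} (hc : c ≠ 0) :
    (lsRescale hc).comp (polyInv k) =
      (polyInv k).comp (compRingHom (C c⁻¹ * X)) := by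
  refine Polynomial.ringHom_ext (fun a => ?_) ?_
  · simp [polyInv_C, lsRescale_algebraMap_base]
  · simp only [RingHom.comp_apply, coe_compRingHom_apply, X_comp, map_mul, polyInv_C, polyInv_X,
      map_inv₀, lsRescale_zLS, mul_inv]

theorem coeff_X_pow_mul_expand_psSection {k : Type*} [CommRing k] {Q : ℕ} (hQ : Q ≠ 0) {n : ℕ}
    (hn : n < Q) (h : PowerSeries k) (l : ℕ) :
    PowerSeries.coeff l (PowerSeries.X ^ n * PowerSeries.expand Q hQ (psSection Q n h)) =
      if n ≡ l [MOD Q] then PowerSeries.coeff l h else 0 := by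
  rw [PowerSeries.coeff_X_pow_mul']
  by_cases hnl : n ≡ l [MOD Q]
  · have hle : n ≤ l := by
      have h1 : n % Q = l % Q := hnl
      rw [Nat.mod_eq_of_lt hn] at h1
      exact h1 ▸ Nat.mod_le _ _
    have hd := (Nat.modEq_iff_dvd' hle).1 hnl
    rw [if_pos hle, if_pos hnl, PowerSeries.coeff_expand, if_pos hd, psSection,
      PowerSeries.coeff_mk, Nat.mul_div_cancel' hd, Nat.sub_add_cancel hle]
  · rw [if_neg hnl]
    split_ifs with hle
    · exact PowerSeries.coeff_expand_of_not_dvd _ _ _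
        fun hd => hnl ((Nat.modEq_iff_dvd' hle).2 hd)
    · rfl

theorem sum_rescale_eq_section {k : Type*} [Field k] {Q : ℕ} (hQ : Q ≠ 0) {n : ℕ}
    (hn : n < Q) {ζ : k} (hζ : IsPrimitiveRoot ζ Q) (h : PowerSeries k) :
    ∑ i ∈ Finset.range Q, PowerSeries.C ((ζ ^ i)⁻¹ ^ n) * PowerSeries.rescale (ζ ^ i) h =
      PowerSeries.C (Q : k) *
        (PowerSeries.X ^ n * PowerSeries.expand Q hQ (psSection Q n h)) := by
  ext l
  rw [PowerSeries.coeff_C_mul, coeff_X_pow_mul_expand_psSection hQ hn, map_sum]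
  simp only [PowerSeries.coeff_C_mul, PowerSeries.coeff_rescale, ← mul_assoc]
  rw [← Finset.sum_mul]
  have hζ0 : ζ ≠ 0 := hζ.ne_zero hQ
  have hterm : ∀ i, (ζ ^ i)⁻¹ ^ n * (ζ ^ i) ^ l = ((ζ ^ n)⁻¹ * ζ ^ l) ^ i := fun i => by
    rw [mul_pow, inv_pow, inv_pow, ← pow_mul, ← pow_mul, ← pow_mul, ← pow_mul, mul_comm n i,
      mul_comm l i]
  simp only [hterm]
  have hfin : IsOfFinOrder ζ := isOfFinOrder_iff_pow_eq_one.2 ⟨Q, by omega, hζ.pow_eq_one⟩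
  have hpow : ζ ^ n = ζ ^ l ↔ n ≡ l [MOD Q] := by
    have := hfin.pow_eq_pow_iff_modEq (n := n) (m := l)
    rwa [← hζ.eq_orderOf] at this
  by_cases hnl : n ≡ l [MOD Q]
  · have : (ζ ^ n)⁻¹ * ζ ^ l = 1 := by
      rw [inv_mul_eq_one₀ (pow_ne_zero _ hζ0)]
      exact hpow.2 hnl
    simp [this, hnl]
  · have hx : (ζ ^ n)⁻¹ * ζ ^ l ≠ 1 := by
      rw [Ne, inv_mul_eq_one₀ (pow_ne_zero _ hζ0)]
      exact fun h => hnl (hpow.1 h)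
    have hx1 : ((ζ ^ n)⁻¹ * ζ ^ l) ^ Q = 1 := by
      rw [mul_pow, inv_pow, ← pow_mul, ← pow_mul, mul_comm n, mul_comm l, pow_mul, pow_mul,
        hζ.pow_eq_one, one_pow, one_pow, inv_one, one_mul]
    rw [geom_sum_eq hx, hx1, if_neg hnl]
    simp

theorem RingHom.IsIntegralElem.sum {A S ι : Type*} [CommRing A] [CommRing S] {φ : A →+* S}
    {s : Finset ι} {x : ι → S} (h : ∀ i ∈ s, φ.IsIntegralElem (x i)) :
    φ.IsIntegralElem (∑ i ∈ s, x i) := by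
  algebraize [φ]
  exact IsIntegral.sum _ h

theorem RingHom.IsIntegralElem.pow {A S : Type*} [CommRing A] [CommRing S] {φ : A →+* S}
    {x : S} (h : φ.IsIntegralElem x) (n : ℕ) : φ.IsIntegralElem (x ^ n) := by
  algebraize [φ]
  exact IsIntegral.pow h n

theorem isIntegralElem_section {k : Type*} [Field k] [CharZero k] {φ : k[X] →+* LS k}
    (hC : ∀ c : k, φ (C c) = algebraMap k (LS k) c)
    (hφ : ∀ (c : k) (hc : c ≠ 0), ∃ e : k[X] →+* k[X], (lsRescale hc).comp φ = φ.comp e)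
    {Q : ℕ} (hQ : Q ≠ 0) {n : ℕ} (hn : n < Q) {ζ : k} (hζ : IsPrimitiveRoot ζ Q)
    (h : PowerSeries k) (N : ℕ)
    (hInt : φ.IsIntegralElem ((zLS k)⁻¹ ^ N * algebraMap _ (LS k) h)) :
    φ.IsIntegralElem ((zLS k)⁻¹ ^ N *
      (zLS k ^ n * lsExpand k hQ (algebraMap _ (LS k) (psSection Q n h)))) := by
  have hCint : ∀ c : k, φ.IsIntegralElem (algebraMap k (LS k) c) := fun c => by
    rw [← hC]
    exact RingHom.isIntegralElem_map _
  have hζ0 : ζ ≠ 0 := hζ.ne_zero hQ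
  have hQ0 : algebraMap k (LS k) (Q : k) ≠ 0 := by
    exact (_root_.map_ne_zero _).2 (Nat.cast_ne_zero.2 hQ)
  have key := congrArg (algebraMap (PowerSeries k) (LS k)) (sum_rescale_eq_section hQ hn hζ h)
  rw [map_sum, map_mul, algebraMap_C_LS, map_mul, map_pow, ← lsExpand_algebraMap] at key
  have h1 : (zLS k)⁻¹ ^ N *
      (zLS k ^ n * lsExpand k hQ (algebraMap _ (LS k) (psSection Q n h))) =
      algebraMap k (LS k) (Q : k)⁻¹ * ∑ i ∈ Finset.range Q,
        algebraMap k (LS k) ((ζ ^ i)⁻¹ ^ n * (ζ ^ i) ^ N) *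
          lsRescale (pow_ne_zero i hζ0) ((zLS k)⁻¹ ^ N * algebraMap _ (LS k) h) := by
    rw [map_inv₀, eq_inv_mul_iff_mul_eq₀ hQ0, mul_left_comm, ← key, Finset.mul_sum]
    refine Finset.sum_congr rfl fun i _ => ?_
    have h0 : algebraMap k (LS k) (ζ ^ i) ≠ 0 :=
      (_root_.map_ne_zero _).2 (pow_ne_zero _ hζ0)
    rw [map_mul, algebraMap_C_LS, map_mul (lsRescale _), map_pow (lsRescale _), map_inv₀,
      lsRescale_zLS, lsRescale_algebraMap, map_mul, mul_inv, mul_pow, map_pow _ (ζ ^ i) N,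
      inv_pow (algebraMap k (LS k) (ζ ^ i))]
    field_simp
  rw [h1]
  refine RingHom.IsIntegralElem.mul _ (hCint _) (RingHom.IsIntegralElem.sum fun i _ => ?_)
  obtain ⟨e, he⟩ := hφ _ (pow_ne_zero i hζ0)
  exact RingHom.IsIntegralElem.mul _ (hCint _) (hInt.map_of_comp he)

theorem isIntegralElem_desubstitution {k : Type*} [Field k] {φ : k[X] →+* LS k} {Q : ℕ}
    (hQ : Q ≠ 0) (hφ : (lsExpand k hQ).comp φ = φ.comp (expand k Q : k[X] →+* k[X]))
    (v : LS k) (n N : ℕ)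
    (hInt : φ.IsIntegralElem ((zLS k)⁻¹ ^ N * (zLS k ^ n * lsExpand k hQ v))) :
    φ.IsIntegralElem ((zLS k)⁻¹ ^ N * (zLS k ^ n * v ^ Q)) := by
  refine RingHom.IsIntegralElem.of_map_of_comp (lsExpand k hQ).injective (isIntegral_expand k hQ)
    hφ ?_
  convert hInt.pow Q using 1
  simp only [map_mul, map_pow, map_inv₀, lsExpand_zLS, mul_pow, inv_pow]
  ring_nf

theorem reflect_polyInv {k : Type*} [Field k] (p : k[X]) (N : ℕ) (hp : p.natDegree ≤ N) :
    polyInv k (reflect N p) = (zLS k)⁻¹ ^ N * algebraMap k[X] (LS k) p := by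
  have hz : zLS k ≠ 0 := by
    rw [Ne, FaithfulSMul.algebraMap_eq_zero_iff]
    exact PowerSeries.X_ne_zero
  let : Invertible (zLS k) := invertibleOfNonzero hz
  have h1 := eval₂_reflect_mul_pow (algebraMap k (LS k)) (zLS k) N p hp
  rw [invOf_eq_inv] at h1
  have h2 : algebraMap k[X] (LS k) p = eval₂ (algebraMap k (LS k)) (zLS k) p := by
    rw [← aeval_def, ← algebraMap_polynomial_X, aeval_algebraMap_apply, aeval_X_left_apply]
  rw [h2, ← h1, mul_comm, mul_assoc, ← mul_pow, mul_inv_cancel₀ hz, one_pow, mul_one]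
  rfl

theorem exists_isIntegralElem_polyInv {k : Type*} [Field k] {x : LS k} (hx : IsIntegral k[X] x) :
    ∃ N : ℕ, (polyInv k).IsIntegralElem ((zLS k)⁻¹ ^ N * x) := by
  obtain ⟨p, hp, hpx⟩ := hx
  obtain ⟨N, hN⟩ : ∃ N, ∀ i, (p.coeff i).natDegree ≤ N := by
    refine ⟨p.support.sup fun i => (p.coeff i).natDegree, fun i => ?_⟩
    by_cases hi : i ∈ p.support
    · exact Finset.le_sup (f := fun i => (p.coeff i).natDegree) hi
    · simp [notMem_support_iff.1 hi]
  refine ⟨N, X ^ p.natDegree +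
    ∑ i ∈ Finset.range p.natDegree, C (reflect (N * (p.natDegree - i)) (p.coeff i)) * X ^ i,
    ?_, ?_⟩
  · refine monic_X_pow_add ((degree_sum_le _ _).trans_lt ?_)
    rw [Finset.sup_lt_iff (WithBot.bot_lt_coe _)]
    intro i hi
    exact (degree_C_mul_X_pow_le _ _).trans_lt (WithBot.coe_lt_coe.2 (Finset.mem_range.1 hi))
  · rw [eval₂_add, eval₂_X_pow, eval₂_finsetSum]
    have h1 : eval₂ (algebraMap k[X] (LS k)) x p = x ^ p.natDegree +
        ∑ i ∈ Finset.range p.natDegree, algebraMap k[X] (LS k) (p.coeff i) * x ^ i := by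
      rw [eval₂_eq_sum_range, Finset.sum_range_succ, hp.coeff_natDegree, map_one, one_mul, add_comm]
    have h2 : ((zLS k)⁻¹ ^ N) ^ p.natDegree * eval₂ (algebraMap k[X] (LS k)) x p = 0 := by
      rw [hpx, mul_zero]
    rw [h1, mul_add, ← mul_pow, Finset.mul_sum] at h2
    rw [← h2]
    congr 1
    refine Finset.sum_congr rfl fun i hi => ?_
    have hi' := Finset.mem_range.1 hi
    rw [eval₂_mul, eval₂_C, eval₂_X_pow, reflect_polyInv _ _ ((hN i).trans
      (Nat.le_mul_of_pos_right _ (by omega))), mul_pow, pow_mul]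
    rw [show ((zLS k)⁻¹ ^ N) ^ p.natDegree =
      ((zLS k)⁻¹ ^ N) ^ (p.natDegree - i) * ((zLS k)⁻¹ ^ N) ^ i by
        rw [← pow_add, Nat.sub_add_cancel hi'.le]]
    ring

theorem exists_eq_sum_zLS_pow_mul_lsExpand {k ι : Type*} [Field k] {Q : ℕ} (hQ : Q ≠ 0)
    (y : ι → LS k)
    (hy : ∀ i, y i ∈ IntermediateField.adjoin (RatFunc k)
      (Set.range fun j => lsExpand k hQ (y j)))
    {x : LS k} (hx : x ∈ IntermediateField.adjoin (RatFunc k) (Set.range y)) :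
    ∃ g : ℕ → LS k, (∀ n, g n ∈ IntermediateField.adjoin (RatFunc k) (Set.range y)) ∧
      x = ∑ n ∈ Finset.range Q, zLS k ^ n * lsExpand k hQ (g n) := by
  let M := IntermediateField.adjoin (RatFunc k) (Set.range y)
  let M' : Subfield (LS k) := M.toSubfield.map (lsExpand k hQ)
  have hzM : zLS k ∈ M := by
    rw [← algebraMap_ratFunc_X]
    exact M.algebraMap_mem _
  have hzQ : zLS k ^ Q ∈ M' := ⟨zLS k, hzM, lsExpand_zLS hQ⟩
  have hcM : ∀ c : k, algebraMap k (LS k) c ∈ M' := fun c => by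
    refine ⟨algebraMap k (LS k) c, ?_, lsExpand_algebraMap_base hQ c⟩
    rw [IsScalarTower.algebraMap_apply k (RatFunc k)]
    exact M.algebraMap_mem _
  let P : M'[X] := X ^ Q - C ⟨zLS k ^ Q, hzQ⟩
  have hPm : P.Monic := monic_X_pow_sub_C _ hQ
  have hPz : aeval (zLS k) P = 0 := by
    simp only [P, map_sub, map_pow, aeval_X, aeval_C]
    exact sub_self _
  let S := IntermediateField.adjoin M' {zLS k}
  have hzS : zLS k ∈ S := IntermediateField.mem_adjoin_simple_self _ _
  have hM'S : ∀ a ∈ M', a ∈ S := fun a ha => S.algebraMap_mem ⟨a, ha⟩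
  have hpoly : ∀ p : k[X], algebraMap k[X] (LS k) p ∈ S := fun p => by
    have h2 : algebraMap k[X] (LS k) p = eval₂ (algebraMap k (LS k)) (zLS k) p := by
      rw [← aeval_def, ← algebraMap_polynomial_X, aeval_algebraMap_apply, aeval_X_left_apply]
    rw [h2, eval₂_eq_sum_range]
    exact S.sum_mem fun i _ => S.mul_mem (hM'S _ (hcM _)) (S.pow_mem hzS i)
  let T : IntermediateField (RatFunc k) (LS k) := S.toSubfield.toIntermediateField fun r => by
    rw [← RatFunc.num_div_denom r, map_div₀, ← IsScalarTower.algebraMap_apply,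
      ← IsScalarTower.algebraMap_apply]
    exact S.div_mem (hpoly _) (hpoly _)
  have hMT : M ≤ T := by
    rw [IntermediateField.adjoin_le_iff]
    rintro _ ⟨i, rfl⟩
    have h1 : IntermediateField.adjoin (RatFunc k)
        (Set.range fun j => lsExpand k hQ (y j)) ≤ T := by
      rw [IntermediateField.adjoin_le_iff]
      rintro _ ⟨j, rfl⟩
      exact hM'S _ ⟨y j, IntermediateField.subset_adjoin _ _ ⟨j, rfl⟩, rfl⟩
    exact h1 (hy i)
  have hxS : x ∈ S := hMT hx
  have hInt : IsIntegral M' (zLS k) := ⟨P, hPm, hPz⟩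
  obtain ⟨p, hp⟩ : ∃ p : M'[X], aeval (zLS k) p = x := by
    have : x ∈ S.toSubalgebra := hxS
    rw [IntermediateField.adjoin_simple_toSubalgebra_of_isAlgebraic hInt.isAlgebraic,
      Algebra.adjoin_singleton_eq_range_aeval] at this
    exact this
  rw [← aeval_modByMonic_eq_self_of_root hPz] at hp
  have hdeg : (p %ₘ P).natDegree < Q := by
    have h1 : P.natDegree = Q := natDegree_X_pow_sub_C
    rw [← h1]
    refine natDegree_modByMonic_lt _ hPm fun h => hQ ?_
    rw [← h1, h, natDegree_one]
  have hg : ∀ n, ∃ g ∈ M, lsExpand k hQ g = ((p %ₘ P).coeff n : LS k) := fun n =>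
    ((p %ₘ P).coeff n).2
  choose g hgM hg using hg
  refine ⟨g, hgM, ?_⟩
  rw [← hp, aeval_eq_sum_range' hdeg]
  refine Finset.sum_congr rfl fun n _ => ?_
  rw [hg, mul_comm]
  rfl

theorem psSection_mem_adjoin {k ι : Type*} [Field k] {Q : ℕ} (hQ : Q ≠ 0) (y : ι → LS k)
    (hy : ∀ i, y i ∈ IntermediateField.adjoin (RatFunc k)
      (Set.range fun j => lsExpand k hQ (y j)))
    {h : PowerSeries k}
    (hh : algebraMap _ (LS k) h ∈ IntermediateField.adjoin (RatFunc k) (Set.range y))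
    {n : ℕ} (hn : n < Q) :
    algebraMap _ (LS k) (psSection Q n h) ∈
      IntermediateField.adjoin (RatFunc k) (Set.range y) := by
  obtain ⟨g, hgM, hg⟩ := exists_eq_sum_zLS_pow_mul_lsExpand hQ y hy hh
  obtain ⟨b, hb⟩ := IsLocalization.exist_integer_multiples (nonZeroDivisors (PowerSeries k))
    (Finset.range Q) g
  choose! u hu using hb
  have hb0 : algebraMap _ (LS k) (b : PowerSeries k) ≠ 0 := by
    rw [Ne, FaithfulSMul.algebraMap_eq_zero_iff]
    exact nonZeroDivisors.ne_zero b.2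
  have hsum : ∑ n ∈ Finset.range Q, PowerSeries.X ^ n *
      PowerSeries.expand Q hQ ((b : PowerSeries k) * psSection Q n h - u n) = 0 := by
    apply IsFractionRing.injective (PowerSeries k) (LS k)
    rw [map_zero]
    simp only [map_sub, map_mul, mul_sub, Finset.sum_sub_distrib]
    rw [sub_eq_zero]
    have h1 : ∑ n ∈ Finset.range Q, PowerSeries.X ^ n *
        (PowerSeries.expand Q hQ (b : PowerSeries k) * PowerSeries.expand Q hQ (psSection Q n h)) =
        PowerSeries.expand Q hQ (b : PowerSeries k) * h := by
      conv_rhs => rw [← sum_X_pow_mul_expand_psSection hQ h, Finset.mul_sum]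
      exact Finset.sum_congr rfl fun n _ => mul_left_comm _ _ _
    rw [h1, map_mul, hg, Finset.mul_sum, map_sum]
    refine Finset.sum_congr rfl fun i hi => ?_
    rw [map_mul, map_pow, ← lsExpand_algebraMap, ← lsExpand_algebraMap, hu i hi,
      Algebra.smul_def, map_mul]
    ring
  have h2 := eq_zero_of_sum_X_pow_mul_expand hQ hsum hn
  have h3 : algebraMap _ (LS k) (psSection Q n h) = g n := by
    have h4 := congrArg (algebraMap _ (LS k)) (sub_eq_zero.1 h2)
    rw [map_mul, hu n (Finset.mem_range.2 hn), Algebra.smul_def] at h4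
    exact mul_left_cancel₀ hb0 h4
  rw [h3]
  exact hgM n

theorem eq_zero_of_isIntegralElem_expand {k : Type*} [Field k] {Q : ℕ} (hQ : Q ≠ 0)
    (v : PowerSeries k) (n N d e : ℕ)
    (h0 : (algebraMap k[X] (LS k)).IsIntegralElem
      (zLS k ^ n * lsExpand k hQ (algebraMap _ (LS k) v)))
    (hinf : (polyInv k).IsIntegralElem
      ((zLS k)⁻¹ ^ N * (zLS k ^ n * lsExpand k hQ (algebraMap _ (LS k) v))))
    (hd : (minpoly (RatFunc k) (zLS k ^ n * (algebraMap _ (LS k) v) ^ Q)).natDegree ≤ d)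
    (he : PowerSeries.X ^ e ∣ PowerSeries.X ^ n * v ^ Q) (hNe : N * d < e) : v = 0 := by
  have h0' := isIntegralElem_desubstitution hQ (lsExpand_comp_algebraMap hQ)
    (algebraMap _ (LS k) v) n 0 (by simpa using h0)
  have hinf' := isIntegralElem_desubstitution hQ (lsExpand_comp_polyInv hQ) _ n N hinf
  have hW : zLS k ^ n * (algebraMap _ (LS k) v) ^ Q =
      algebraMap _ (LS k) (PowerSeries.X ^ n * v ^ Q) := by
    rw [map_mul, map_pow, map_pow]
  rw [hW] at h0' hinf' hd
  rw [pow_zero, one_mul] at h0'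
  have := eq_zero_of_X_pow_dvd_of_isIntegral _ N d e h0' hinf' hd he hNe
  rcases mul_eq_zero.1 this with h | h
  · exact absurd h (pow_ne_zero _ PowerSeries.X_ne_zero)
  · exact pow_eq_zero_iff hQ |>.1 h

/-- Power series that are algebraic, integral over the polynomials, and lie in a finitely
generated field stable under desubstitution are polynomials. -/
theorem exists_polynomial_of_isIntegral_of_mem_adjoin {ι : Type*} [Finite ι]
    (y : ι → LS ℂ)
    (hy : ∀ B : ℕ, ∃ (Q : ℕ) (hQ : Q ≠ 0), B < Q ∧ ∀ i, y i ∈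
      IntermediateField.adjoin (RatFunc ℂ) (Set.range fun j => lsExpand ℂ hQ (y j)))
    {h : PowerSeries ℂ} (hInt : IsIntegral ℂ[X] (algebraMap _ (LS ℂ) h))
    (hM : algebraMap _ (LS ℂ) h ∈ IntermediateField.adjoin (RatFunc ℂ) (Set.range y)) :
    ∃ p : ℂ[X], h = p := by
  obtain ⟨N, hN⟩ := exists_isIntegralElem_polyInv hInt
  obtain ⟨d, hd⟩ := exists_natDegree_minpoly_le_of_mem_adjoin (RatFunc ℂ) (Set.finite_range y)
  obtain ⟨Q, hQ, hQB, hyQ⟩ := hy ((N + N * d) * d)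
  have hζ := Complex.isPrimitiveRoot_exp Q hQ
  have hzM : zLS ℂ ∈ IntermediateField.adjoin (RatFunc ℂ) (Set.range y) := by
    rw [← algebraMap_ratFunc_X]
    exact (IntermediateField.adjoin _ _).algebraMap_mem _
  have hcM : ∀ c : ℂ, algebraMap ℂ (LS ℂ) c ∈
      IntermediateField.adjoin (RatFunc ℂ) (Set.range y) := fun c => by
    rw [IsScalarTower.algebraMap_apply ℂ (RatFunc ℂ)]
    exact (IntermediateField.adjoin _ _).algebraMap_mem _
  have hz0 : zLS ℂ ≠ 0 := by
    rw [Ne, FaithfulSMul.algebraMap_eq_zero_iff]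
    exact PowerSeries.X_ne_zero
  have key : ∀ n < Q, ∃ c : ℂ, psSection Q n h = PowerSeries.C c := by
    intro n hn
    have hgM := psSection_mem_adjoin hQ y hyQ hM hn
    have h0 := isIntegralElem_section algebraMap_C_polynomial_LS
      (fun c hc => ⟨_, lsRescale_comp_algebraMap hc⟩) hQ hn hζ h 0
      (by rw [pow_zero, one_mul]; exact hInt)
    have hinf := isIntegralElem_section polyInv_C
      (fun c hc => ⟨_, lsRescale_comp_polyInv hc⟩) hQ hn hζ h N hN
    rw [pow_zero, one_mul] at h0
    generalize psSection Q n h = g at *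
    rcases lt_or_ge (N * d) n with hnN | hnN
    · refine ⟨0, ?_⟩
      rw [map_zero]
      exact eq_zero_of_isIntegralElem_expand hQ g n N d n h0 hinf
        (hd _ (mul_mem (pow_mem hzM _) (pow_mem hgM _))) (dvd_mul_right _ _) hnN
    · refine ⟨PowerSeries.constantCoeff g, ?_⟩
      obtain ⟨c, hc⟩ : ∃ c, c = PowerSeries.constantCoeff g := ⟨_, rfl⟩
      rw [← hc, ← sub_eq_zero]
      have hmap : algebraMap _ (LS ℂ) (g - PowerSeries.C c) =
          algebraMap _ (LS ℂ) g - algebraMap ℂ (LS ℂ) c := by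
        rw [map_sub, algebraMap_C_LS]
      have hx : zLS ℂ ^ n * lsExpand ℂ hQ (algebraMap _ (LS ℂ) (g - PowerSeries.C c)) =
          zLS ℂ ^ n * lsExpand ℂ hQ (algebraMap _ (LS ℂ) g) -
            algebraMap ℂ[X] (LS ℂ) (C c * X ^ n) := by
        rw [hmap, map_sub, mul_sub, lsExpand_algebraMap_base, map_mul, map_pow,
          algebraMap_C_polynomial_LS, algebraMap_polynomial_X, mul_comm (algebraMap ℂ (LS ℂ) c)]
      refine eq_zero_of_isIntegralElem_expand hQ _ n (N + N * d) d Q ?_ ?_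
        (hd _ (mul_mem (pow_mem hzM _) (pow_mem ?_ _))) ?_ hQB
      · rw [hx]
        exact RingHom.IsIntegralElem.sub _ h0 (RingHom.isIntegralElem_map _)
      · rw [hx, mul_sub]
        refine RingHom.IsIntegralElem.sub _ ?_ ?_
        · rw [pow_add, mul_comm ((zLS ℂ)⁻¹ ^ N), mul_assoc, ← polyInv_X ℂ, ← map_pow]
          exact RingHom.IsIntegralElem.mul _ (RingHom.isIntegralElem_map _)
            (by rw [polyInv_X]; exact hinf)
        · rw [← reflect_polyInv _ _ ((natDegree_C_mul_X_pow_le _ _).trans (by omega))]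
          exact RingHom.isIntegralElem_map _
      · rw [hmap]
        exact sub_mem hgM (hcM c)
      · refine (pow_dvd_pow_of_dvd ?_ Q).mul_left _
        rw [PowerSeries.X_dvd_iff, map_sub, hc, PowerSeries.constantCoeff_C, sub_self]
  choose! c hc using key
  refine ⟨∑ n ∈ Finset.range Q, C (c n) * X ^ n, ?_⟩
  rw [← sum_X_pow_mul_expand_psSection hQ h, ← Polynomial.coeToPowerSeries.ringHom_apply, map_sum]
  refine Finset.sum_congr rfl fun n hn => ?_
  rw [hc n (Finset.mem_range.1 hn), PowerSeries.expand_C, map_mul, map_pow, mul_comm]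
  simp

/-- The exponent vector of bounded exponents. -/
def boundedExponent {ι : Type*} [Finite ι] {n : ℕ} (v : ι → Fin n) : ι →₀ ℕ :=
  Finsupp.equivFunOnFinite.symm fun i => (v i : ℕ)

theorem boundedExponent_injective {ι : Type*} [Finite ι] {n : ℕ} :
    Function.Injective (boundedExponent : (ι → Fin n) → ι →₀ ℕ) := by
  intro v w h
  funext i
  exact Fin.ext (DFunLike.congr_fun h i)

open Classical in
/-- The polynomial with coefficient array `c`. -/
def boundedPolynomial {K ι : Type*} [Field K] [Fintype ι] {n : ℕ}
    (c : Fin (n + 1) × (ι → Fin (n + 1)) → K) : MvPolynomial ι K[X] :=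
  ∑ x, MvPolynomial.monomial (boundedExponent x.2) (monomial x.1 (c x))

theorem boundedPolynomial_coeff {K ι : Type*} [Field K] [Fintype ι] {n : ℕ}
    (c : Fin (n + 1) × (ι → Fin (n + 1)) → K) (x : Fin (n + 1) × (ι → Fin (n + 1))) :
    (MvPolynomial.coeff (boundedExponent x.2) (boundedPolynomial c)).coeff x.1 = c x := by
  classical
  rw [boundedPolynomial, MvPolynomial.coeff_sum, Polynomial.finsetSum_coeff,
    Finset.sum_eq_single x]
  · simp
  · intro y _ hyx
    rw [MvPolynomial.coeff_monomial]
    split_ifs with h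
    · rw [coeff_monomial, if_neg]
      exact fun h1 => hyx (Prod.ext (Fin.ext h1) (boundedExponent_injective h))
    · simp
  · simp

theorem natDegree_coeff_boundedPolynomial_le {K ι : Type*} [Field K] [Fintype ι] {n : ℕ}
    (c : Fin (n + 1) × (ι → Fin (n + 1)) → K) (v : ι →₀ ℕ) :
    (MvPolynomial.coeff v (boundedPolynomial c)).natDegree ≤ n := by
  classical
  rw [boundedPolynomial, MvPolynomial.coeff_sum]
  refine natDegree_sum_le_of_forall_le _ _ fun x _ => ?_
  rw [MvPolynomial.coeff_monomial]
  split_ifs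
  · exact (natDegree_monomial_le _).trans (Nat.lt_succ_iff.1 x.1.2)
  · simp

theorem totalDegree_boundedPolynomial_le {K ι : Type*} [Field K] [Fintype ι] {n : ℕ}
    (c : Fin (n + 1) × (ι → Fin (n + 1)) → K) :
    (boundedPolynomial c).totalDegree ≤ Fintype.card ι * n := by
  refine MvPolynomial.totalDegree_finsetSum_le fun x _ => ?_
  refine (MvPolynomial.totalDegree_monomial_le (R := K[X]) _ _).trans ?_
  rw [Finsupp.sum_fintype _ _ (fun _ => rfl)]
  refine (Finset.sum_le_card_nsmul _ _ n fun i _ => ?_).trans (by simp)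
  exact Nat.lt_succ_iff.1 (x.2 i).2

/-- Auxiliary polynomials: a nontrivial combination of powers of `F` that vanishes to
high order at `z = 0`. -/
theorem exists_C_X_pow_dvd_sum {K ι : Type*} [Field K] [Fintype ι]
    (F : MvPolynomial ι (PowerSeries K)) (p n e : ℕ) (he : ∀ i, F.degreeOf i ≤ e)
    (hcard : p * (n * (1 + e) + 1) ^ Fintype.card ι < (n + 1) ^ (Fintype.card ι + 2)) :
    ∃ c : ℕ → Fin (n + 1) × (ι → Fin (n + 1)) → K,
      (∃ j, j ≤ n ∧ c j ≠ 0) ∧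
      MvPolynomial.C (PowerSeries.X ^ p) ∣ ∑ j ∈ Finset.range (n + 1),
        MvPolynomial.map (algebraMap K[X] (PowerSeries K)) (boundedPolynomial (c j)) * F ^ j := by
  classical
  let B : Fin (n + 1) × (Fin (n + 1) × (ι → Fin (n + 1))) → MvPolynomial ι (PowerSeries K) :=
    fun x => MvPolynomial.monomial (boundedExponent x.2.2)
      (PowerSeries.X ^ (x.2.1 : ℕ)) * F ^ (x.1 : ℕ)
  let Φ : (Fin (n + 1) × (Fin (n + 1) × (ι → Fin (n + 1))) → K) →ₗ[K]
      (Fin p × (ι → Fin (n * (1 + e) + 1)) → K) :=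
    (LinearMap.pi fun y => (PowerSeries.coeff (y.1 : ℕ)).comp
      ((MvPolynomial.lcoeff (PowerSeries K) (boundedExponent y.2)).restrictScalars K)).comp
        (Fintype.linearCombination K B)
  have hker : Φ.ker ≠ ⊥ := by
    apply LinearMap.ker_ne_bot_of_finrank_lt
    simp only [Module.finrank_fintype_fun_eq_card, Fintype.card_prod, Fintype.card_fun,
      Fintype.card_fin]
    calc _ < _ := hcard
      _ = _ := by ring
  obtain ⟨c, hc, hc0⟩ := Submodule.exists_mem_ne_zero_of_ne_bot hker
  refine ⟨fun j x => if h : j < n + 1 then c (⟨j, h⟩, x) else 0, ?_, ?_⟩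
  · by_contra! hcon
    refine hc0 (funext fun x => ?_)
    have := congrFun (hcon x.1 (Nat.lt_succ_iff.1 x.1.2)) x.2
    simpa [Nat.lt_succ_iff.1 x.1.2] using this
  · have hsum : ∑ j ∈ Finset.range (n + 1),
        MvPolynomial.map (algebraMap K[X] (PowerSeries K)) (boundedPolynomial
          (fun x => if h : j < n + 1 then c (⟨j, h⟩, x) else 0)) * F ^ j =
        Fintype.linearCombination K B c := by
      rw [Finset.sum_range, Fintype.linearCombination_apply, Fintype.sum_prod_type]
      refine Finset.sum_congr rfl fun j _ => ?_
      rw [boundedPolynomial, map_sum, Finset.sum_mul]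
      refine Finset.sum_congr rfl fun x _ => ?_
      rw [dif_pos j.2, MvPolynomial.map_monomial, ← smul_mul_assoc, MvPolynomial.smul_monomial,
        algebraMap_polynomial_powerSeries]
      congr 2
      rw [← C_mul_X_pow_eq_monomial, Polynomial.coe_mul, Polynomial.coe_C, Polynomial.coe_pow,
        Polynomial.coe_X, PowerSeries.smul_eq_C_mul]
    rw [hsum, MvPolynomial.C_dvd_iff_dvd_coeff]
    intro w
    rw [PowerSeries.X_pow_dvd_iff]
    intro l hl
    by_cases hw : ∀ i, w i < n * (1 + e) + 1
    · have h1 := congrFun (LinearMap.mem_ker.1 hc) (⟨l, hl⟩, fun i => ⟨w i, hw i⟩)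
      have hw' : boundedExponent (fun i => (⟨w i, hw i⟩ : Fin (n * (1 + e) + 1))) = w := by
        ext i
        rfl
      simpa [Φ, hw'] using h1
    · push Not at hw
      obtain ⟨i, hi⟩ := hw
      rw [MvPolynomial.notMem_support_iff.1, map_zero]
      intro hmem
      have h1 := MvPolynomial.monomial_le_degreeOf i hmem
      have h2 : MvPolynomial.degreeOf i (Fintype.linearCombination K B c) ≤ n * (1 + e) := by
        rw [Fintype.linearCombination_apply]
        refine (MvPolynomial.degreeOf_sum_le _ _ _).trans (Finset.sup_le fun x _ => ?_)
        rw [← smul_mul_assoc, MvPolynomial.smul_monomial]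
        refine (MvPolynomial.degreeOf_mul_le _ _ _).trans ?_
        rw [mul_add, mul_one]
        refine add_le_add (MvPolynomial.degreeOf_le_iff.2 fun m hm => ?_)
          ((MvPolynomial.degreeOf_pow_le _ _ _).trans
            (Nat.mul_le_mul (Nat.lt_succ_iff.1 x.1.2) (he i)))
        rw [Finset.mem_singleton.1 (MvPolynomial.support_monomial_subset hm)]
        exact Nat.lt_succ_iff.1 (x.2.2 i).2
      omega

theorem exists_C_X_pow_dvd_sum_head_ne_zero {K ι : Type*} [Field K] [Fintype ι]
    {F : MvPolynomial ι (PowerSeries K)} (hF : F ≠ 0) (s : ℕ) :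
    ∃ (n : ℕ) (N : ℕ) (P : ℕ → MvPolynomial ι K[X]), 1 ≤ n ∧ N ≤ n ∧ P 0 ≠ 0 ∧
      (∀ j, (P j).totalDegree ≤ Fintype.card ι * n) ∧
      (∀ v, (MvPolynomial.coeff v (P 0)).natDegree ≤ n) ∧
      MvPolynomial.C (PowerSeries.X ^ (s * n)) ∣ ∑ j ∈ Finset.range (N + 1),
        MvPolynomial.map (algebraMap K[X] (PowerSeries K)) (P j) * F ^ j := by
  classical
  have hprime : Prime (MvPolynomial.C PowerSeries.X : MvPolynomial ι (PowerSeries K)) :=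
    (MvPolynomial.prime_C_iff ι).2 PowerSeries.X_prime
  obtain ⟨F', hF', hnd⟩ :=
    (FiniteMultiplicity.of_not_isUnit hprime.not_isUnit hF).exists_eq_pow_mul_and_not_dvd
  generalize multiplicity (MvPolynomial.C PowerSeries.X) F = a at hF'
  obtain ⟨A, hA⟩ : ∃ A, A = (1 + F.totalDegree) ^ Fintype.card ι := ⟨_, rfl⟩
  have hA1 : 1 ≤ A := hA ▸ Nat.one_le_pow _ _ (by omega)
  obtain ⟨S, hS⟩ : ∃ S, S = s + a + 2 := ⟨_, rfl⟩
  obtain ⟨n, hn⟩ : ∃ n, n + 1 = S * A :=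
    ⟨S * A - 1, Nat.sub_add_cancel (Nat.mul_pos (by omega) hA1)⟩
  have hn1 : 1 ≤ n := by
    have : 2 * 1 ≤ S * A := Nat.mul_le_mul (by omega) hA1
    omega
  obtain ⟨c, ⟨j₁, hj₁, hcj₁⟩, hdvd⟩ := exists_C_X_pow_dvd_sum F (S * n) n F.totalDegree
    (fun i => MvPolynomial.degreeOf_le_totalDegree F i) (by
      calc S * n * (n * (1 + F.totalDegree) + 1) ^ Fintype.card ι
          ≤ S * n * ((n + 1) * (1 + F.totalDegree)) ^ Fintype.card ι := by
            gcongr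
            ring_nf
            omega
        _ = n * (n + 1) ^ (Fintype.card ι + 1) := by
            rw [mul_pow, ← hA, pow_succ]
            calc S * n * ((n + 1) ^ Fintype.card ι * A) =
              n * ((n + 1) ^ Fintype.card ι * (S * A)) := by ring
              _ = _ := by rw [← hn]
        _ < (n + 1) * (n + 1) ^ (Fintype.card ι + 1) := by
            gcongr
            omega
        _ = _ := by ring)
  have hex : ∃ j, c j ≠ 0 := ⟨j₁, hcj₁⟩
  let j₀ := Nat.find hex
  have hj₀ : c j₀ ≠ 0 := Nat.find_spec hex
  have hj₀n : j₀ ≤ n := (Nat.find_min' hex hcj₁).trans hj₁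
  have hzero : ∀ j < j₀, c j = 0 := fun j hj => not_not.1 (Nat.find_min hex hj)
  refine ⟨n, n - j₀, fun j => boundedPolynomial (c (j₀ + j)), hn1, Nat.sub_le _ _, ?_,
    fun j => totalDegree_boundedPolynomial_le _,
    fun v => natDegree_coeff_boundedPolynomial_le _ v, ?_⟩
  · intro h
    refine hj₀ (funext fun x => ?_)
    rw [← boundedPolynomial_coeff (c j₀) x]
    have h' : boundedPolynomial (c j₀) = 0 := h
    rw [h']
    simp
  · rw [show n + 1 = j₀ + (n - j₀ + 1) by omega, Finset.sum_range_add,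
      Finset.sum_eq_zero (fun j hj => ?_), zero_add] at hdvd
    · simp only [pow_add F j₀, mul_left_comm _ (F ^ j₀)] at hdvd
      rw [← Finset.mul_sum] at hdvd
      generalize ∑ j ∈ Finset.range (n - j₀ + 1),
        MvPolynomial.map (algebraMap K[X] (PowerSeries K)) (boundedPolynomial (c (j₀ + j))) *
          F ^ j = G at hdvd ⊢
      rw [map_pow, hF', mul_pow, ← pow_mul, mul_assoc] at hdvd
      have h1 : MvPolynomial.C PowerSeries.X ^ (a * j₀) * MvPolynomial.C PowerSeries.X ^ (s * n) ∣
          MvPolynomial.C PowerSeries.X ^ (a * j₀) * (F' ^ j₀ * G) := by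
        refine dvd_trans ?_ hdvd
        rw [← pow_add]
        refine pow_dvd_pow _ ?_
        have : a * j₀ ≤ a * n := Nat.mul_le_mul_left _ hj₀n
        rw [hS]
        nlinarith
      rw [mul_dvd_mul_iff_left (pow_ne_zero _ hprime.ne_zero)] at h1
      rw [map_pow]
      exact hprime.pow_dvd_of_dvd_mul_left _ (fun h => hnd (hprime.dvd_of_dvd_pow h)) h1
    · rw [hzero j (Finset.mem_range.1 hj)]
      simp [boundedPolynomial]

/-- `SizeLE B x`: the positive integer `B` is a denominator of the algebraic number `x` and
bounds all its conjugates. -/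
def SizeLE {K : Type*} [Field K] (B : ℕ) (x : K) : Prop :=
  0 < B ∧ IsIntegral ℤ ((B : K) * x) ∧ ∀ σ : K →+* ℂ, ‖σ x‖ ≤ B

namespace SizeLE

variable {K : Type*} [Field K] {B B' : ℕ} {x y : K}

theorem of_dvd (h : SizeLE B x) (hd : B ∣ B') (hB' : 0 < B') : SizeLE B' x := by
  obtain ⟨c, rfl⟩ := hd
  refine ⟨hB', ?_, fun σ => (h.2.2 σ).trans ?_⟩
  · rw [mul_comm B c, Nat.cast_mul, mul_assoc]
    have h2 : IsIntegral ℤ ((c : ℤ) : K) := isIntegral_algebraMap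
    exact (by simpa using h2 : IsIntegral ℤ (c : K)).mul h.2.1
  · exact_mod_cast Nat.le_of_dvd hB' (dvd_mul_right B c)

theorem mul (hx : SizeLE B x) (hy : SizeLE B' y) : SizeLE (B * B') (x * y) := by
  refine ⟨Nat.mul_pos hx.1 hy.1, ?_, fun σ => ?_⟩
  · rw [Nat.cast_mul, mul_mul_mul_comm]
    exact hx.2.1.mul hy.2.1
  · rw [map_mul, norm_mul, Nat.cast_mul]
    exact mul_le_mul (hx.2.2 σ) (hy.2.2 σ) (norm_nonneg _) (Nat.cast_nonneg _)

theorem one : SizeLE 1 (1 : K) := ⟨one_pos, by simpa using isIntegral_one, by simp⟩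

theorem pow (hx : SizeLE B x) (n : ℕ) : SizeLE (B ^ n) (x ^ n) := by
  induction n with
  | zero => simpa using one
  | succ n ih => rw [pow_succ, pow_succ]; exact ih.mul hx

theorem sub (hx : SizeLE B x) (hy : SizeLE B y) : SizeLE (2 * B) (x - y) := by
  refine ⟨Nat.mul_pos two_pos hx.1, ?_, fun σ => ?_⟩
  · have : ((2 * B : ℕ) : K) * (x - y) =
        ((B : K) * x + (B : K) * x) - ((B : K) * y + (B : K) * y) := by
      push_cast
      ring
    rw [this]
    exact (hx.2.1.add hx.2.1).sub (hy.2.1.add hy.2.1)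
  · rw [map_sub]
    refine (norm_sub_le _ _).trans ((add_le_add (hx.2.2 σ) (hy.2.2 σ)).trans ?_)
    push_cast
    linarith

theorem sum {ι : Type*} {s : Finset ι} {f : ι → K} (hB : 0 < B)
    (h : ∀ i ∈ s, SizeLE B (f i)) : SizeLE ((s.card + 1) * B) (∑ i ∈ s, f i) := by
  refine ⟨Nat.mul_pos (Nat.succ_pos _) hB, ?_, fun σ => ?_⟩
  · rw [Nat.cast_mul, mul_assoc, Finset.mul_sum]
    have h1 : IsIntegral ℤ (((s.card + 1 : ℕ) : ℤ) : K) := isIntegral_algebraMap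
    exact (by simpa using h1 : IsIntegral ℤ ((s.card + 1 : ℕ) : K)).mul
      (IsIntegral.sum _ fun i hi => (h i hi).2.1)
  · rw [map_sum]
    refine (norm_sum_le _ _).trans ((Finset.sum_le_card_nsmul _ _ _
      fun i hi => (h i hi).2.2 σ).trans ?_)
    rw [nsmul_eq_mul]
    push_cast
    nlinarith [(Nat.cast_nonneg B : (0 : ℝ) ≤ B)]

end SizeLE

theorem exists_sizeLE {K : Type*} [Field K] [NumberField K] (x : K) : ∃ B, SizeLE B x := by
  have hx : IsAlgebraic ℤ x := by
    have : IsAlgebraic ℚ x := Algebra.IsAlgebraic.isAlgebraic x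
    exact (IsFractionRing.isAlgebraic_iff ℤ ℚ K).2 this
  obtain ⟨a, ha, hax⟩ := hx.exists_integral_multiple
  let c : ℕ := ⌈∑ σ : K →+* ℂ, ‖σ x‖⌉₊ + 1
  have hc : ∀ σ : K →+* ℂ, ‖σ x‖ ≤ c := fun σ => by
    have h1 : ‖σ x‖ ≤ ∑ σ : K →+* ℂ, ‖σ x‖ :=
      Finset.single_le_sum (f := fun σ : K →+* ℂ => ‖σ x‖) (fun _ _ => norm_nonneg _)
        (Finset.mem_univ σ)
    refine (h1.trans (Nat.le_ceil _)).trans ?_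
    exact_mod_cast Nat.le_succ _
  have hpos : 0 < a.natAbs * c := Nat.mul_pos (Int.natAbs_pos.2 ha) (Nat.succ_pos _)
  refine ⟨a.natAbs * c, hpos, ?_, fun σ => (hc σ).trans ?_⟩
  · have h1 : IsIntegral ℤ ((a.natAbs : K) * x) := by
      rw [zsmul_eq_mul] at hax
      rcases Int.natAbs_eq a with h | h
      · rw [h] at hax
        simpa using hax
      · rw [h] at hax
        simpa using hax.neg
    rw [mul_comm a.natAbs, Nat.cast_mul, mul_assoc]
    have h2 : IsIntegral ℤ ((c : ℤ) : K) := isIntegral_algebraMap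
    exact (by simpa using h2 : IsIntegral ℤ (c : K)).mul h1
  · exact_mod_cast Nat.le_mul_of_pos_left _ (Int.natAbs_pos.2 ha)

theorem exists_sizeLE_family {K ι : Type*} [Field K] [NumberField K] [Fintype ι] (x : ι → K) :
    ∃ B, 0 < B ∧ ∀ i, SizeLE B (x i) := by
  choose B hB using fun i => exists_sizeLE (x i)
  have hpos : 0 < ∏ i, B i := Finset.prod_pos fun i _ => (hB i).1
  exact ⟨∏ i, B i, hpos, fun i => (hB i).of_dvd (Finset.dvd_prod_of_mem B (Finset.mem_univ i)) hpos⟩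

/-- Liouville's inequality. -/
theorem one_le_norm_mul_of_sizeLE {K : Type*} [Field K] [NumberField K] (φ : K →+* ℂ) {B : ℕ}
    {x : K} (h : SizeLE B x) (hx : x ≠ 0) :
    1 ≤ ‖φ x‖ * (B : ℝ) ^ (2 * Module.finrank ℚ K) := by
  classical
  have hB : (1 : ℝ) ≤ B := by exact_mod_cast h.1
  have hBx : (B : K) * x ≠ 0 := mul_ne_zero (by exact_mod_cast h.1.ne') hx
  have hInt : IsIntegral ℤ (Algebra.norm ℚ ((B : K) * x)) := Algebra.isIntegral_norm ℚ h.2.1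
  obtain ⟨N, hN⟩ := IsIntegrallyClosed.isIntegral_iff.1 hInt
  have hN0 : N ≠ 0 := by
    rintro rfl
    rw [map_zero] at hN
    exact hBx (Algebra.norm_eq_zero_iff.1 hN.symm)
  have hnorm := Algebra.norm_eq_prod_embeddings ℚ ℂ ((B : K) * x)
  rw [← hN] at hnorm
  have h1 : (1 : ℝ) ≤ ‖algebraMap ℚ ℂ (algebraMap ℤ ℚ N)‖ := by
    simp only [eq_intCast, map_intCast, Complex.norm_intCast]
    exact_mod_cast Int.one_le_abs hN0
  rw [hnorm, norm_prod] at h1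
  refine h1.trans ?_
  rw [← Finset.mul_prod_erase _ _ (Finset.mem_univ (φ.toRatAlgHom : K →ₐ[ℚ] ℂ))]
  have hcard : Fintype.card (K →ₐ[ℚ] ℂ) = Module.finrank ℚ K := AlgHom.card ℚ K ℂ
  have hpos : 0 < Module.finrank ℚ K := Module.finrank_pos
  have h2 : ∏ σ ∈ Finset.univ.erase (φ.toRatAlgHom : K →ₐ[ℚ] ℂ), ‖σ ((B : K) * x)‖ ≤
      ((B : ℝ) * B) ^ (Module.finrank ℚ K - 1) := by
    rw [← hcard, ← Finset.card_univ, ← Finset.card_erase_of_mem (Finset.mem_univ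
      (φ.toRatAlgHom : K →ₐ[ℚ] ℂ)), ← Finset.prod_const]
    refine Finset.prod_le_prod (fun _ _ => norm_nonneg _) fun σ _ => ?_
    rw [map_mul, norm_mul, map_natCast, Complex.norm_natCast]
    exact mul_le_mul_of_nonneg_left (h.2.2 (σ : K →+* ℂ)) (by positivity)
  have h3 : ‖φ.toRatAlgHom ((B : K) * x)‖ = B * ‖φ x‖ := by
    rw [map_mul, norm_mul, map_natCast, Complex.norm_natCast]
    rfl
  rw [h3]
  calc (B : ℝ) * ‖φ x‖ * _ ≤ B * ‖φ x‖ * ((B : ℝ) * B) ^ (Module.finrank ℚ K - 1) := by gcongr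
    _ = ‖φ x‖ * (B : ℝ) ^ (1 + 2 * (Module.finrank ℚ K - 1)) := by
      rw [pow_add, pow_mul, pow_one, pow_two]
      ring
    _ ≤ _ := by
      gcongr
      omega

/-- The ring of power series over `K` whose image under `φ : K → ℂ` converges absolutely on the
closed disk of radius `ρ`. -/
def Conv {K : Type*} [Field K] (φ : K →+* ℂ) (ρ : ℝ) : Subring (PowerSeries K) where
  carrier := {g | Summable fun n => ‖φ (PowerSeries.coeff n g) * (ρ : ℂ) ^ n‖}
  mul_mem' {a b} ha hb := by
    refine (summable_norm_sum_mul_antidiagonal_of_summable_norm ha hb).congr fun n => ?_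
    rw [PowerSeries.coeff_mul, map_sum, Finset.sum_mul]
    congr 1
    refine Finset.sum_congr rfl fun p hp => ?_
    rw [map_mul, ← Finset.HasAntidiagonal.mem_antidiagonal.1 hp, pow_add]
    ring
  one_mem' := by
    refine summable_of_ne_finset_zero (s := {0}) fun n hn => ?_
    rw [PowerSeries.coeff_one, if_neg (by simpa using hn), map_zero, zero_mul, norm_zero]
  add_mem' {a b} ha hb := by
    refine Summable.of_nonneg_of_le (fun _ => norm_nonneg _) (fun n => ?_) (Summable.add ha hb)
    rw [map_add, map_add, add_mul]
    exact norm_add_le _ _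
  zero_mem' := by simp
  neg_mem' {a} ha := by simpa using ha

namespace Conv

variable {K : Type*} [Field K] {φ : K →+* ℂ} {ρ : ℝ}

theorem mem_iff {g : PowerSeries K} :
    g ∈ Conv φ ρ ↔ Summable fun n => ‖φ (PowerSeries.coeff n g) * (ρ : ℂ) ^ n‖ := Iff.rfl

theorem summable_norm_of_le {z : ℂ} (hz : ‖z‖ ≤ ρ) (g : Conv φ ρ) :
    Summable fun n => ‖φ (PowerSeries.coeff n (g : PowerSeries K)) * z ^ n‖ := by
  refine Summable.of_nonneg_of_le (fun _ => norm_nonneg _) (fun n => ?_) g.2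
  rw [norm_mul, norm_mul, norm_pow, norm_pow, Complex.norm_real]
  gcongr
  exact hz.trans (le_abs_self ρ)

/-- Evaluation at a point of the closed disk of radius `ρ`. -/
def eval (φ : K →+* ℂ) {ρ : ℝ} {z : ℂ} (hz : ‖z‖ ≤ ρ) : Conv φ ρ →+* ℂ where
  toFun g := ∑' n, φ (PowerSeries.coeff n (g : PowerSeries K)) * z ^ n
  map_one' := by
    rw [tsum_eq_single 0 fun n hn => ?_]
    · simp
    · simp [PowerSeries.coeff_one, hn]
  map_zero' := by simp
  map_add' a b := by
    rw [← ((summable_norm_of_le hz a).of_norm).tsum_add (summable_norm_of_le hz b).of_norm]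
    exact tsum_congr fun n => by simp [add_mul]
  map_mul' a b := by
    rw [tsum_mul_tsum_eq_tsum_sum_antidiagonal_of_summable_norm (summable_norm_of_le hz a)
      (summable_norm_of_le hz b)]
    refine tsum_congr fun n => ?_
    rw [Subring.coe_mul, PowerSeries.coeff_mul, map_sum, Finset.sum_mul]
    refine Finset.sum_congr rfl fun p hp => ?_
    rw [map_mul, ← Finset.HasAntidiagonal.mem_antidiagonal.1 hp, pow_add]
    ring

theorem eval_apply {z : ℂ} (hz : ‖z‖ ≤ ρ) (g : Conv φ ρ) :
    eval φ hz g = ∑' n, φ (PowerSeries.coeff n (g : PowerSeries K)) * z ^ n := rfl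

theorem coe_mem (p : K[X]) : (p : PowerSeries K) ∈ Conv φ ρ := by
  refine summable_of_ne_finset_zero (s := p.support) fun n hn => ?_
  rw [Polynomial.coeff_coe, Polynomial.notMem_support_iff.1 hn, map_zero, zero_mul, norm_zero]

/-- Polynomials converge everywhere. -/
def ofPoly (φ : K →+* ℂ) (ρ : ℝ) : K[X] →+* Conv φ ρ :=
  Polynomial.coeToPowerSeries.ringHom.codRestrict (Conv φ ρ) coe_mem

theorem coe_ofPoly (p : K[X]) : (ofPoly φ ρ p : PowerSeries K) = p := rfl

theorem eval_ofPoly {w : K} (hw : ‖φ w‖ ≤ ρ) (p : K[X]) :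
    eval φ hw (ofPoly φ ρ p) = φ (p.eval w) := by
  rw [eval_apply, tsum_eq_sum (s := p.support) fun n hn => ?_, Polynomial.eval_eq_sum,
    Polynomial.sum, map_sum]
  · simp [coe_ofPoly]
  · rw [coe_ofPoly, Polynomial.coeff_coe, Polynomial.notMem_support_iff.1 hn, map_zero, zero_mul]

/-- A convergent power series divisible by `X ^ N` is `O(‖z‖ ^ N)`. -/
theorem exists_norm_eval_le (hρ : 0 < ρ) (g : Conv φ ρ) {N : ℕ}
    (hg : PowerSeries.X ^ N ∣ (g : PowerSeries K)) :
    ∃ A : ℝ, 0 ≤ A ∧ ∀ (z : ℂ) (hz : ‖z‖ ≤ ρ), ‖eval φ hz g‖ ≤ A * ‖z‖ ^ N := by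
  refine ⟨(∑' n, ‖φ (PowerSeries.coeff n (g : PowerSeries K)) * (ρ : ℂ) ^ n‖) / ρ ^ N, ?_,
    fun z hz => ?_⟩
  · exact div_nonneg (tsum_nonneg fun _ => norm_nonneg _) (by positivity)
  rw [eval_apply, div_mul_eq_mul_div, mul_div_assoc, ← div_pow, ← tsum_mul_right]
  refine (norm_tsum_le_tsum_norm (summable_norm_of_le hz g)).trans ?_
  refine (summable_norm_of_le hz g).tsum_le_tsum (fun n => ?_) (Summable.mul_right _ g.2)
  rcases lt_or_ge n N with hn | hn
  · rw [PowerSeries.X_pow_dvd_iff.1 hg n hn, map_zero, zero_mul, norm_zero]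
    positivity
  · rw [norm_mul, norm_mul, norm_pow, norm_pow, Complex.norm_real, Real.norm_of_nonneg hρ.le,
      mul_assoc]
    refine mul_le_mul_of_nonneg_left ?_ (norm_nonneg _)
    calc ‖z‖ ^ n = ρ ^ n * (‖z‖ / ρ) ^ n := by rw [← mul_pow, mul_div_cancel₀ _ hρ.ne']
      _ ≤ _ := by
        refine mul_le_mul_of_nonneg_left ?_ (by positivity)
        exact pow_le_pow_of_le_one (by positivity) ((div_le_one hρ).2 hz) hn

end Conv

theorem SizeLE.prod {K ι : Type*} [Field K] {s : Finset ι} {f : ι → K} {B : ι → ℕ}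
    (h : ∀ i ∈ s, SizeLE (B i) (f i)) : SizeLE (∏ i ∈ s, B i) (∏ i ∈ s, f i) := by
  classical
  induction s using Finset.induction_on with
  | empty => simpa using SizeLE.one
  | insert a s ha ih =>
    rw [Finset.prod_insert ha, Finset.prod_insert ha]
    exact (h a (Finset.mem_insert_self a s)).mul
      (ih fun i hi => h i (Finset.mem_insert_of_mem hi))

theorem Polynomial.exists_sizeLE_eval {K : Type*} [Field K] [NumberField K] (p : K[X]) {n : ℕ}
    (hn : p.natDegree ≤ n) :
    ∃ B : ℕ, 0 < B ∧ ∀ (D : ℕ) (b : K), SizeLE D b → SizeLE (B * D ^ n) (p.eval b) := by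
  obtain ⟨B, hB, h⟩ := exists_sizeLE_family fun j : Fin (n + 1) => p.coeff j
  refine ⟨(n + 1 + 1) * B, by positivity, fun D b hD => ?_⟩
  have hD0 := hD.1
  rw [Polynomial.eval_eq_sum_range' (Nat.lt_succ_of_le hn), mul_assoc]
  have := SizeLE.sum (s := Finset.range (n + 1)) (f := fun j => p.coeff j * b ^ j)
    (B := B * D ^ n) (by positivity) fun j hj => ?_
  · simpa using this
  · refine ((h ⟨j, Finset.mem_range.1 hj⟩).mul (hD.pow j)).of_dvd ?_ (by positivity)
    exact mul_dvd_mul_left _ (pow_dvd_pow _ (by have := Finset.mem_range.1 hj; omega))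

theorem Finsupp.sum_le_totalDegree {R ι : Type*} [CommSemiring R] [Fintype ι]
    {P : MvPolynomial ι R} {v : ι →₀ ℕ} (hv : v ∈ P.support) : ∑ i, v i ≤ P.totalDegree := by
  have := MvPolynomial.le_totalDegree hv
  rwa [Finsupp.sum_fintype _ _ fun _ => rfl] at this

theorem MvPolynomial.exists_sizeLE_eval₂ {K ι : Type*} [Field K] [NumberField K] [Fintype ι]
    (P : MvPolynomial ι K[X]) {n e : ℕ} (hn : ∀ v, (P.coeff v).natDegree ≤ n)
    (he : P.totalDegree ≤ e) :
    ∃ B : ℕ, 0 < B ∧ ∀ (D : ℕ) (b : K) (t : ι → K), SizeLE D b → (∀ i, SizeLE D (t i)) →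
      SizeLE (B * D ^ (n + e)) (MvPolynomial.eval₂ (Polynomial.evalRingHom b) t P) := by
  choose B hB h using fun v => (P.coeff v).exists_sizeLE_eval (hn v)
  have hBpos : 0 < ∏ v ∈ P.support, B v := Finset.prod_pos fun v _ => hB v
  refine ⟨(P.support.card + 1) * ∏ v ∈ P.support, B v, by positivity, fun D b t hb ht => ?_⟩
  have hD0 := hb.1
  rw [MvPolynomial.eval₂_eq', mul_assoc]
  refine SizeLE.sum (by positivity) fun v hv => ?_
  refine ((h v D b hb).mul (SizeLE.prod fun i _ => (ht i).pow (v i))).of_dvd ?_ (by positivity)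
  rw [Finset.prod_pow_eq_pow_sum, mul_assoc, ← pow_add]
  exact mul_dvd_mul (Finset.dvd_prod_of_mem B hv)
    (pow_dvd_pow _ (Nat.add_le_add_left ((Finsupp.sum_le_totalDegree hv).trans he) _))

theorem MvPolynomial.exists_norm_eval₂_le {K ι : Type*} [Field K] [Fintype ι] {φ : K →+* ℂ} {ρ : ℝ}
    (hρ : 0 < ρ) (G : MvPolynomial ι (Conv φ ρ)) {N e : ℕ}
    (hG : ∀ v, PowerSeries.X ^ N ∣ ((G.coeff v : Conv φ ρ) : PowerSeries K))
    (he : G.totalDegree ≤ e) :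
    ∃ A : ℝ, 0 ≤ A ∧ ∀ (z : ℂ) (hz : ‖z‖ ≤ ρ) (D : ℝ) (t : ι → ℂ), 1 ≤ D → (∀ i, ‖t i‖ ≤ D) →
      ‖MvPolynomial.eval₂ (Conv.eval φ hz) t G‖ ≤ A * ‖z‖ ^ N * D ^ e := by
  choose A hA h using fun v => Conv.exists_norm_eval_le hρ (G.coeff v) (hG v)
  refine ⟨∑ v ∈ G.support, A v, Finset.sum_nonneg fun v _ => hA v, fun z hz D t hD ht => ?_⟩
  rw [MvPolynomial.eval₂_eq', Finset.sum_mul, Finset.sum_mul]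
  refine (norm_sum_le _ _).trans (Finset.sum_le_sum fun v hv => ?_)
  rw [norm_mul, norm_prod]
  refine mul_le_mul (h v z hz) ?_ (by positivity) (mul_nonneg (hA v) (by positivity))
  calc ∏ i, ‖t i ^ v i‖ ≤ ∏ i, D ^ v i := by
        refine Finset.prod_le_prod (fun _ _ => norm_nonneg _) fun i _ => ?_
        rw [norm_pow]
        exact pow_le_pow_left₀ (norm_nonneg _) (ht i) _
    _ = D ^ ∑ i, v i := Finset.prod_pow_eq_pow_sum _ _ _
    _ ≤ D ^ e := pow_le_pow_right₀ hD ((Finsupp.sum_le_totalDegree hv).trans he)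

theorem eventually_mul_pow_pow_lt_one {q : ℕ} (hq : 2 ≤ q) (A : ℝ) {θ : ℝ} (h0 : 0 ≤ θ)
    (h1 : θ < 1) : ∀ᶠ k : ℕ in Filter.atTop, A * θ ^ q ^ k < 1 := by
  have hlim : Filter.Tendsto (fun k : ℕ => A * θ ^ q ^ k) Filter.atTop (nhds (A * 0)) :=
    ((tendsto_pow_atTop_nhds_zero_of_lt_one h0 h1).comp
      (tendsto_pow_atTop_atTop_of_one_lt hq)).const_mul A
  rw [mul_zero] at hlim
  exact hlim.eventually (gt_mem_nhds one_pos)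

/-- An algebraic relation with convergent coefficients along the points `(β ^ q ^ k, t k)`, all of
size at most `C ^ q ^ k`, forces an algebraic relation with polynomial coefficients. -/
theorem exists_polynomial_relation {K ι : Type*} [Field K] [NumberField K] [Fintype ι]
    (φ : K →+* ℂ) {q : ℕ} (hq : 2 ≤ q) {β : K} (hβ0 : β ≠ 0) {ρ : ℝ}
    (hρdef : ρ = ‖φ β‖) (hβ1 : ρ < 1) {C : ℕ}
    {t : ℕ → ι → K} (ht : ∀ k i, SizeLE (C ^ q ^ k) (t k i))
    (hβ : ∀ k, SizeLE (C ^ q ^ k) (β ^ q ^ k))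
    (hz : ∀ k, ‖φ (β ^ q ^ k)‖ ≤ ρ)
    {F : MvPolynomial ι (Conv φ ρ)} (hF : F ≠ 0) :
    ∃ P : MvPolynomial ι K[X], P ≠ 0 ∧ ∀ᶠ k in Filter.atTop,
      MvPolynomial.eval₂ (Conv.eval φ (hz k)) (fun i => φ (t k i)) F = 0 →
      MvPolynomial.eval₂ (Polynomial.evalRingHom (β ^ q ^ k)) (t k) P = 0 := by
  have hρ : 0 < ρ := hρdef ▸ norm_pos_iff.2 ((map_ne_zero φ).2 hβ0)
  set r := Fintype.card ι
  set d := Module.finrank ℚ K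
  have hC1 : 1 ≤ C := by
    have := (hβ 0).1
    rcases Nat.eq_zero_or_pos C with h | h
    · rw [h, pow_zero, pow_one] at this
      exact absurd this (lt_irrefl 0)
    · exact h
  have hC1' : (1 : ℝ) ≤ C := by exact_mod_cast hC1
  set c₁ := r + F.totalDegree
  set c₂ := c₁ + (1 + r) * (2 * d)
  obtain ⟨s, hs⟩ : ∃ s : ℕ, ρ ^ s < ((C : ℝ) ^ c₂)⁻¹ :=
    exists_pow_lt_of_lt_one (by positivity) hβ1
  have hs' : ρ ^ s * (C : ℝ) ^ c₂ < 1 := by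
    rwa [← lt_div_iff₀ (by positivity), one_div]
  have hF0 : MvPolynomial.map (Conv φ ρ).subtype F ≠ 0 := fun h0 =>
    hF (MvPolynomial.map_injective _ (Conv φ ρ).subtype_injective (by rw [h0, map_zero]))
  obtain ⟨n, N, P, hn1, hN, hP0, hdeg, hnat, hdvd⟩ := exists_C_X_pow_dvd_sum_head_ne_zero hF0 s
  refine ⟨P 0, hP0, ?_⟩
  set G : MvPolynomial ι (Conv φ ρ) :=
    ∑ j ∈ Finset.range (N + 1), MvPolynomial.map (Conv.ofPoly φ ρ) (P j) * F ^ j with hG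
  have hGmap : MvPolynomial.map (Conv φ ρ).subtype G = ∑ j ∈ Finset.range (N + 1),
      MvPolynomial.map (algebraMap K[X] (PowerSeries K)) (P j) *
        (MvPolynomial.map (Conv φ ρ).subtype F) ^ j := by
    rw [hG, map_sum]
    refine Finset.sum_congr rfl fun j _ => ?_
    rw [map_mul, map_pow, MvPolynomial.map_map]
    congr 2
  rw [← hGmap, MvPolynomial.C_dvd_iff_dvd_coeff] at hdvd
  have hGdvd : ∀ v, PowerSeries.X ^ (s * n) ∣ ((G.coeff v : Conv φ ρ) : PowerSeries K) :=
    fun v => by simpa [MvPolynomial.coeff_map] using hdvd v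
  have hGdeg : G.totalDegree ≤ c₁ * n := by
    refine MvPolynomial.totalDegree_finsetSum_le fun j hj => ?_
    refine (MvPolynomial.totalDegree_mul _ _).trans ?_
    rw [add_mul]
    refine add_le_add ?_ ?_
    · exact (Finset.sup_mono (MvPolynomial.support_map_subset _ _)).trans (hdeg j)
    · refine (MvPolynomial.totalDegree_pow _ _).trans ?_
      rw [mul_comm]
      exact Nat.mul_le_mul_left _ (by have := Finset.mem_range.1 hj; omega)
  obtain ⟨A, hA, hGle⟩ := MvPolynomial.exists_norm_eval₂_le hρ G hGdvd hGdeg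
  obtain ⟨B, hB, hPle⟩ := (P 0).exists_sizeLE_eval₂ hnat (hdeg 0)
  have hθ0 : 0 ≤ (ρ ^ s * (C : ℝ) ^ c₂) ^ n := by positivity
  have hθ1 : (ρ ^ s * (C : ℝ) ^ c₂) ^ n < 1 := pow_lt_one₀ (by positivity) hs' (by omega)
  filter_upwards [eventually_mul_pow_pow_lt_one hq (A * (B : ℝ) ^ (2 * d)) hθ0 hθ1] with k hk hFk
  by_contra hne
  have hlow := one_le_norm_mul_of_sizeLE φ (hPle _ _ _ (hβ k) (ht k)) hne
  have hD1 : (1 : ℝ) ≤ (C : ℝ) ^ q ^ k := one_le_pow₀ hC1'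
  have hup := hGle _ (hz k) ((C : ℝ) ^ q ^ k) (fun i => φ (t k i)) hD1 fun i => by
    exact_mod_cast (ht k i).2.2 φ
  have hGev : MvPolynomial.eval₂ (Conv.eval φ (hz k)) (fun i => φ (t k i)) G =
      φ (MvPolynomial.eval₂ (Polynomial.evalRingHom (β ^ q ^ k)) (t k) (P 0)) := by
    rw [hG, MvPolynomial.eval₂_sum, Finset.sum_eq_single 0]
    · rw [pow_zero, mul_one, MvPolynomial.eval₂_map, MvPolynomial.eval₂_comp_left]
      congr 1
      exact RingHom.ext fun p => Conv.eval_ofPoly (hz k) p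
    · intro j _ hj
      rw [MvPolynomial.eval₂_mul, MvPolynomial.eval₂_pow, hFk, zero_pow hj, mul_zero]
    · intro h
      exact absurd (Finset.mem_range.2 (Nat.succ_pos N)) h
  rw [hGev] at hup
  refine absurd (hlow.trans (mul_le_mul_of_nonneg_right hup (by positivity))) (not_le.2 ?_)
  refine lt_of_eq_of_lt ?_ hk
  rw [map_pow, norm_pow, ← hρdef]
  push_cast
  simp only [mul_pow, ← pow_mul]
  simp only [c₂]
  have e1 : q ^ k * (s * n) = s * n * q ^ k := by ring
  have e2 : (c₁ + (1 + r) * (2 * d)) * n * q ^ k =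
    q ^ k * (c₁ * n) + q ^ k * ((n + r * n) * (2 * d)) := by ring
  rw [e1, e2, pow_add]
  ring

theorem eq_zero_of_sum_mul_eq_zero_of_algebraicIndependent_fractionRing {P A κ N Ω ι : Type*}
    [CommRing P] [CommRing A] [IsDomain P] [IsDomain A] [Field κ] [Field N] [Field Ω] [CharZero κ]
    [Algebra P A]
    [Algebra P κ] [IsFractionRing P κ] [Algebra A N] [IsFractionRing A N] [Algebra κ N]
    [Algebra P N] [IsScalarTower P κ N] [IsScalarTower P A N] [Algebra N Ω] [Algebra A Ω]
    [IsScalarTower A N Ω] [Algebra κ Ω] [IsScalarTower κ N Ω] [Algebra P Ω] [IsScalarTower P κ Ω]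
    [Fintype ι] {y : ι → A} (hy : LinearIndependent P y)
    (hcl : ∀ x ∈ IntermediateField.adjoin κ (Set.range fun i => algebraMap A N (y i)),
      IsIntegral κ x → x ∈ (algebraMap κ N).range)
    {ξ : ι → Ω} (hind : ∀ s : Set ι, AlgebraicIndepOn P ξ s → AlgebraicIndepOn A ξ s)
    (h : ∑ i, algebraMap A Ω (y i) * ξ i = 0) : ξ = 0 := by
  set M := IntermediateField.adjoin κ (Set.range fun i => algebraMap A N (y i)) with hM
  have hmem : ∀ i, algebraMap A N (y i) ∈ M := fun i =>
    IntermediateField.subset_adjoin κ _ ⟨i, rfl⟩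
  have : IsScalarTower κ M Ω := inferInstance
  refine eq_zero_of_sum_mul_eq_zero_of_algebraicIndependent (k := κ) (M := M) (ι := ι)
    (y := fun i => ⟨algebraMap A N (y i), hmem i⟩) ?_ ?_ ?_ ?_
  · intro x hx
    obtain ⟨c, hc⟩ := hcl x x.2 ((isIntegral_algebraMap_iff
      (algebraMap M N).injective).2 hx)
    exact ⟨c, Subtype.ext hc⟩
  · have h1 : LinearIndependent P fun i => algebraMap A N (y i) :=
      hy.map' (IsScalarTower.toAlgHom P A N).toLinearMap
        (LinearMap.ker_eq_bot.2 (IsFractionRing.injective A N))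
    have h2 : LinearIndependent κ fun i => algebraMap A N (y i) :=
      (LinearIndependent.iff_fractionRing P κ).1 h1
    exact LinearIndependent.of_comp (M.val.toLinearMap) h2
  · intro s hs
    have h1 : AlgebraicIndepOn P ξ s :=
      AlgebraicIndependent.restrictScalars (IsFractionRing.injective P κ) hs
    have h2 : AlgebraicIndependent N fun i : s => ξ i :=
      have : Algebra.IsAlgebraic A N :=
        ⟨fun x => (IsFractionRing.isAlgebraic_iff A N N).2 (isAlgebraic_algebraMap x)⟩
      AlgebraicIndependent.extendScalars N (hind s h1)
    exact AlgebraicIndependent.restrictScalars (R := M) (K := N) (algebraMap M N).injective h2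
  · rw [← h]
    refine Finset.sum_congr rfl fun i _ => ?_
    rw [IsScalarTower.algebraMap_apply A N Ω]
    rfl

theorem expand_pow_add {k : Type*} [CommRing k] {q : ℕ} (hq : q ≠ 0) (i j : ℕ)
    (g : PowerSeries k) :
    PowerSeries.expand (q ^ (i + j)) (pow_ne_zero _ hq) g =
      PowerSeries.expand (q ^ i) (pow_ne_zero _ hq)
        (PowerSeries.expand (q ^ j) (pow_ne_zero _ hq) g) := by
  simp_rw [pow_add]
  rw [PowerSeries.expand_mul]

theorem expand_coe {k : Type*} [CommRing k] {Q : ℕ} (hQ : Q ≠ 0) (p : k[X]) :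
    PowerSeries.expand Q hQ (p : PowerSeries k) = (expand k Q p : k[X]) := by
  ext n
  rw [PowerSeries.coeff_expand, Polynomial.coeff_coe, Polynomial.coeff_coe,
    Polynomial.coeff_expand (Nat.pos_of_ne_zero hQ)]

theorem mem_adjoin_lsExpand {q : ℕ} (hq : 2 ≤ q) {m : ℕ} {p : ℕ → ℂ[X]} (hp : p 0 ≠ 0)
    {g : PowerSeries ℂ} (hq0 : q ≠ 0)
    (h : ∑ i ∈ Finset.range (m + 1), (p i : PowerSeries ℂ) *
      PowerSeries.expand (q ^ i) (pow_ne_zero i hq0) g = 0) (B : ℕ) :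
    ∃ (Q : ℕ) (hQ : Q ≠ 0), B < Q ∧ ∀ i : Fin m,
      algebraMap _ (LS ℂ) (PowerSeries.expand (q ^ (i : ℕ)) (pow_ne_zero i hq0) g) ∈
      IntermediateField.adjoin (RatFunc ℂ) (Set.range fun j : Fin m => lsExpand ℂ hQ
        (algebraMap _ (LS ℂ) (PowerSeries.expand (q ^ (j : ℕ)) (pow_ne_zero j hq0) g))) := by
  refine ⟨q ^ B, pow_ne_zero B hq0, Nat.lt_pow_self hq, ?_⟩
  set y : ℕ → LS ℂ := fun n =>
    algebraMap _ (LS ℂ) (PowerSeries.expand (q ^ n) (pow_ne_zero n hq0) g) with hy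
  have key : ∀ s n, n < s + m → y n ∈
      IntermediateField.adjoin (RatFunc ℂ) (Set.range fun j : Fin m => y (s + j)) := by
    intro s
    induction s with
    | zero =>
      intro n hn
      refine IntermediateField.subset_adjoin _ _ ⟨⟨n, by omega⟩, by simp⟩
    | succ s ih =>
      set E := IntermediateField.adjoin (RatFunc ℂ) (Set.range fun j : Fin m => y (s + 1 + j))
      have hE : ∀ j, j < m → y (s + 1 + j) ∈ E := fun j hj =>
        IntermediateField.subset_adjoin _ _ ⟨⟨j, hj⟩, rfl⟩
      have hs : y s ∈ E := by
        have h1 := congrArg (fun w => algebraMap _ (LS ℂ)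
          (PowerSeries.expand (q ^ s) (pow_ne_zero s hq0) w)) h
        simp only [map_sum, map_mul, map_zero, ← expand_pow_add hq0, expand_coe] at h1
        have h2 : ∀ c : ℂ[X], algebraMap (PowerSeries ℂ) (LS ℂ) c ∈ E := fun c => by
          have := E.algebraMap_mem (algebraMap ℂ[X] (RatFunc ℂ) c)
          rwa [← IsScalarTower.algebraMap_apply, IsScalarTower.algebraMap_apply ℂ[X]
            (PowerSeries ℂ), algebraMap_polynomial_powerSeries] at this
        rw [Finset.sum_range_succ'] at h1
        have h3 : algebraMap (PowerSeries ℂ) (LS ℂ) (expand ℂ (q ^ s) (p 0) : ℂ[X]) * y s ∈ E := by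
          rw [show _ * y s = _ from eq_neg_of_add_eq_zero_right h1]
          refine neg_mem (sum_mem fun i hi => mul_mem (h2 _) ?_)
          have := hE i (Finset.mem_range.1 hi)
          rwa [hy, add_assoc, add_comm 1 i] at this
        have h4 : algebraMap (PowerSeries ℂ) (LS ℂ) (expand ℂ (q ^ s) (p 0) : ℂ[X]) ≠ 0 := by
          rw [Ne, FaithfulSMul.algebraMap_eq_zero_iff, Polynomial.coe_eq_zero_iff,
            Polynomial.expand_eq_zero (by positivity)]
          exact hp
        have := mul_mem (inv_mem (h2 (expand ℂ (q ^ s) (p 0)))) h3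
        rwa [inv_mul_cancel_left₀ h4] at this
      intro n hn
      have hsub : IntermediateField.adjoin (RatFunc ℂ) (Set.range fun j : Fin m => y (s + j)) ≤
          E := by
        rw [IntermediateField.adjoin_le_iff]
        rintro _ ⟨j, rfl⟩
        rcases j with ⟨_ | j, hj⟩
        · exact hs
        · have := hE j (by omega)
          rwa [add_assoc, add_comm 1 j] at this
      rcases Nat.lt_or_ge n (s + m) with h5 | h5
      · exact hsub (ih n h5)
      · obtain rfl : n = s + m := by omega
        rcases m with _ | m
        · exact hs
        · have := hE m (by omega)
          rwa [add_assoc, add_comm 1 m] at this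
  intro i
  have := key B i (by omega)
  convert this using 4 with j
  rw [lsExpand_algebraMap, hy]
  simp only [expand_pow_add hq0 B]

theorem exists_polynomial_map_eq {K : Type*} [Field K] (φ : K →+* ℂ) {u v : PowerSeries K}
    (hv : v ≠ 0) {p : ℂ[X]} (h : PowerSeries.map φ u = PowerSeries.map φ v * p) :
    ∃ p' : K[X], u = v * p' := by
  have hinj : Function.Injective (PowerSeries.map φ) := PowerSeries.map_injective φ φ.injective
  have hv0 : PowerSeries.map φ v ≠ 0 := (map_ne_zero_iff _ hinj).2 hv
  have hdvd : v ∣ u := by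
    rcases ValuationRing.dvd_total v u with hd | ⟨g, hg⟩
    · exact hd
    · rw [hg, map_mul, mul_assoc] at h
      by_cases hu : u = 0
      · rw [hu]
        exact dvd_zero v
      · have h1 : PowerSeries.map φ g * p = 1 :=
          mul_left_cancel₀ ((map_ne_zero_iff _ hinj).2 hu) (by rw [← h, mul_one])
        have h2 : IsUnit (PowerSeries.constantCoeff (PowerSeries.map φ g)) :=
          (IsUnit.of_mul_eq_one _ h1).map _
        have h3 : IsUnit g := by
          rw [PowerSeries.isUnit_iff_constantCoeff, isUnit_iff_ne_zero]
          rintro h0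
          rw [isUnit_iff_ne_zero, ← PowerSeries.coeff_zero_eq_constantCoeff_apply,
            PowerSeries.coeff_map, PowerSeries.coeff_zero_eq_constantCoeff_apply, h0] at h2
          exact h2 (map_zero φ)
        rw [hg]
        exact (h3.mul_right_dvd).2 dvd_rfl
  obtain ⟨g, rfl⟩ := hdvd
  rw [map_mul] at h
  have h1 : PowerSeries.map φ g = p := mul_left_cancel₀ hv0 h
  refine ⟨PowerSeries.trunc (p.natDegree + 1) g, ?_⟩
  congr 1
  ext n
  rw [Polynomial.coeff_coe, PowerSeries.coeff_trunc]
  split_ifs with hn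
  · rfl
  · have h2 := congrArg (PowerSeries.coeff n) h1
    rw [PowerSeries.coeff_map, Polynomial.coeff_coe,
      Polynomial.coeff_eq_zero_of_natDegree_lt (by omega)] at h2
    exact (map_eq_zero φ).1 h2

namespace Conv

variable {K : Type*} [Field K] {φ : K →+* ℂ} {ρ : ℝ}

instance : Algebra K[X] (Conv φ ρ) := (ofPoly φ ρ).toAlgebra

theorem algebraMap_eq : algebraMap K[X] (Conv φ ρ) = ofPoly φ ρ := rfl

theorem ofPoly_injective : Function.Injective (ofPoly φ ρ) := fun _ _ h =>
  Polynomial.coe_injective K (congrArg (Subtype.val : Conv φ ρ → PowerSeries K) h)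

instance : FaithfulSMul K[X] (FractionRing (Conv φ ρ)) := by
  rw [faithfulSMul_iff_algebraMap_injective, IsScalarTower.algebraMap_eq K[X] (Conv φ ρ),
    RingHom.coe_comp]
  exact (IsFractionRing.injective (Conv φ ρ) _).comp ofPoly_injective

/-- The embedding of convergent power series over `K` into formal power series over `ℂ`. -/
def toComplex (φ : K →+* ℂ) (ρ : ℝ) : Conv φ ρ →+* PowerSeries ℂ :=
  (PowerSeries.map φ).comp (Conv φ ρ).subtype

theorem toComplex_injective : Function.Injective (toComplex φ ρ) :=
  (PowerSeries.map_injective φ φ.injective).comp Subtype.val_injective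

/-- The embedding of the fraction field of the ring of convergent power series over `K` into the
field of formal Laurent series over `ℂ`. -/
def toLS (φ : K →+* ℂ) (ρ : ℝ) : FractionRing (Conv φ ρ) →+* LS ℂ :=
  IsFractionRing.lift (g := (algebraMap (PowerSeries ℂ) (LS ℂ)).comp (toComplex φ ρ))
    ((IsFractionRing.injective (PowerSeries ℂ) (LS ℂ)).comp toComplex_injective)

theorem toLS_algebraMap (g : Conv φ ρ) :
    toLS φ ρ (algebraMap _ _ g) = algebraMap _ (LS ℂ) (toComplex φ ρ g) :=
  IsFractionRing.lift_algebraMap _ _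

theorem toLS_algebraMap_polynomial (p : K[X]) :
    toLS φ ρ (algebraMap K[X] _ p) = algebraMap ℂ[X] (LS ℂ) (p.map φ) := by
  rw [IsScalarTower.algebraMap_apply K[X] (Conv φ ρ), toLS_algebraMap,
    IsScalarTower.algebraMap_apply ℂ[X] (PowerSeries ℂ), algebraMap_polynomial_powerSeries]
  congr 1
  ext n
  simp [toComplex, algebraMap_eq, coe_ofPoly]

theorem toLS_mem_adjoin {ι : Type*} {y : ι → Conv φ ρ} {x : FractionRing (Conv φ ρ)}
    (hx : x ∈ IntermediateField.adjoin (RatFunc K)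
      (Set.range fun i => algebraMap _ (FractionRing (Conv φ ρ)) (y i))) :
    toLS φ ρ x ∈ IntermediateField.adjoin (RatFunc ℂ)
      (Set.range fun i => algebraMap _ (LS ℂ) (toComplex φ ρ (y i))) := by
  set E := IntermediateField.adjoin (RatFunc ℂ)
      (Set.range fun i => algebraMap _ (LS ℂ) (toComplex φ ρ (y i)))
  induction hx using IntermediateField.adjoin_induction with
  | mem x hx =>
    obtain ⟨i, rfl⟩ := hx
    rw [toLS_algebraMap]
    exact IntermediateField.subset_adjoin _ _ ⟨i, rfl⟩
  | algebraMap c =>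
    have h1 : ∀ p : K[X], toLS φ ρ (algebraMap K[X] _ p) ∈ E := fun p => by
      rw [toLS_algebraMap_polynomial, IsScalarTower.algebraMap_apply ℂ[X] (RatFunc ℂ)]
      exact E.algebraMap_mem _
    obtain ⟨a, b, -, rfl⟩ := IsFractionRing.div_surjective (A := K[X]) c
    rw [map_div₀, map_div₀, ← IsScalarTower.algebraMap_apply, ← IsScalarTower.algebraMap_apply]
    exact div_mem (h1 a) (h1 b)
  | add x y _ _ hx hy => rw [map_add]; exact add_mem hx hy
  | inv x _ hx => rw [map_inv₀]; exact inv_mem hx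
  | mul x y _ _ hx hy => rw [map_mul]; exact mul_mem hx hy

theorem mem_range_of_isIntegral {q : ℕ} (hq : 2 ≤ q) (hq0 : q ≠ 0) {m : ℕ} {p : ℕ → K[X]}
    (hp : p 0 ≠ 0) {f : PowerSeries K}
    (h : ∑ i ∈ Finset.range (m + 1), (p i : PowerSeries K) *
      PowerSeries.expand (q ^ i) (pow_ne_zero i hq0) f = 0) {y : Fin m → Conv φ ρ}
    (hy : ∀ i, (y i : PowerSeries K) = PowerSeries.expand (q ^ (i : ℕ)) (pow_ne_zero i hq0) f)
    {x : FractionRing (Conv φ ρ)}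
    (hx : x ∈ IntermediateField.adjoin (RatFunc K)
      (Set.range fun i => algebraMap _ (FractionRing (Conv φ ρ)) (y i)))
    (hInt : IsIntegral (RatFunc K) x) :
    x ∈ (algebraMap (RatFunc K) (FractionRing (Conv φ ρ))).range := by
  have halg : IsAlgebraic K[X] x :=
    (IsFractionRing.isAlgebraic_iff K[X] (RatFunc K) _).2 hInt.isAlgebraic
  obtain ⟨b, hb, hbx⟩ := halg.exists_integral_multiple
  have hbx1 : IsIntegral ℂ[X] (toLS φ ρ (b • x)) := by
    have h1 : ((toLS φ ρ).comp (algebraMap K[X] _)).IsIntegralElem (toLS φ ρ (b • x)) :=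
      RingHom.IsIntegralElem.map hbx _
    have h2 : (toLS φ ρ).comp (algebraMap K[X] _) =
        (algebraMap ℂ[X] (LS ℂ)).comp (Polynomial.mapRingHom φ) :=
      RingHom.ext fun p => toLS_algebraMap_polynomial p
    rw [h2] at h1
    exact h1.of_comp
  obtain ⟨g, hg⟩ := IsIntegrallyClosed.isIntegral_iff.1
    (hbx1.tower_top (A := PowerSeries ℂ))
  have hxE := toLS_mem_adjoin hx
  have hbmem : toLS φ ρ (b • x) ∈ IntermediateField.adjoin (RatFunc ℂ)
      (Set.range fun i => algebraMap _ (LS ℂ) (toComplex φ ρ (y i))) := by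
    rw [Algebra.smul_def, map_mul, toLS_algebraMap_polynomial,
      IsScalarTower.algebraMap_apply ℂ[X] (RatFunc ℂ)]
    exact mul_mem (IntermediateField.algebraMap_mem _ _) hxE
  rw [← hg] at hbx1 hbmem
  have hyC : ∀ i, toComplex φ ρ (y i) = PowerSeries.expand (q ^ (i : ℕ)) (pow_ne_zero i hq0)
      (PowerSeries.map φ f) := fun i => by
    rw [toComplex, RingHom.comp_apply, Subring.subtype_apply, hy, PowerSeries.map_expand]
  have hC : ∑ i ∈ Finset.range (m + 1), ((p i).map φ : PowerSeries ℂ) *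
      PowerSeries.expand (q ^ i) (pow_ne_zero i hq0) (PowerSeries.map φ f) = 0 := by
    rw [← map_zero (PowerSeries.map φ), ← h, map_sum]
    refine Finset.sum_congr rfl fun i _ => ?_
    rw [map_mul, PowerSeries.map_expand, Polynomial.polynomial_map_coe]
  simp only [hyC] at hbmem
  obtain ⟨P, rfl⟩ := exists_polynomial_of_isIntegral_of_mem_adjoin _
    (mem_adjoin_lsExpand hq ((Polynomial.map_ne_zero_iff φ.injective).2 hp) hq0 hC) hbx1 hbmem
  obtain ⟨u, v, hv, huv⟩ := IsFractionRing.div_surjective (A := Conv φ ρ) (b • x)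
  have hv0 : v ≠ 0 := nonZeroDivisors.ne_zero hv
  have hv1 : algebraMap _ (FractionRing (Conv φ ρ)) v ≠ 0 := by simpa using hv0
  rw [div_eq_iff hv1] at huv
  have h3 := congrArg (toLS φ ρ) huv
  rw [map_mul, toLS_algebraMap, toLS_algebraMap, ← hg, ← map_mul] at h3
  have h4 := IsFractionRing.injective (PowerSeries ℂ) (LS ℂ) h3
  obtain ⟨p', hp'⟩ := exists_polynomial_map_eq φ (u := u) (v := v)
    (fun h0 => hv0 (Subtype.ext h0)) (p := P) (by rw [mul_comm]; exact h4)
  have h5 : u = v * algebraMap K[X] _ p' := Subtype.ext hp'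
  rw [h5, map_mul, mul_comm, ← IsScalarTower.algebraMap_apply] at huv
  have h6 := mul_right_cancel₀ hv1 huv
  have hb1 : algebraMap K[X] (FractionRing (Conv φ ρ)) b ≠ 0 := by simpa using hb
  refine ⟨algebraMap K[X] _ p' / algebraMap K[X] _ b, ?_⟩
  rw [map_div₀, ← IsScalarTower.algebraMap_apply, ← IsScalarTower.algebraMap_apply, h6,
    Algebra.smul_def, mul_div_cancel_left₀ _ hb1]

end Conv

/-- The coefficient vectors of the linear relations deduced from an initial relation `x` between
the terms of a sequence `s` by means of the recurrences `∑ i, c k i * s (k + i) = 0`. -/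
def relOrbit {K : Type*} [Field K] (c : ℕ → ℕ → K) (x : ℕ → K) : ℕ → ℕ → K
  | 0 => x
  | k + 1 => fun i => c k 0 * relOrbit c x k (i + 1) - c k (i + 1) * relOrbit c x k 0

section relOrbit

variable {K : Type*} [Field K] {c : ℕ → ℕ → K} {x : ℕ → K} {m : ℕ}

theorem relOrbit_succ (k i : ℕ) : relOrbit c x (k + 1) i =
    c k 0 * relOrbit c x k (i + 1) - c k (i + 1) * relOrbit c x k 0 := rfl

theorem relOrbit_eq_zero_of_le (hc : ∀ k i, m < i → c k i = 0) (hx : ∀ i, m ≤ i → x i = 0)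
    (k : ℕ) {i : ℕ} (hi : m ≤ i) : relOrbit c x k i = 0 := by
  induction k generalizing i with
  | zero => exact hx i hi
  | succ k ih => 
    rw [relOrbit_succ, ih (Nat.le_succ_of_le hi), hc k _ (Nat.lt_succ_of_le hi), mul_zero, zero_mul,
      sub_zero]

theorem exists_relOrbit_ne_zero (hc : ∀ k i, m < i → c k i = 0) (hx : ∀ i, m ≤ i → x i = 0)
    (h0 : ∀ k, c k 0 ≠ 0) (hm : ∀ k, c k m ≠ 0) (hne : ∃ i, x i ≠ 0) (k : ℕ) :
    ∃ i, relOrbit c x k i ≠ 0 := by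
  induction k with
  | zero => exact hne
  | succ k ih =>
    by_contra! hall
    obtain ⟨i, hi⟩ := ih
    rcases m with _ | m
    · exact hi (relOrbit_eq_zero_of_le hc hx k (Nat.zero_le i))
    have h1 := hall m
    rw [relOrbit_succ, relOrbit_eq_zero_of_le hc hx k le_rfl, mul_zero, zero_sub, neg_eq_zero] at h1
    have h2 := (mul_eq_zero.1 h1).resolve_left (hm k)
    rcases i with _ | i
    · exact hi h2
    · have h3 := hall i
      rw [relOrbit_succ, h2, mul_zero, sub_zero] at h3
      exact hi ((mul_eq_zero.1 h3).resolve_left (h0 k))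

theorem sum_relOrbit_mul_eq_zero (hc : ∀ k i, m < i → c k i = 0) (hx : ∀ i, m ≤ i → x i = 0)
    (φ : K →+* ℂ) {s : ℕ → ℂ} (hs : ∀ k, ∑ i ∈ Finset.range (m + 1), φ (c k i) * s (k + i) = 0)
    (h : ∑ i ∈ Finset.range m, φ (x i) * s i = 0) (k : ℕ) :
    ∑ i ∈ Finset.range m, φ (relOrbit c x k i) * s (k + i) = 0 := by
  induction k with
  | zero => simpa [relOrbit] using h
  | succ k ih =>
    have h1 : ∑ i ∈ Finset.range (m + 1), φ (relOrbit c x k i) * s (k + i) = 0 := by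
      rw [Finset.sum_range_succ, ih, relOrbit_eq_zero_of_le hc hx k le_rfl, map_zero, zero_mul,
        add_zero]
    have h2 := hs k
    rw [Finset.sum_range_succ'] at h1 h2
    have h3 : ∑ i ∈ Finset.range m, φ (relOrbit c x (k + 1) i) * s (k + 1 + i) =
        φ (c k 0) * ∑ i ∈ Finset.range m, φ (relOrbit c x k (i + 1)) * s (k + (i + 1)) -
        φ (relOrbit c x k 0) * ∑ i ∈ Finset.range m, φ (c k (i + 1)) * s (k + (i + 1)) := by
      rw [Finset.mul_sum, Finset.mul_sum, ← Finset.sum_sub_distrib]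
      refine Finset.sum_congr rfl fun i _ => ?_
      rw [relOrbit_succ, map_sub, map_mul, map_mul, add_assoc, add_comm 1 i]
      ring
    rw [h3, eq_neg_of_add_eq_zero_left h1, eq_neg_of_add_eq_zero_left h2]
    ring

theorem sizeLE_relOrbit {q : ℕ} (hq : 2 ≤ q) {A B : ℕ} (hc : ∀ k i, SizeLE (A ^ q ^ k) (c k i))
    (hx : ∀ i, SizeLE B (x i)) (k i : ℕ) :
    SizeLE ((2 * A * B) ^ q ^ k) (relOrbit c x k i) := by
  have hB : 0 < B := (hx 0).1
  have hA : 0 < A := by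
    have := (hc 0 0).1
    rwa [pow_zero, pow_one] at this
  induction k generalizing i with
  | zero =>
    rw [pow_zero, pow_one]
    exact (hx i).of_dvd (dvd_mul_left _ _) (by positivity)
  | succ k ih =>
    rw [relOrbit_succ]
    refine (((hc k 0).mul (ih (i + 1))).sub ((hc k (i + 1)).mul (ih 0))).of_dvd ?_ (by positivity)
    calc 2 * (A ^ q ^ k * (2 * A * B) ^ q ^ k) ∣ (2 * A * B) ^ q ^ k * (2 * A * B) ^ q ^ k := by
          rw [← mul_assoc]
          refine mul_dvd_mul_right ?_ _
          rw [mul_pow, mul_pow]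
          exact (mul_dvd_mul_right (dvd_pow_self 2 (by positivity)) _).mul_right _
      _ = (2 * A * B) ^ (q ^ k * 2) := by rw [pow_mul, pow_two]
      _ ∣ (2 * A * B) ^ q ^ (k + 1) := by
          rw [pow_succ]
          exact pow_dvd_pow _ (Nat.mul_le_mul_left _ hq)

end relOrbit

theorem exists_sizeLE_pow_eval {K : Type*} [Field K] [NumberField K] {m : ℕ} {p : ℕ → K[X]}
    (hp : ∀ i, m < i → p i = 0) (β : K) :
    ∃ A : ℕ, ∀ n i, 0 < n → SizeLE (A ^ n) ((p i).eval (β ^ n)) := by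
  obtain ⟨D, hD⟩ := exists_sizeLE β
  have hDpos := hD.1
  set d := (Finset.range (m + 1)).sup fun i => (p i).natDegree
  have hd : ∀ i, (p i).natDegree ≤ d := fun i => by
    rcases le_or_gt i m with h | h
    · exact Finset.le_sup (f := fun i => (p i).natDegree) (Finset.mem_range.2 (by omega))
    · rw [hp i h, natDegree_zero]
      exact Nat.zero_le _
  choose B hB h using fun i => (p i).exists_sizeLE_eval (hd i)
  have hBpos : 0 < ∏ i ∈ Finset.range (m + 1), B i := Finset.prod_pos fun i _ => hB i
  refine ⟨(∏ i ∈ Finset.range (m + 1), B i) * D ^ d, fun n i hn => ?_⟩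
  rcases le_or_gt i m with hi | hi
  · refine (h i (D ^ n) (β ^ n) (hD.pow n)).of_dvd ?_ (by positivity)
    rw [mul_pow, ← pow_mul, ← pow_mul, mul_comm n d]
    exact mul_dvd_mul_right ((Finset.dvd_prod_of_mem B (Finset.mem_range.2 (by omega))).trans
      (dvd_pow_self _ hn.ne')) _
  · rw [hp i hi, eval_zero]
    exact ⟨by positivity, by simpa using isIntegral_zero, fun σ => by
      rw [map_zero, norm_zero]
      exact Nat.cast_nonneg _⟩

namespace Conv

variable {K : Type*} [Field K] {φ : K →+* ℂ} {ρ : ℝ}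

theorem coeff_expand_mul_pow_eq_zero {Q : ℕ} (hQ : Q ≠ 0) (f : PowerSeries K) (z : ℂ) {n : ℕ}
    (hn : n ∉ Set.range (Q * ·)) :
    φ (PowerSeries.coeff n (PowerSeries.expand Q hQ f)) * z ^ n = 0 := by
  rw [PowerSeries.coeff_expand_of_not_dvd, map_zero, zero_mul]
  rintro ⟨c, rfl⟩
  exact hn ⟨c, rfl⟩

theorem expand_mem (h0 : 0 ≤ ρ) (h1 : ρ ≤ 1) {f : PowerSeries K} (hf : f ∈ Conv φ ρ) {Q : ℕ}
    (hQ : Q ≠ 0) : PowerSeries.expand Q hQ f ∈ Conv φ ρ := by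
  have hinj : Function.Injective (Q * · : ℕ → ℕ) := mul_right_injective₀ hQ
  rw [mem_iff, ← hinj.summable_iff fun n hn => by
    rw [coeff_expand_mul_pow_eq_zero hQ f _ hn, norm_zero]]
  refine Summable.of_nonneg_of_le (fun _ => norm_nonneg _) (fun n => ?_) hf
  simp only [Function.comp_apply, PowerSeries.coeff_expand_mul, norm_mul, norm_pow,
    Complex.norm_real, Real.norm_of_nonneg h0]
  exact mul_le_mul_of_nonneg_left
    (pow_le_pow_of_le_one h0 h1 (Nat.le_mul_of_pos_left n (Nat.pos_of_ne_zero hQ))) (norm_nonneg _)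

theorem eval_eq_of_coe_eq_expand {f : PowerSeries K} {Q : ℕ} (hQ : Q ≠ 0) {y : Conv φ ρ}
    (hy : (y : PowerSeries K) = PowerSeries.expand Q hQ f) {z : ℂ} (hz : ‖z‖ ≤ ρ) :
    eval φ hz y = ∑' n, φ (PowerSeries.coeff n f) * (z ^ Q) ^ n := by
  have hinj : Function.Injective (Q * · : ℕ → ℕ) := mul_right_injective₀ hQ
  rw [eval_apply, hy, ← hinj.tsum_eq fun n hn => by_contra fun h =>
    hn (coeff_expand_mul_pow_eq_zero hQ f z h)]
  exact tsum_congr fun n => by rw [PowerSeries.coeff_expand_mul, pow_mul]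

end Conv

theorem MvPolynomial.eval₂_germ {S ι : Type*} [CommRing S] (U : Filter ℕ) (e : ℕ → S →+* ℂ)
    (t : ℕ → ι → ℂ) (F : MvPolynomial ι S) :
    MvPolynomial.eval₂ ((Filter.Germ.coeRingHom U).comp (RingHom.pi e))
      (fun i => ((fun k => t k i : ℕ → ℂ) : Filter.Germ U ℂ)) F =
    ((fun k => MvPolynomial.eval₂ (e k) (t k) F : ℕ → ℂ) : Filter.Germ U ℂ) := by
  have h1 := MvPolynomial.eval₂_comp_left (Filter.Germ.coeRingHom (R := ℂ) U) (RingHom.pi e)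
    (fun i k => t k i) F
  refine h1.symm.trans ?_
  have h2 : MvPolynomial.eval₂ (RingHom.pi e) (fun i k => t k i) F =
      fun k => MvPolynomial.eval₂ (e k) (t k) F := by
    funext k
    exact MvPolynomial.eval₂_comp_left (Pi.evalRingHom (fun _ => ℂ) k) (RingHom.pi e)
      (fun i k => t k i) F
  rw [h2]
  rfl

theorem pow_pow_injective {K : Type*} [Field K] (φ : K →+* ℂ) {q : ℕ} (hq : 2 ≤ q) {β : K}
    (hβ0 : β ≠ 0) (hβ1 : ‖φ β‖ < 1) : Function.Injective fun k : ℕ => β ^ q ^ k := by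
  intro a b hab
  have h1 := congrArg (fun w => ‖φ w‖) hab
  simp only [map_pow, norm_pow] at h1
  have h2 := pow_right_injective₀ (norm_pos_iff.2 ((_root_.map_ne_zero φ).2 hβ0)) hβ1.ne h1
  exact Nat.pow_right_injective hq h2

/-- Values at `β` of the solutions of a Mahler equation which is regular along the orbit of `β`
are linearly independent. -/
theorem sum_mul_eval_ne_zero {K : Type*} [Field K] [NumberField K] (φ : K →+* ℂ) {q : ℕ}
    (hq : 2 ≤ q) (hq0 : q ≠ 0) {β : K} (hβ0 : β ≠ 0) (hβ1 : ‖φ β‖ < 1) {f : PowerSeries K}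
    (hf : f ∈ Conv φ ‖φ β‖) {m : ℕ} {p : ℕ → K[X]} (hp : ∀ i, m < i → p i = 0)
    (hp0 : ∀ k, (p 0).eval (β ^ q ^ k) ≠ 0) (hpm : ∀ k, (p m).eval (β ^ q ^ k) ≠ 0)
    (hrel : ∑ i ∈ Finset.range (m + 1), (p i : PowerSeries K) *
      PowerSeries.expand (q ^ i) (pow_ne_zero i hq0) f = 0)
    (hli : LinearIndependent K[X] fun i : Fin m =>
      PowerSeries.expand (q ^ (i : ℕ)) (pow_ne_zero i hq0) f)
    {x : ℕ → K} (hx : ∀ i, m ≤ i → x i = 0) (hx0 : ∃ i, x i ≠ 0) :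
    ∑ i ∈ Finset.range m, φ (x i) *
      ∑' n, φ (PowerSeries.coeff n f) * (φ β ^ q ^ i) ^ n ≠ 0 := by
  classical
  intro hsum
  obtain ⟨ρ, hρ⟩ : ∃ ρ, ρ = ‖φ β‖ := ⟨_, rfl⟩
  rw [← hρ] at hβ1 hf
  have hρ0 : 0 ≤ ρ := hρ ▸ norm_nonneg _
  have hz : ∀ k, ‖φ (β ^ q ^ k)‖ ≤ ρ := fun k => by
    rw [map_pow, norm_pow, ← hρ]
    exact pow_le_of_le_one hρ0 hβ1.le (pow_ne_zero k hq0)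
  set c : ℕ → ℕ → K := fun k i => (p i).eval (β ^ q ^ k) with hc
  have hc0 : ∀ k i, m < i → c k i = 0 := fun k i hi => by simp [hc, hp i hi]
  set s : ℕ → ℂ := fun i => ∑' n, φ (PowerSeries.coeff n f) * (φ β ^ q ^ i) ^ n with hs
  set y : ℕ → Conv φ ρ := fun i =>
    ⟨PowerSeries.expand (q ^ i) (pow_ne_zero i hq0) f, Conv.expand_mem hρ0 hβ1.le hf _⟩ with hy
  have hys : ∀ k i, Conv.eval φ (hz k) (y i) = s (k + i) := fun k i => by
    rw [Conv.eval_eq_of_coe_eq_expand (pow_ne_zero i hq0) rfl, hs]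
    simp only [map_pow, ← pow_mul, pow_add, mul_assoc]
  have hrelC : ∑ i ∈ Finset.range (m + 1), Conv.ofPoly φ ρ (p i) * y i = 0 := by
    refine Subtype.ext (Eq.trans ?_ hrel)
    rw [AddSubmonoidClass.coe_finsetSum]
    rfl
  have hrels : ∀ k, ∑ i ∈ Finset.range (m + 1), φ (c k i) * s (k + i) = 0 := fun k => by
    rw [← map_zero (Conv.eval φ (hz k)), ← hrelC, map_sum]
    refine Finset.sum_congr rfl fun i _ => ?_
    rw [map_mul, Conv.eval_ofPoly, hys]
  have hsum' := sum_relOrbit_mul_eq_zero hc0 hx φ hrels hsum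
  obtain ⟨A, hA⟩ := exists_sizeLE_pow_eval hp β
  have hcs : ∀ k i, SizeLE (A ^ q ^ k) (c k i) := fun k i => hA _ _ (by positivity)
  obtain ⟨B, hB, hBx⟩ := exists_sizeLE_family fun i : Fin m => x i
  have hBx' : ∀ i, SizeLE B (x i) := fun i => by
    rcases lt_or_ge i m with hi | hi
    · exact hBx ⟨i, hi⟩
    · rw [hx i hi]
      exact ⟨hB, by simpa using isIntegral_zero, fun σ => by simp⟩
  obtain ⟨D, hD⟩ := exists_sizeLE β
  have horb := sizeLE_relOrbit hq hcs hBx'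
  set C := 2 * A * B * D with hC
  have hCpos : 0 < C := Nat.mul_pos (by simpa using (horb 0 0).1) hD.1
  have horbC : ∀ k i, SizeLE (C ^ q ^ k) (relOrbit c x k i) := fun k i =>
    (horb k i).of_dvd (pow_dvd_pow_of_dvd (dvd_mul_right _ _) _) (by positivity)
  have hβC : ∀ k, SizeLE (C ^ q ^ k) (β ^ q ^ k) := fun k =>
    (hD.pow _).of_dvd (pow_dvd_pow_of_dvd (dvd_mul_left _ _) _) (by positivity)
  set U := Filter.hyperfilter ℕ
  let Ω := Filter.Germ (U : Filter ℕ) ℂ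
  let ev : Conv φ ρ →+* Ω :=
    (Filter.Germ.coeRingHom (U : Filter ℕ)).comp (RingHom.pi fun k => Conv.eval φ (hz k))
  have hinj : Function.Injective ev := by
    rw [injective_iff_map_eq_zero]
    intro g hg
    by_contra hg0
    have hg1 : ∀ᶠ k in (U : Filter ℕ), Conv.eval φ (hz k) g = 0 := Filter.Germ.coe_eq.1 hg
    obtain ⟨P, hP, hP1⟩ := exists_polynomial_relation φ hq hβ0 hρ hβ1 (ι := Empty)
      (t := fun _ i => i.elim) (fun _ i => i.elim) hβC hz
      (F := MvPolynomial.C g) (by simpa using hg0)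
    obtain ⟨P, rfl⟩ := MvPolynomial.C_surjective Empty P
    have h1 : ∀ᶠ k in (U : Filter ℕ), P.eval (β ^ q ^ k) = 0 := by
      filter_upwards [hg1, Nat.hyperfilter_le_atTop hP1] with k hk1 hk2
      simpa using hk2 (by simpa using hk1)
    have h2 : {k : ℕ | P.eval (β ^ q ^ k) = 0}.Finite := by
      have h3 : P ≠ 0 := fun h => hP (by rw [h, map_zero])
      refine ((P.roots.toFinset.finite_toSet).preimage
        (pow_pow_injective φ hq hβ0 (hρ ▸ hβ1)).injOn).subset fun k hk => ?_
      simpa [h3] using hk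
    exact Filter.notMem_hyperfilter_of_finite h2 h1
  let ξ : Fin m → Ω := fun i => ((fun k => φ (relOrbit c x k i) : ℕ → ℂ) : Ω)
  let _ : Algebra (Conv φ ρ) Ω := ev.toAlgebra
  let _ : Algebra K[X] Ω := (ev.comp (Conv.ofPoly φ ρ)).toAlgebra
  have : FaithfulSMul (Conv φ ρ) Ω := (faithfulSMul_iff_algebraMap_injective _ _).2 hinj
  let _ : Algebra (FractionRing (Conv φ ρ)) Ω := FractionRing.liftAlgebra (Conv φ ρ) Ω
  let _ : Algebra (RatFunc K) Ω := ((algebraMap (FractionRing (Conv φ ρ)) Ω).comp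
    (algebraMap (RatFunc K) (FractionRing (Conv φ ρ)))).toAlgebra
  have : IsScalarTower (RatFunc K) (FractionRing (Conv φ ρ)) Ω :=
    IsScalarTower.of_algebraMap_eq' rfl
  have : IsScalarTower K[X] (Conv φ ρ) Ω := IsScalarTower.of_algebraMap_eq' rfl
  have : IsScalarTower K[X] (RatFunc K) Ω := by
    refine IsScalarTower.of_algebraMap_eq fun P => ?_
    rw [IsScalarTower.algebraMap_apply (RatFunc K) (FractionRing (Conv φ ρ)) Ω,
      ← IsScalarTower.algebraMap_apply K[X] (RatFunc K),
      IsScalarTower.algebraMap_apply K[X] (Conv φ ρ) (FractionRing (Conv φ ρ)),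
      ← IsScalarTower.algebraMap_apply (Conv φ ρ)]
    rfl
  have hξ : ξ = 0 := by
    refine eq_zero_of_sum_mul_eq_zero_of_algebraicIndependent_fractionRing (P := K[X])
      (A := Conv φ ρ) (κ := RatFunc K) (N := FractionRing (Conv φ ρ)) (y := fun i : Fin m => y i)
      ?_ ?_ ?_ ?_
    · refine LinearIndependent.of_comp (M' := PowerSeries K)
        { toFun := fun g : Conv φ ρ => (g : PowerSeries K)
          map_add' := fun _ _ => rfl
          map_smul' := fun P g => ?_ } hli
      rw [Algebra.smul_def, Algebra.smul_def, Subring.coe_mul, algebraMap_polynomial_powerSeries]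
      rfl
    · intro w hw hInt
      exact Conv.mem_range_of_isIntegral hq hq0 (fun h => hp0 0 (by rw [h, eval_zero])) hrel
        (fun _ => rfl) hw hInt
    · intro S hS
      rw [AlgebraicIndepOn, algebraicIndependent_iff] at hS ⊢
      intro F hF
      by_contra hF0
      have hF1 : ∀ᶠ k in (U : Filter ℕ), MvPolynomial.eval₂ (Conv.eval φ (hz k))
          (fun i : S => φ (relOrbit c x k i)) F = 0 := by
        refine Filter.Germ.coe_eq.1 (Eq.trans ?_ hF)
        exact (MvPolynomial.eval₂_germ _ _ (fun k (i : S) => φ (relOrbit c x k i)) F).symm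
      have : Fintype S := Fintype.ofFinite S
      obtain ⟨P, hP, hP1⟩ := exists_polynomial_relation φ hq hβ0 hρ hβ1 (ι := S)
        (t := fun k i => relOrbit c x k i) (fun k i => horbC k i) hβC hz hF0
      refine hP (hS P ?_)
      refine Eq.trans (MvPolynomial.eval₂_germ (U : Filter ℕ)
        (fun k => (Conv.eval φ (hz k)).comp (Conv.ofPoly φ ρ))
        (fun k (i : S) => φ (relOrbit c x k i)) P) (Filter.Germ.coe_eq.2 ?_)
      filter_upwards [hF1, Nat.hyperfilter_le_atTop hP1] with k hk1 hk2
      have h3 := congrArg φ (hk2 hk1)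
      rw [map_zero, MvPolynomial.eval₂_comp_left] at h3
      refine Eq.trans ?_ h3
      congr 1
      exact RingHom.ext fun P => Conv.eval_ofPoly (hz k) P
    · have h1 : ∑ i : Fin m, ev (y i) * ξ i = ((fun k => ∑ i ∈ Finset.range m,
          φ (relOrbit c x k i) * s (k + i) : ℕ → ℂ) : Ω) := by
        have h2 : (fun k => ∑ i ∈ Finset.range m, φ (relOrbit c x k i) * s (k + i)) =
            ∑ i : Fin m, (fun k => Conv.eval φ (hz k) (y i)) * fun k => φ (relOrbit c x k i) := by
          funext k
          rw [Finset.sum_apply, ← Fin.sum_univ_eq_sum_range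
            (fun i => φ (relOrbit c x k i) * s (k + i))]
          refine Finset.sum_congr rfl fun i _ => ?_
          rw [Pi.mul_apply, hys, mul_comm]
        rw [h2]
        exact (map_sum (Filter.Germ.coeRingHom (R := ℂ) (U : Filter ℕ)) _ _).symm
      refine h1.trans ?_
      simp only [hsum']
      rfl
  have h1 : ∀ᶠ k in (U : Filter ℕ), ∀ i : Fin m, φ (relOrbit c x k i) = 0 :=
    Filter.eventually_all.2 fun i => Filter.Germ.coe_eq.1 (congrFun hξ i)
  obtain ⟨k, hk⟩ := h1.exists
  obtain ⟨i, hi⟩ := exists_relOrbit_ne_zero hc0 hx hp0 hpm hx0 k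
  rcases lt_or_ge i m with him | him
  · exact hi ((map_eq_zero φ).1 (hk ⟨i, him⟩))
  · exact hi (relOrbit_eq_zero_of_le hc0 hx k him)

section relations

variable {K : Type*} [Field K] {q : ℕ}

theorem exists_coe_eq_psSection (Q n : ℕ) (hQ : Q ≠ 0) (p : K[X]) :
    ∃ p' : K[X], (p' : PowerSeries K) = psSection Q n p := by
  refine ⟨PowerSeries.trunc (p.natDegree + 1) (psSection Q n p), ?_⟩
  ext j
  rw [Polynomial.coeff_coe, PowerSeries.coeff_trunc]
  split_ifs with hj
  · rfl
  · rw [psSection, PowerSeries.coeff_mk, Polynomial.coeff_coe,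
      Polynomial.coeff_eq_zero_of_natDegree_lt]
    have := Nat.le_mul_of_pos_left j (Nat.pos_of_ne_zero hQ)
    omega

/-- A Mahler relation without constant term can be divided by `σ_q`. -/
theorem exists_relation_of_shifted (hq0 : q ≠ 0) {f : PowerSeries K} {m : ℕ} {p : ℕ → K[X]}
    (hne : ∃ i < m, p i ≠ 0)
    (h : ∑ i ∈ Finset.range m, (p i : PowerSeries K) *
      PowerSeries.expand (q ^ (1 + i)) (pow_ne_zero _ hq0) f = 0) :
    ∃ p' : ℕ → K[X], (∃ i < m, p' i ≠ 0) ∧ ∑ i ∈ Finset.range m, (p' i : PowerSeries K) *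
      PowerSeries.expand (q ^ i) (pow_ne_zero _ hq0) f = 0 := by
  choose P hP using fun n i => exists_coe_eq_psSection q n hq0 (p i)
  have hsum : ∀ i, (p i : PowerSeries K) = ∑ n ∈ Finset.range q,
      PowerSeries.X ^ n * PowerSeries.expand q hq0 (P n i : PowerSeries K) := fun i => by
    simp only [hP, sum_X_pow_mul_expand_psSection]
  have h1 : ∑ n ∈ Finset.range q, PowerSeries.X ^ n * PowerSeries.expand q hq0
      (∑ i ∈ Finset.range m, (P n i : PowerSeries K) *
        PowerSeries.expand (q ^ i) (pow_ne_zero _ hq0) f) = 0 := by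
    rw [← h]
    simp only [map_sum, Finset.mul_sum]
    rw [Finset.sum_comm]
    refine Finset.sum_congr rfl fun i _ => ?_
    rw [hsum i, Finset.sum_mul, expand_pow_add hq0 1 i]
    refine Finset.sum_congr rfl fun n _ => ?_
    rw [map_mul, mul_assoc]
    simp only [pow_one]
  obtain ⟨i, him, hi⟩ := hne
  have h2 : ∃ n < q, P n i ≠ 0 := by
    by_contra! hall
    refine hi (Polynomial.coe_injective K ?_)
    rw [hsum i, Polynomial.coe_zero]
    refine Finset.sum_eq_zero fun n hn => ?_
    rw [hall n (Finset.mem_range.1 hn), Polynomial.coe_zero, map_zero, mul_zero]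
  obtain ⟨n, hn, hni⟩ := h2
  exact ⟨P n, ⟨i, him, hni⟩, eq_zero_of_sum_X_pow_mul_expand hq0 h1 hn⟩

/-- A relation of minimal order has nonzero extreme coefficients. -/
theorem exists_minimal_relation (hq0 : q ≠ 0) {f : PowerSeries K} (hf : f ≠ 0) {m₀ : ℕ}
    {p₀ : ℕ → K[X]} (hne : ∃ i ≤ m₀, p₀ i ≠ 0)
    (h : ∑ i ∈ Finset.range (m₀ + 1), (p₀ i : PowerSeries K) *
      PowerSeries.expand (q ^ i) (pow_ne_zero _ hq0) f = 0) :
    ∃ (m : ℕ) (p : ℕ → K[X]), 1 ≤ m ∧ p 0 ≠ 0 ∧ p m ≠ 0 ∧ (∀ i, m < i → p i = 0) ∧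
      ∑ i ∈ Finset.range (m + 1), (p i : PowerSeries K) *
        PowerSeries.expand (q ^ i) (pow_ne_zero _ hq0) f = 0 ∧
      LinearIndependent K[X] fun i : Fin m =>
        PowerSeries.expand (q ^ (i : ℕ)) (pow_ne_zero i hq0) f := by
  classical
  have hex : ∃ n : ℕ, ∃ p : ℕ → K[X], (∃ i < n, p i ≠ 0) ∧
      ∑ i ∈ Finset.range n, (p i : PowerSeries K) *
        PowerSeries.expand (q ^ i) (pow_ne_zero _ hq0) f = 0 := by
    obtain ⟨i, hi, hi0⟩ := hne
    exact ⟨m₀ + 1, p₀, ⟨i, Nat.lt_succ_of_le hi, hi0⟩, h⟩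
  obtain ⟨n, hn⟩ : ∃ n, n = Nat.find hex := ⟨_, rfl⟩
  have hspec := Nat.find_spec hex
  have hmin : ∀ n' < n, ∀ p : ℕ → K[X], ∑ i ∈ Finset.range n', (p i : PowerSeries K) *
      PowerSeries.expand (q ^ i) (pow_ne_zero _ hq0) f = 0 → ∀ i < n', p i = 0 := by
    intro n' hn' p hp i hi
    by_contra hpi
    exact Nat.find_min hex (hn ▸ hn') ⟨p, ⟨i, hi, hpi⟩, hp⟩
  rw [← hn] at hspec
  obtain ⟨p, ⟨j, hj, hpj⟩, hp⟩ := hspec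
  obtain ⟨m, rfl⟩ : ∃ m, n = m + 1 := ⟨n - 1, by omega⟩
  have hpm : p m ≠ 0 := by
    intro h0
    rw [Finset.sum_range_succ, h0, Polynomial.coe_zero, zero_mul, add_zero] at hp
    rcases Nat.lt_succ_iff_lt_or_eq.1 hj with hj | rfl
    · exact hpj (hmin m (Nat.lt_succ_self m) p hp j hj)
    · exact hpj h0
  have hm1 : 1 ≤ m := by
    by_contra hm
    obtain rfl : m = 0 := by omega
    rw [zero_add, Finset.sum_range_one] at hp
    rcases mul_eq_zero.1 hp with h1 | h1
    · exact hpm (Polynomial.coe_eq_zero_iff.1 h1)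
    · exact hf (expand_powerSeries_injective (pow_ne_zero _ hq0) (h1.trans (map_zero _).symm))
  have hp0 : p 0 ≠ 0 := by
    intro h0
    rw [Finset.sum_range_succ', h0, Polynomial.coe_zero, zero_mul, add_zero] at hp
    obtain ⟨p', ⟨i, hi, hi0⟩, hp'⟩ := exists_relation_of_shifted (f := f) hq0 (m := m)
      (p := fun i => p (i + 1)) ⟨m - 1, by omega, by rwa [Nat.sub_add_cancel hm1]⟩
      (by simpa only [add_comm 1] using hp)
    exact hi0 (hmin m (Nat.lt_succ_self m) p' hp' i hi)
  refine ⟨m, fun i => if i ≤ m then p i else 0, hm1, by simpa using hp0, by simpa using hpm,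
    fun i hi => if_neg (by omega), ?_, ?_⟩
  · rw [← hp]
    refine Finset.sum_congr rfl fun i hi => ?_
    beta_reduce
    rw [if_pos (by have := Finset.mem_range.1 hi; omega)]
  · rw [Fintype.linearIndependent_iff]
    intro g hg i
    have h1 := hmin m (Nat.lt_succ_self m) (fun i => if h : i < m then g ⟨i, h⟩ else 0) ?_ i i.2
    · simpa using h1
    · rw [← hg, ← Fin.sum_univ_eq_sum_range fun i => ((if h : i < m then g ⟨i, h⟩ else 0 : K[X]) :
        PowerSeries K) * PowerSeries.expand (q ^ i) (pow_ne_zero _ hq0) f]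
      refine Finset.sum_congr rfl fun i _ => ?_
      rw [dif_pos i.2, Algebra.smul_def, algebraMap_polynomial_powerSeries]

theorem exists_iterated_relation (hq0 : q ≠ 0) {f : PowerSeries K} {m : ℕ} (hm : 1 ≤ m)
    {p : ℕ → K[X]} (hp0 : p 0 ≠ 0)
    (h : ∑ i ∈ Finset.range (m + 1), (p i : PowerSeries K) *
      PowerSeries.expand (q ^ i) (pow_ne_zero _ hq0) f = 0) (k : ℕ) :
    ∃ (b : K[X]) (c : ℕ → K[X]), b ≠ 0 ∧ (∀ i, m ≤ i → c i = 0) ∧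
      (b : PowerSeries K) * f = ∑ i ∈ Finset.range m, (c i : PowerSeries K) *
        PowerSeries.expand (q ^ (k + i)) (pow_ne_zero _ hq0) f := by
  induction k with
  | zero =>
    refine ⟨1, fun i => if i = 0 then 1 else 0, one_ne_zero, fun i hi => if_neg (by omega), ?_⟩
    rw [Finset.sum_eq_single 0]
    · simp
    · intro i _ hi
      simp [hi]
    · intro h0
      exact absurd (Finset.mem_range.2 (by omega)) h0
  | succ k ih =>
    obtain ⟨b, c, hb, hc, hbc⟩ := ih
    have hQ : q ^ k ≠ 0 := pow_ne_zero k hq0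
    refine ⟨expand K (q ^ k) (p 0) * b,
      fun i => if i < m then expand K (q ^ k) (p 0) * c (i + 1) - c 0 * expand K (q ^ k) (p (i + 1))
        else 0, mul_ne_zero ?_ hb, fun i hi => if_neg (by omega), ?_⟩
    · exact (Polynomial.expand_ne_zero (Nat.pos_of_ne_zero hQ)).2 hp0
    have h1 := congrArg (PowerSeries.expand (q ^ k) hQ) h
    simp only [map_sum, map_mul, map_zero, ← expand_pow_add hq0, expand_coe] at h1
    rw [Finset.sum_range_succ'] at h1
    have h2 : ∑ i ∈ Finset.range (m + 1), (c i : PowerSeries K) *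
        PowerSeries.expand (q ^ (k + i)) (pow_ne_zero _ hq0) f = b * f := by
      rw [Finset.sum_range_succ, hc m le_rfl, Polynomial.coe_zero, zero_mul, add_zero, hbc]
    rw [Finset.sum_range_succ'] at h2
    have h3 : ∑ i ∈ Finset.range m, ((if i < m then expand K (q ^ k) (p 0) * c (i + 1) -
          c 0 * expand K (q ^ k) (p (i + 1)) else 0 : K[X]) : PowerSeries K) *
        PowerSeries.expand (q ^ (k + 1 + i)) (pow_ne_zero _ hq0) f =
        (expand K (q ^ k) (p 0) : K[X]) * ∑ i ∈ Finset.range m, (c (i + 1) : PowerSeries K) *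
          PowerSeries.expand (q ^ (k + (i + 1))) (pow_ne_zero _ hq0) f -
        (c 0 : PowerSeries K) * ∑ i ∈ Finset.range m,
          ((expand K (q ^ k) (p (i + 1)) : K[X]) : PowerSeries K) *
          PowerSeries.expand (q ^ (k + (i + 1))) (pow_ne_zero _ hq0) f := by
      rw [Finset.mul_sum, Finset.mul_sum, ← Finset.sum_sub_distrib]
      refine Finset.sum_congr rfl fun i hi => ?_
      rw [if_pos (Finset.mem_range.1 hi)]
      simp only [add_assoc, add_comm 1 i]
      push_cast
      ring
    rw [h3, eq_sub_of_add_eq h2, eq_neg_of_add_eq_zero_left h1]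
    push_cast
    ring

end relations

section Field

variable {K : Type*} [Field K]

/-- A relation `b f = ∑ cᵢ gᵢ` can be divided by powers of `X - α` until not all coefficients
vanish at `α`. -/
theorem exists_relation_eval_ne_zero (α : K) {f : PowerSeries K} {g : ℕ → PowerSeries K} {m : ℕ}
    {b : K[X]} {c : ℕ → K[X]} (hb : b ≠ 0) (hc : ∀ i, m ≤ i → c i = 0)
    (h : (b : PowerSeries K) * f = ∑ i ∈ Finset.range m, (c i : PowerSeries K) * g i) :
    ∃ (b' : K[X]) (c' : ℕ → K[X]), (∀ i, m ≤ i → c' i = 0) ∧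
      (b' : PowerSeries K) * f = ∑ i ∈ Finset.range m, (c' i : PowerSeries K) * g i ∧
      (b'.eval α ≠ 0 ∨ ∃ i, (c' i).eval α ≠ 0) := by
  induction hn : b.natDegree generalizing b c with
  | zero =>
    refine ⟨b, c, hc, h, Or.inl ?_⟩
    obtain ⟨a, rfl⟩ := natDegree_eq_zero.1 hn
    rw [eval_C]
    exact fun h0 => hb (by rw [h0, C_0])
  | succ n ih =>
    by_cases hα : b.eval α ≠ 0 ∨ ∃ i, (c i).eval α ≠ 0
    · exact ⟨b, c, hc, h, hα⟩
    push Not at hα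
    have hXα : ((X - C α : K[X]) : PowerSeries K) ≠ 0 := fun h0 =>
      X_sub_C_ne_zero α (Polynomial.coe_eq_zero_iff.1 h0)
    obtain ⟨b', rfl⟩ := dvd_iff_isRoot.2 hα.1
    choose c' hc' using fun i => dvd_iff_isRoot.2 (hα.2 i)
    have hb' : b' ≠ 0 := right_ne_zero_of_mul hb
    refine ih (b := b') (c := c') hb' (fun i hi => ?_) (mul_left_cancel₀ hXα ?_) ?_
    · have := hc i hi
      rw [hc'] at this
      exact (mul_eq_zero.1 this).resolve_left (X_sub_C_ne_zero α)
    · rw [← mul_assoc, ← Polynomial.coe_mul, h, Finset.mul_sum]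
      refine Finset.sum_congr rfl fun i _ => ?_
      rw [← mul_assoc, ← Polynomial.coe_mul, ← hc']
    · rw [natDegree_mul (X_sub_C_ne_zero α) hb', natDegree_X_sub_C] at hn
      omega

theorem Conv.anti {φ : K →+* ℂ} {ρ ρ' : ℝ} (h0 : 0 ≤ ρ') (h : ρ' ≤ ρ) {f : PowerSeries K}
    (hf : f ∈ Conv φ ρ) : f ∈ Conv φ ρ' :=
  Conv.summable_norm_of_le (z := (ρ' : ℂ))
    (by rwa [Complex.norm_real, Real.norm_of_nonneg h0]) ⟨f, hf⟩

/-- A nonzero polynomial has only finitely many zeros on a Mahler orbit. -/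
theorem eventually_eval_pow_pow_ne_zero {q : ℕ} (φ : K →+* ℂ) (hq : 2 ≤ q) {α : K} (hα0 : α ≠ 0)
    (hα1 : ‖φ α‖ < 1) {p : K[X]} (hp : p ≠ 0) :
    ∀ᶠ k in Filter.atTop, p.eval (α ^ q ^ k) ≠ 0 := by
  rw [← Nat.cofinite_eq_atTop]
  refine Set.Finite.subset
    ((p.rootSet_finite K).preimage (pow_pow_injective φ hq hα0 hα1).injOn) fun k hk => ?_
  rw [Set.mem_preimage, Polynomial.mem_rootSet]
  refine ⟨hp, ?_⟩
  rw [coe_aeval_eq_eval]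
  exact not_not.1 hk

end Field

/-- A Mahler function over a number field converging at `α`, `0 < |α| < 1`, satisfies a Mahler
equation whose leading coefficient does not vanish at `α`. -/
theorem exists_mahler_relation_eval_ne_zero {K : Type*} [Field K] [NumberField K] (φ : K →+* ℂ)
    {q : ℕ} (hq : 2 ≤ q) (hq0 : q ≠ 0) {α : K} (hα0 : α ≠ 0) (hα1 : ‖φ α‖ < 1)
    {f : PowerSeries K} (hf0 : f ≠ 0) (hf : f ∈ Conv φ ‖φ α‖) {m₀ : ℕ} {p₀ : ℕ → K[X]}
    (hne : ∃ i ≤ m₀, p₀ i ≠ 0)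
    (hrel : ∑ i ∈ Finset.range (m₀ + 1), (p₀ i : PowerSeries K) *
      PowerSeries.expand (q ^ i) (pow_ne_zero _ hq0) f = 0) :
    ∃ (a : K[X]) (M k : ℕ) (c : ℕ → K[X]), a.eval α ≠ 0 ∧
      (a : PowerSeries K) * f = ∑ i ∈ Finset.range M, (c i : PowerSeries K) *
        PowerSeries.expand (q ^ (k + 1 + i)) (pow_ne_zero _ hq0) f := by
  obtain ⟨m, p, hm, hp0, hpm, hp, hrel, hli⟩ := exists_minimal_relation hq0 hf0 hne hrel
  obtain ⟨k, hk⟩ := Filter.eventually_atTop.1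
    ((eventually_eval_pow_pow_ne_zero φ hq hα0 hα1 hp0).and
      (eventually_eval_pow_pow_ne_zero φ hq hα0 hα1 hpm))
  obtain ⟨b, c, hb, hc, hbc⟩ := exists_iterated_relation hq0 hm hp0 hrel (k + 1)
  obtain ⟨b, c, hc, hbc, hα⟩ := exists_relation_eval_ne_zero α hb hc hbc
  rcases hα with hα | hα
  · exact ⟨b, m, k, c, hα, hbc⟩
  refine ⟨b, m, k, c, fun hbα => ?_, hbc⟩
  have hpow : ∀ j, (α ^ q ^ (k + 1)) ^ q ^ j = α ^ q ^ (k + 1 + j) := fun j => by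
    rw [← pow_mul, ← pow_add]
  have hle : ‖φ (α ^ q ^ (k + 1))‖ ≤ ‖φ α‖ := by
    rw [map_pow, norm_pow]
    exact pow_le_of_le_one (norm_nonneg _) hα1.le (pow_ne_zero _ hq0)
  refine sum_mul_eval_ne_zero φ hq hq0 (β := α ^ q ^ (k + 1)) (pow_ne_zero _ hα0)
    (hle.trans_lt hα1) (Conv.anti (norm_nonneg _) hle hf) hp
    (fun j => ?_) (fun j => ?_) hrel hli (x := fun i => (c i).eval α)
    (fun i hi => by rw [hc i hi, eval_zero]) hα ?_
  · rw [hpow]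
    exact (hk _ (by omega)).1
  · rw [hpow]
    exact (hk _ (by omega)).2
  let y : ℕ → Conv φ ‖φ α‖ := fun i => ⟨_, Conv.expand_mem (norm_nonneg _) hα1.le hf
    (pow_ne_zero (k + 1 + i) hq0)⟩
  have h1 : Conv.ofPoly φ ‖φ α‖ b * ⟨f, hf⟩ =
      ∑ i ∈ Finset.range m, Conv.ofPoly φ ‖φ α‖ (c i) * y i := by
    refine Subtype.ext ?_
    rw [AddSubmonoidClass.coe_finsetSum]
    exact hbc
  have h2 := congrArg (Conv.eval φ (le_refl ‖φ α‖)) h1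
  rw [map_mul, Conv.eval_ofPoly, hbα, map_zero, zero_mul, map_sum] at h2
  rw [h2]
  refine Finset.sum_congr rfl fun i _ => ?_
  rw [map_mul, Conv.eval_ofPoly, Conv.eval_eq_of_coe_eq_expand (pow_ne_zero _ hq0) rfl]
  rw [← map_pow, hpow, map_pow]

/-- The coefficients of a solution of a Mahler equation lie in the field generated by the
coefficients of the equation and finitely many initial coefficients of the solution. -/
theorem coeff_mem_of_mahler_relation {L : Type*} [Field L] (S : Subfield L) {q : ℕ} (hq : 2 ≤ q)
    (hq0 : q ≠ 0) {f : PowerSeries L} {m : ℕ} {p : ℕ → L[X]} (hp0 : p 0 ≠ 0)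
    (hp : ∀ i ≤ m, ∀ n, (p i).coeff n ∈ S)
    (hf : ∀ n ≤ (p 0).natTrailingDegree, PowerSeries.coeff n f ∈ S)
    (hrel : ∑ i ∈ Finset.range (m + 1), (p i : PowerSeries L) *
      PowerSeries.expand (q ^ i) (pow_ne_zero _ hq0) f = 0) (n : ℕ) :
    PowerSeries.coeff n f ∈ S := by
  induction n using Nat.strong_induction_on with
  | _ n ih =>
  set v := (p 0).natTrailingDegree with hv
  rcases le_or_gt n v with hn | hn
  · exact hf n hn
  have hlead : (p 0).coeff v ≠ 0 := fun h => hp0 (trailingCoeff_eq_zero.1 h)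
  rw [Finset.sum_range_succ'] at hrel
  have h1 := congrArg (PowerSeries.coeff (v + n)) hrel
  rw [map_add, map_sum, map_zero] at h1
  have h2 : ∑ i ∈ Finset.range m, PowerSeries.coeff (v + n) ((p (i + 1) : PowerSeries L) *
      PowerSeries.expand (q ^ (i + 1)) (pow_ne_zero _ hq0) f) ∈ S := by
    refine sum_mem fun i hi => ?_
    rw [PowerSeries.coeff_mul]
    refine sum_mem fun x hx => ?_
    rw [Polynomial.coeff_coe, PowerSeries.coeff_expand]
    refine mul_mem (hp _ (by have := Finset.mem_range.1 hi; omega) _) ?_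
    split_ifs
    · refine ih _ ?_
      have h3 := Finset.HasAntidiagonal.mem_antidiagonal.1 hx
      have h4 : 2 ≤ q ^ (i + 1) := hq.trans (Nat.le_self_pow (by omega) q)
      calc x.2 / q ^ (i + 1) ≤ x.2 / 2 := Nat.div_le_div_left h4 (by omega)
        _ < n := by omega
    · exact zero_mem S
  have h5 := eq_neg_of_add_eq_zero_right h1
  simp only [pow_zero, PowerSeries.expand_one, AlgHom.id_apply, PowerSeries.coeff_mul] at h5
  have hmem : (v, n) ∈ Finset.HasAntidiagonal.antidiagonal (v + n) :=
    Finset.HasAntidiagonal.mem_antidiagonal.2 rfl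
  rw [← Finset.add_sum_erase _ _ hmem, Polynomial.coeff_coe] at h5
  have h6 : (p 0).coeff v * PowerSeries.coeff n f ∈ S := by
    rw [eq_sub_of_add_eq h5]
    refine sub_mem (by simpa only [PowerSeries.coeff_mul] using neg_mem h2) (sum_mem fun x hx => ?_)
    obtain ⟨hx1, hx2⟩ := Finset.mem_erase.1 hx
    have hx3 := Finset.HasAntidiagonal.mem_antidiagonal.1 hx2
    rw [Polynomial.coeff_coe]
    rcases lt_or_ge x.1 v with hxv | hxv
    · rw [coeff_eq_zero_of_lt_natTrailingDegree hxv, zero_mul]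
      exact zero_mem S
    · refine mul_mem (hp 0 (Nat.zero_le _) _) (ih _ ?_)
      have : x.2 ≠ n := fun h => hx1 (Prod.ext (by omega) h)
      omega
  simpa [hlead] using mul_mem (inv_mem (hp 0 (Nat.zero_le m) v)) h6

/-- A Mahler function over an algebraic extension of `ℚ` converging at `α`, `0 < |α| < 1`,
satisfies a Mahler equation whose leading coefficient does not vanish at `α`. -/
theorem exists_mahler_relation_eval_ne_zero_of_isAlgebraic {k : Type*} [Field k] [Algebra ℚ k]
    [Algebra.IsAlgebraic ℚ k] (φ : k →+* ℂ)
    {q : ℕ} (hq : 2 ≤ q) (hq0 : q ≠ 0) {α : k} (hα0 : α ≠ 0) (hα1 : ‖φ α‖ < 1)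
    {f : PowerSeries k} (hf0 : f ≠ 0) (hf : f ∈ Conv φ ‖φ α‖) {m₀ : ℕ} {p₀ : ℕ → k[X]}
    (hne : ∃ i ≤ m₀, p₀ i ≠ 0)
    (hrel : ∑ i ∈ Finset.range (m₀ + 1), (p₀ i : PowerSeries k) *
      PowerSeries.expand (q ^ i) (pow_ne_zero _ hq0) f = 0) :
    ∃ (a : k[X]) (M l : ℕ) (c : ℕ → k[X]), a.eval α ≠ 0 ∧
      (a : PowerSeries k) * f = ∑ i ∈ Finset.range M, (c i : PowerSeries k) *
        PowerSeries.expand (q ^ (l + 1 + i)) (pow_ne_zero _ hq0) f := by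
  obtain ⟨m, p, -, hp0, -, hp, hrel, -⟩ := exists_minimal_relation hq0 hf0 hne hrel
  let s : Set k := {α} ∪ (⋃ i ∈ Finset.range (m + 1), ((p i).coeffs : Set k)) ∪
    (fun n => PowerSeries.coeff n f) '' Set.Iic (p 0).natTrailingDegree
  have hs : s.Finite := ((Set.finite_singleton α).union
    ((Finset.range (m + 1)).finite_toSet.biUnion fun i _ => (p i).coeffs.finite_toSet)).union
    ((Set.finite_Iic _).image _)
  have : Finite s := hs
  let K := IntermediateField.adjoin ℚ s
  have hsK : s ⊆ K := IntermediateField.subset_adjoin ℚ s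
  have hfd : FiniteDimensional ℚ K := IntermediateField.finiteDimensional_adjoin fun x _ =>
    Algebra.IsIntegral.isIntegral x
  have : CharZero k := algebraRat.charZero k
  have : NumberField K := by
    refine @NumberField.mk K _ inferInstance ?_
    convert hfd
    exact Subsingleton.elim _ _
  have hαK : α ∈ K := hsK (Or.inl (Or.inl rfl))
  have hpK : ∀ i n, (p i).coeff n ∈ K := fun i n => by
    by_cases h0 : (p i).coeff n = 0
    · rw [h0]
      exact zero_mem K
    have hi : i ≤ m := by
      by_contra hi
      exact h0 (by rw [hp i (by omega), coeff_zero])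
    exact hsK (Or.inl (Or.inr (Set.mem_biUnion (Finset.mem_coe.2 (Finset.mem_range.2 (by omega)))
      (coeff_mem_coeffs h0))))
  have hfK : ∀ n, PowerSeries.coeff n f ∈ K := coeff_mem_of_mahler_relation K.toSubfield hq hq0 hp0
    (fun i _ => hpK i) (fun n hn => hsK (Or.inr ⟨n, hn, rfl⟩)) hrel
  let ψ : K →+* k := algebraMap K k
  obtain ⟨g, hg⟩ : ∃ g : PowerSeries K, PowerSeries.map ψ g = f :=
    ⟨PowerSeries.mk fun n => ⟨_, hfK n⟩, by ext n; simp [ψ]⟩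
  rw [← hg] at hf0 hf hrel ⊢
  have hlift : ∀ i, ∃ r : K[X], r.map ψ = p i := fun i =>
    (lifts_iff_coeff_lifts (p i)).2 fun n => ⟨⟨_, hpK i n⟩, rfl⟩
  choose r hr using hlift
  have hinj := PowerSeries.map_injective ψ ψ.injective
  obtain ⟨a, M, l, c, ha, hac⟩ := exists_mahler_relation_eval_ne_zero (φ.comp ψ) hq hq0
    (α := (⟨α, hαK⟩ : K)) (f := g) (m₀ := m) (p₀ := r) (fun h => hα0 (congrArg Subtype.val h)) hα1
    (fun h => hf0 (by rw [h, map_zero]))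
    (by simpa [Conv.mem_iff, show ψ ⟨α, hαK⟩ = α from rfl] using hf)
    ⟨0, Nat.zero_le _, fun h => hp0 (by rw [← hr, h, Polynomial.map_zero])⟩ (hinj (by
      simpa only [map_sum, map_mul, map_zero, PowerSeries.map_expand, ← polynomial_map_coe, hr]
        using hrel))
  refine ⟨a.map ψ, M, l, fun i => (c i).map ψ, fun h => ha ?_, ?_⟩
  · have h1 : (a.map ψ).eval (ψ ⟨α, hαK⟩) = 0 := h
    rw [eval_map_apply] at h1
    exact (map_eq_zero ψ).1 h1
  · simpa only [map_sum, map_mul, PowerSeries.map_expand, ← polynomial_map_coe] using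
      congrArg (PowerSeries.map ψ) hac

theorem polyPS_apply (p : ℂ[X]) : polyPS p = (p : PowerSeries ℂ) := rfl

theorem psSigma_iterate {q : ℕ} (hq0 : q ≠ 0) (f : PowerSeries ℂ) (i : ℕ) :
    (psSigma q)^[i] f = PowerSeries.expand (q ^ i) (pow_ne_zero _ hq0) f := by
  have h1 : ∀ g, psSigma q g = PowerSeries.expand (q ^ 1) (pow_ne_zero _ hq0) g := fun g => by
    ext n
    rw [psSigma, PowerSeries.coeff_mk, PowerSeries.coeff_expand, pow_one]
  induction i with
  | zero => simp
  | succ i ih =>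
    rw [Function.iterate_succ_apply', ih, h1, ← expand_pow_add hq0]
    simp only [add_comm 1]

/-- A Mahler function `f` over an algebraic extension of `ℚ` satisfies an equation
`g f = ∑ cᵢ σ^(i+1) f` whose leading coefficient `g` does not vanish at any nonzero point of the
open unit disk at which `f` converges absolutely. -/
theorem exists_mahler_relation_forall_eval_ne_zero {k : Type*} [Field k] [Algebra ℚ k]
    [Algebra.IsAlgebraic ℚ k] (φ : k →+* ℂ) {q : ℕ} (hq : 2 ≤ q) (hq0 : q ≠ 0)
    {f : PowerSeries k} {m₀ : ℕ} {p₀ : ℕ → k[X]} (hne : ∃ i ≤ m₀, p₀ i ≠ 0)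
    (hrel : ∑ i ∈ Finset.range (m₀ + 1), (p₀ i : PowerSeries k) *
      PowerSeries.expand (q ^ i) (pow_ne_zero _ hq0) f = 0) :
    ∃ (a : k[X]) (M : ℕ) (c : ℕ → k[X]), a ≠ 0 ∧
      (∀ α : k, α ≠ 0 → ‖φ α‖ < 1 → f ∈ Conv φ ‖φ α‖ → a.eval α ≠ 0) ∧
      (a : PowerSeries k) * f = ∑ i ∈ Finset.range M, (c i : PowerSeries k) *
        PowerSeries.expand (q ^ (i + 1)) (pow_ne_zero _ hq0) f := by
  rcases eq_or_ne f 0 with rfl | hf0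
  · exact ⟨1, 0, 0, one_ne_zero, by simp, by simp⟩
  let N : Submodule k[X] (PowerSeries k) := Submodule.span k[X]
    (Set.range fun i : ℕ => PowerSeries.expand (q ^ (i + 1)) (pow_ne_zero _ hq0) f)
  let J : Ideal k[X] := N.comap (LinearMap.toSpanSingleton k[X] (PowerSeries k) f)
  have hJ : ∀ a : k[X], a ∈ J ↔ (a : PowerSeries k) * f ∈ N := fun a => by
    rw [Submodule.mem_comap, LinearMap.toSpanSingleton_apply, Algebra.smul_def,
      algebraMap_polynomial_powerSeries]
  have hN : ∀ (c : k[X]) (i : ℕ), 1 ≤ i → (c : PowerSeries k) *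
      PowerSeries.expand (q ^ i) (pow_ne_zero _ hq0) f ∈ N := fun c i hi => by
    obtain ⟨j, rfl⟩ := Nat.exists_eq_add_of_le' hi
    rw [← algebraMap_polynomial_powerSeries, ← Algebra.smul_def]
    exact N.smul_mem _ (Submodule.subset_span ⟨j, rfl⟩)
  let g := Submodule.IsPrincipal.generator J
  have hg : ∀ a ∈ J, g ∣ a := fun a ha => (Submodule.IsPrincipal.mem_iff_generator_dvd J).1 ha
  have hg0 : g ≠ 0 := by
    obtain ⟨m, p, hm, hp0, -, -, hrel, -⟩ := exists_minimal_relation hq0 hf0 hne hrel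
    refine ne_zero_of_dvd_ne_zero hp0 (hg _ ((hJ _).2 ?_))
    rw [Finset.sum_range_succ'] at hrel
    have h1 := eq_neg_of_add_eq_zero_right hrel
    simp only [pow_zero, PowerSeries.expand_one, AlgHom.id_apply] at h1
    rw [h1]
    exact neg_mem (sum_mem fun i _ => hN _ _ (by omega))
  obtain ⟨c, hc⟩ := Finsupp.mem_span_range_iff_exists_finsupp.1
    ((hJ g).1 (Submodule.IsPrincipal.generator_mem J))
  obtain ⟨M, hM⟩ := c.support.exists_nat_subset_range
  refine ⟨g, M, c, hg0, fun α hα0 hα1 hf h0 => ?_, ?_⟩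
  · obtain ⟨a, M, l, c, ha, hac⟩ :=
      exists_mahler_relation_eval_ne_zero_of_isAlgebraic φ hq hq0 hα0 hα1 hf0 hf hne hrel
    refine ha (eval_eq_zero_of_dvd_of_eval_eq_zero (hg a ((hJ a).2 ?_)) h0)
    rw [hac]
    exact sum_mem fun i _ => hN _ _ (by omega)
  · rw [← hc, Finsupp.sum_of_support_subset c hM _ fun i _ => by rw [zero_smul]]
    refine Finset.sum_congr rfl fun i _ => ?_
    rw [Algebra.smul_def, algebraMap_polynomial_powerSeries]

end MahlerRelations

/-- Every M_q-function analytic on the open disk `D(0,R)`, `0 < R ≤ 1`, is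
annihilated by an M_q-operator of level `R`: there are `a₀, …, a_m ∈ ℚ̄[z]` with `a₀ ≠ 0`
having no root in `D*(0,R)` such that `a₀(z) f(z) + ⋯ + a_m(z) f(z^{q^m}) = 0`. -/
theorem Mq_function_killed_by_level_R_operator
    (q : ℕ) (hq : 2 ≤ q) (R : ℝ) (hR0 : 0 < R) (hR1 : R ≤ 1)
    (f : PowerSeries ℂ) (hf : IsM q f) (hfa : AnOnBall f R) :
    ∃ (m : ℕ) (a : ℕ → Polynomial ℂ),
      (∀ i k, IsAlgebraic ℚ ((a i).coeff k)) ∧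
      a 0 ≠ 0 ∧
      (∀ z : ℂ, z ≠ 0 → ‖z‖ < R → Polynomial.eval z (a 0) ≠ 0) ∧
      ∑ i ∈ Finset.range (m + 1), polyPS (a i) * (psSigma q)^[i] f = 0 := by
  have hq0 : q ≠ 0 := by omega
  obtain ⟨halg, m₀, p, hp, hne, hrel⟩ := hf
  have : Algebra.IsAlgebraic ℚ (algebraicClosure ℚ ℂ) := algebraicClosure.isAlgebraic ℚ ℂ
  let φ : algebraicClosure ℚ ℂ →+* ℂ := algebraMap _ ℂ
  obtain ⟨g, rfl⟩ : ∃ g, PowerSeries.map φ g = f :=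
    ⟨PowerSeries.mk fun n => ⟨_, mem_algebraicClosure_iff.2 (halg n)⟩, by ext n; simp [φ]⟩
  have hlift : ∀ i, ∃ r : Polynomial (algebraicClosure ℚ ℂ), r.map φ = p i := fun i =>
    (Polynomial.lifts_iff_coeff_lifts (p i)).2 fun n =>
      ⟨⟨_, mem_algebraicClosure_iff.2 (hp i n)⟩, rfl⟩
  choose r hr using hlift
  have hinj := PowerSeries.map_injective φ φ.injective
  obtain ⟨a, M, c, ha0, ha, hac⟩ := exists_mahler_relation_forall_eval_ne_zero φ hq hq0 (f := g)
    (m₀ := m₀) (p₀ := r)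
    (hne.imp fun i hi => ⟨hi.1, fun h => hi.2 (by rw [← hr, h, Polynomial.map_zero])⟩) (hinj (by
      simpa only [map_sum, map_mul, map_zero, PowerSeries.map_expand,
        ← Polynomial.polynomial_map_coe, hr, polyPS_apply, psSigma_iterate hq0] using hrel))
  have ha0' : a.map φ ≠ 0 := (Polynomial.map_ne_zero_iff φ.injective).2 ha0
  refine ⟨M, fun i => if i = 0 then a.map φ else -(c (i - 1)).map φ, fun i n => ?_, ?_,
    fun z hz0 hzR hz => ?_, ?_⟩
  · have h1 : ∀ y, IsAlgebraic ℚ (φ y) := fun y => mem_algebraicClosure_iff.1 y.2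
    beta_reduce
    split_ifs
    · rw [Polynomial.coeff_map]
      exact h1 _
    · rw [Polynomial.coeff_neg, Polynomial.coeff_map]
      exact (h1 _).neg
  · exact ha0'
  · have hz1 : IsAlgebraic (algebraicClosure ℚ ℂ) z :=
      ⟨a, ha0, by rwa [Polynomial.aeval_def, ← Polynomial.eval_map]⟩
    have hz2 : IsAlgebraic ℚ z := hz1.restrictScalars ℚ
    have hz3 : φ ⟨z, mem_algebraicClosure_iff.2 hz2⟩ = z := rfl
    refine ha ⟨z, mem_algebraicClosure_iff.2 hz2⟩ (fun h => hz0 (congrArg Subtype.val h))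
      (hzR.trans_le hR1) ?_ (φ.injective ?_)
    · have h2 := (hfa (‖z‖ : ℂ) (by simpa using hzR)).norm
      rw [Conv.mem_iff, hz3]
      simpa only [PowerSeries.coeff_map] using h2
    · rw [map_zero, ← Polynomial.eval_map_apply]
      exact hz
  · have h1 := congrArg (PowerSeries.map φ) hac
    simp only [map_sum, map_mul, PowerSeries.map_expand] at h1
    rw [Finset.sum_range_succ']
    simp [polyPS_apply, psSigma_iterate hq0, h1]
end
end
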